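/- arXiv:1807.10098 — 2 statements merged into one kernel-verified Lean document; each statement's English description precedes it below -/
import Mathlib

section
/- (Theorem 2, nodal case.) Let l > 0 be fixed and let k ≥ 2 be a fixed integer. Then there exist γ̄ > 0 and, for each γ > γ̄, real numbers λ̄_γ and β_γ > 0 and a smooth radially symmetric function u_γ on Ω̄ such that: λ_k − λ̄_γ = (1 + o(1)) (4π v_k(0)/γ) √(λ_k/l) as γ → +∞; u_γ solves Δu_γ = λ̄_γ u_γ + β_γ u_γ exp(u_γ²) in Ω with u_γ = 0 on ∂Ω and u_γ(0) = γ; and, as γ → +∞, β_γ → 0, u_γ ⇀ √(l/λ_k) v_k weakly in H¹₀(Ω) (a nontrivial limit), and ∫_Ω |∇u_γ|² dy = 4π + l + o(1). The solutions u_γ are sign-changing with exactly k nodal regions in Ω. -/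
open Real Set Filter MeasureTheory Topology

noncomputable section

/-- The radial Laplacian with the sign convention Δ = −div(∇·):
for a radial C² function, (Δu)(r) = −u''(r) − u'(r)/r. -/
def radLap (u : ℝ → ℝ) (r : ℝ) : ℝ := -(deriv (deriv u) r) - deriv u r / r

/-- Dirichlet energy ∫_Ω |∇u|² dy of a radial function, = ∫₀¹ u'(r)² 2πr dr. -/
def dirEnergy (u : ℝ → ℝ) : ℝ := ∫ r in Set.Ioo (0:ℝ) 1, (deriv u r) ^ 2 * (2 * π * r)

/-- `RadialEigen k lamk vk` : λ_k is the k-th radial Dirichlet eigenvalue of Δ = −div∇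
on the unit disk (k ≥ 1), with radial eigenfunction v_k normalized by ∫_Ω v_k² dy = 1 and
v_k(0) > 0; being the k-th radial eigenfunction, v_k has exactly k nodal regions, i.e.
exactly k − 1 zeros in (0,1). -/
def RadialEigen (k : ℕ) (lamk : ℝ) (vk : ℝ → ℝ) : Prop :=
  0 < lamk ∧ ContDiffOn ℝ (⊤ : ℕ∞) vk (Set.Icc 0 1) ∧
    (∀ r ∈ Set.Ioo (0:ℝ) 1, radLap vk r = lamk * vk r) ∧
    vk 1 = 0 ∧ 0 < vk 0 ∧
    (∫ r in Set.Ioo (0:ℝ) 1, (vk r) ^ 2 * (2 * π * r)) = 1 ∧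
    {r : ℝ | r ∈ Set.Ioo (0:ℝ) 1 ∧ vk r = 0}.ncard = k - 1

/-- The average `∫₀¹ θ ^ j F (θ s) dθ`. -/
def dilAvg (j : ℕ) (F : ℝ → ℝ) (s : ℝ) : ℝ := ∫ θ in (0:ℝ)..1, θ ^ j * F (θ * s)

lemma continuous_dilAvg (j : ℕ) {F : ℝ → ℝ} (hF : Continuous F) : Continuous (dilAvg j F) := by
  apply intervalIntegral.continuous_parametric_intervalIntegral_of_continuous'
  unfold Function.uncurry
  fun_prop

lemma hasDerivAt_dilAvg (j : ℕ) {F : ℝ → ℝ} (hF : ContDiff ℝ 1 F) (s : ℝ) :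
    HasDerivAt (dilAvg j F) (dilAvg (j + 1) (deriv F) s) s := by
  have hc := hF.continuous
  have hd : Continuous (deriv F) := hF.continuous_deriv le_rfl
  have hcomp : IsCompact (Set.Icc (0:ℝ) 1 ×ˢ Metric.closedBall s 1) :=
    isCompact_Icc.prod (isCompact_closedBall _ _)
  obtain ⟨C, hC⟩ := hcomp.exists_bound_of_continuousOn
    (f := fun p : ℝ × ℝ => p.1 ^ (j + 1) * deriv F (p.1 * p.2)) (by fun_prop)
  refine (intervalIntegral.hasDerivAt_integral_of_dominated_loc_of_deriv_le
    (F := fun x θ => θ ^ j * F (θ * x)) (F' := fun x θ => θ ^ (j + 1) * deriv F (θ * x))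
    (s := Metric.ball s 1) (bound := fun _ => C) (Metric.ball_mem_nhds _ one_pos) ?_ ?_ ?_ ?_ ?_ ?_).2
  · exact Eventually.of_forall fun x => (by fun_prop : Continuous _).aestronglyMeasurable
  · exact (by fun_prop : Continuous fun θ => θ ^ j * F (θ * s)).intervalIntegrable _ _
  · exact (by fun_prop : Continuous _).aestronglyMeasurable
  · refine Eventually.of_forall fun θ hθ x hx => hC (θ, x) ⟨?_, Metric.ball_subset_closedBall hx⟩
    rw [uIoc_of_le zero_le_one] at hθ
    exact ⟨hθ.1.le, hθ.2⟩
  · simp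
  · refine Eventually.of_forall fun θ _ x _ => ?_
    have h1 : HasDerivAt F (deriv F (θ * x)) (θ * x) :=
      (hF.differentiable one_ne_zero).differentiableAt.hasDerivAt
    have h2 := (h1.comp x ((hasDerivAt_id x).const_mul θ)).const_mul (θ ^ j)
    refine h2.congr_deriv ?_
    ring

lemma contDiff_dilAvg (n : ℕ) : ∀ (j : ℕ) {F : ℝ → ℝ}, ContDiff ℝ n F →
    ContDiff ℝ n (dilAvg j F) := by
  induction n with
  | zero =>
    intro j F hF
    exact contDiff_zero.2 (continuous_dilAvg j (contDiff_zero.1 hF))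
  | succ n ih =>
    intro j F hF
    have h1 : ContDiff ℝ 1 F := hF.of_le (by norm_cast; omega)
    have h2 := hF
    push_cast at h2 ⊢
    rw [contDiff_succ_iff_deriv] at h2 ⊢
    refine ⟨fun s => (hasDerivAt_dilAvg j h1 s).differentiableAt, by simp, ?_⟩
    have : deriv (dilAvg j F) = dilAvg (j + 1) (deriv F) :=
      funext fun s => (hasDerivAt_dilAvg j h1 s).deriv
    rw [this]
    exact ih _ h2.2.2

lemma hasDerivAt_mul_dilAvg {F : ℝ → ℝ} (hF : Continuous F) (s : ℝ) :
    HasDerivAt (fun x => x * dilAvg 0 F x) (F s) s := by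
  have : (fun x => x * dilAvg 0 F x) = fun x => ∫ σ in (0:ℝ)..x, F σ := by
    funext x
    have := intervalIntegral.smul_integral_comp_mul_right (a := 0) (b := 1) F x
    simpa only [dilAvg, pow_zero, one_mul, zero_mul, smul_eq_mul] using this
  rw [this]
  exact intervalIntegral.integral_hasDerivAt_right (hF.intervalIntegrable _ _)
    (hF.stronglyMeasurableAtFilter _ _) hF.continuousAt

/-- A smooth solution of the regularised equation `s w'' + w' = -g(w)`, `w 0 = γ`. -/
lemma contDiff_of_eq_dilAvg {g w : ℝ → ℝ} {γ : ℝ} (hg : ContDiff ℝ (⊤ : ℕ∞) g) (hw : Continuous w)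
    (h : ∀ s, w s = γ - s * dilAvg 0 (dilAvg 0 (fun x => g (w x))) s) :
    ContDiff ℝ (⊤ : ℕ∞) w ∧ ∀ s, HasDerivAt w (-dilAvg 0 (fun x => g (w x)) s) s := by
  have hgw : Continuous fun x => g (w x) := hg.continuous.comp hw
  have hd : ∀ s, HasDerivAt w (-dilAvg 0 (fun x => g (w x)) s) s := by
    intro s
    have := (hasDerivAt_mul_dilAvg (continuous_dilAvg 0 hgw) s).const_sub γ
    exact this.congr_of_eventuallyEq (Eventually.of_forall h)
  refine ⟨?_, hd⟩
  have hder : deriv w = fun s => -dilAvg 0 (fun x => g (w x)) s := funext fun s => (hd s).deriv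
  rw [contDiff_infty]
  intro n
  induction n with
  | zero => exact contDiff_zero.2 hw
  | succ n ih =>
    push_cast
    rw [contDiff_succ_iff_deriv]
    refine ⟨fun s => (hd s).differentiableAt, by simp, ?_⟩
    rw [hder]
    exact (contDiff_dilAvg n 0 ((hg.of_le (by exact_mod_cast le_top)).comp ih)).neg

lemma abs_dilAvg_le {F : ℝ → ℝ} {B s : ℝ} (hB : ∀ θ ∈ Set.Icc (0:ℝ) 1, |F (θ * s)| ≤ B) :
    |dilAvg 0 F s| ≤ B := by
  have := intervalIntegral.norm_integral_le_of_norm_le_const (a := 0) (b := 1)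
    (f := fun θ => θ ^ 0 * F (θ * s)) (C := B) (by
      intro θ hθ
      rw [uIoc_of_le zero_le_one] at hθ
      simpa using hB θ ⟨hθ.1.le, hθ.2⟩)
  simpa [dilAvg] using this

lemma mul_dilAvg_exp_le {F : ℝ → ℝ} {K D s : ℝ} (hK : 0 < K) (hD : 0 ≤ D)
    (hB : ∀ θ ∈ Set.Icc (0:ℝ) 1, |F (θ * s)| ≤ D * exp (K * (θ * |s|))) :
    |s * dilAvg 0 F s| ≤ D / K * exp (K * |s|) := by
  have h1 : |dilAvg 0 F s| ≤ ∫ θ in (0:ℝ)..1, D * exp (K * (θ * |s|)) := by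
    rw [← Real.norm_eq_abs]
    refine intervalIntegral.norm_integral_le_of_norm_le zero_le_one ?_ ?_
    · refine Eventually.of_forall fun θ hθ => ?_
      simpa using hB θ ⟨hθ.1.le, hθ.2⟩
    · exact (by fun_prop : Continuous _).intervalIntegrable _ _
  have h2 : ∫ θ in (0:ℝ)..1, |s| * (D * exp (K * (θ * |s|))) = D / K * exp (K * |s|) - D / K := by
    have : ∀ θ ∈ Set.uIcc (0:ℝ) 1, HasDerivAt (fun θ => D / K * exp (K * (θ * |s|)))
        (|s| * (D * exp (K * (θ * |s|)))) θ := by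
      intro θ _
      have h3 := ((((hasDerivAt_id θ).mul_const |s|).const_mul K).exp).const_mul (D / K)
      refine h3.congr_deriv ?_
      simp only [id, one_mul]
      field_simp
    rw [intervalIntegral.integral_eq_sub_of_hasDerivAt this
      ((by fun_prop : Continuous _).intervalIntegrable _ _)]
    simp
  rw [abs_mul]
  calc |s| * |dilAvg 0 F s| ≤ |s| * ∫ θ in (0:ℝ)..1, D * exp (K * (θ * |s|)) := by gcongr
    _ = D / K * exp (K * |s|) - D / K := by rw [← h2, intervalIntegral.integral_const_mul |s|]
    _ ≤ _ := by have : 0 ≤ D / K := by positivity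
                linarith

/-- Weighted Picard map. -/
lemma exists_eq_dilAvg {g : ℝ → ℝ} (hg : Continuous g) {C B : ℝ} (hC : 0 < C)
    (hL : ∀ x y, |g x - g y| ≤ C * |x - y|) (hB : ∀ x, |g x| ≤ B) (γ : ℝ) :
    ∃ w : ℝ → ℝ, Continuous w ∧
      ∀ s, w s = γ - s * dilAvg 0 (dilAvg 0 (fun x => g (w x))) s := by
  set K : ℝ := 2 * C with hK
  have hK0 : 0 < K := by positivity
  have hB0 : 0 ≤ B := (abs_nonneg _).trans (hB 0)
  let G : (BoundedContinuousFunction ℝ ℝ) → ℝ → ℝ := fun v x => g (exp (K * |x|) * v x)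
  have hG : ∀ v, Continuous (G v) := fun v => by
    have := v.continuous
    simp only [G]; fun_prop
  let Φ : (BoundedContinuousFunction ℝ ℝ) → ℝ → ℝ := fun v s =>
    exp (-(K * |s|)) * (γ - s * dilAvg 0 (dilAvg 0 (G v)) s)
  have hΦc : ∀ v, Continuous (Φ v) := fun v => by
    have := continuous_dilAvg 0 (continuous_dilAvg 0 (hG v))
    simp only [Φ]; fun_prop
  have hee : ∀ s, exp (-(K * |s|)) * exp (K * |s|) = 1 := fun s => by
    rw [← exp_add]; simp
  have hΦb : ∀ v s, ‖Φ v s‖ ≤ |γ| + B / K := by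
    intro v s
    have h1 : |s * dilAvg 0 (dilAvg 0 (G v)) s| ≤ B / K * exp (K * |s|) := by
      refine mul_dilAvg_exp_le hK0 hB0 fun θ hθ => ?_
      refine (abs_dilAvg_le (F := G v) (B := B) fun _ _ => hB _).trans ?_
      have : 1 ≤ exp (K * (θ * |s|)) := one_le_exp (by have := hθ.1; positivity)
      nlinarith
    have h2 : exp (-(K * |s|)) ≤ 1 := exp_le_one_iff.2 (by have := abs_nonneg s; nlinarith)
    rw [Real.norm_eq_abs, abs_mul, abs_of_pos (exp_pos _)]
    calc _ ≤ exp (-(K * |s|)) * (|γ| + B / K * exp (K * |s|)) := by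
          gcongr; exact (abs_sub _ _).trans (by gcongr)
      _ = exp (-(K * |s|)) * |γ| + B / K * (exp (-(K * |s|)) * exp (K * |s|)) := by ring
      _ ≤ _ := by rw [hee]; nlinarith [abs_nonneg γ]
  let T : (BoundedContinuousFunction ℝ ℝ) → (BoundedContinuousFunction ℝ ℝ) := fun v =>
    BoundedContinuousFunction.ofNormedAddCommGroup (Φ v) (hΦc v) _ (hΦb v)
  have hT : ContractingWith (1/2) T := by
    refine ⟨by rw [← NNReal.coe_lt_coe]; norm_num, LipschitzWith.of_dist_le_mul fun v v' => ?_⟩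
    rw [BoundedContinuousFunction.dist_le (by positivity)]
    intro s
    have h0 : T v s - T v' s = -(exp (-(K * |s|)) *
        (s * dilAvg 0 (fun x => dilAvg 0 (fun y => G v y - G v' y) x) s)) := by
      have e1 : ∀ x, dilAvg 0 (fun y => G v y - G v' y) x = dilAvg 0 (G v) x - dilAvg 0 (G v') x := by
        intro x
        have := hG v
        have := hG v'
        simp only [dilAvg, mul_sub]
        exact intervalIntegral.integral_sub
          ((by fun_prop : Continuous _).intervalIntegrable _ _)
          ((by fun_prop : Continuous _).intervalIntegrable _ _)
      have e2 : dilAvg 0 (fun x => dilAvg 0 (fun y => G v y - G v' y) x) s =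
          dilAvg 0 (dilAvg 0 (G v)) s - dilAvg 0 (dilAvg 0 (G v')) s := by
        simp only [e1]
        have := continuous_dilAvg 0 (hG v)
        have := continuous_dilAvg 0 (hG v')
        conv_lhs => unfold dilAvg
        simp only [mul_sub]
        exact intervalIntegral.integral_sub
          ((by fun_prop : Continuous fun θ : ℝ => θ ^ 0 * dilAvg 0 (G v) (θ * s)).intervalIntegrable _ _)
          ((by fun_prop : Continuous fun θ : ℝ => θ ^ 0 * dilAvg 0 (G v') (θ * s)).intervalIntegrable _ _)
      rw [e2]
      simp only [T, Φ, BoundedContinuousFunction.coe_ofNormedAddCommGroup]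
      ring
    have hdiff : ∀ y, |G v y - G v' y| ≤ C * dist v v' * exp (K * |y|) := by
      intro y
      refine (hL _ _).trans ?_
      rw [← mul_sub, abs_mul, abs_of_pos (exp_pos _)]
      have : |v y - v' y| ≤ dist v v' := by
        have := BoundedContinuousFunction.dist_coe_le_dist (f := v) (g := v') y
        rwa [Real.dist_eq] at this
      calc _ ≤ C * (exp (K * |y|) * dist v v') := by gcongr
        _ = _ := by ring
    have h1 : |s * dilAvg 0 (fun x => dilAvg 0 (fun y => G v y - G v' y) x) s| ≤
        C * dist v v' / K * exp (K * |s|) := by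
      refine mul_dilAvg_exp_le hK0 (by positivity)
        fun θ hθ => abs_dilAvg_le fun θ' hθ' => (hdiff _).trans ?_
      gcongr
      rw [abs_mul, abs_mul, abs_of_nonneg hθ.1, abs_of_nonneg hθ'.1]
      have := mul_le_of_le_one_left (mul_nonneg hθ.1 (abs_nonneg s)) hθ'.2
      linarith
    rw [Real.dist_eq, h0, abs_neg, abs_mul, abs_of_pos (exp_pos _)]
    calc _ ≤ exp (-(K * |s|)) * (C * dist v v' / K * exp (K * |s|)) := by gcongr
      _ = C * dist v v' / K * (exp (-(K * |s|)) * exp (K * |s|)) := by ring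
      _ = _ := by rw [hee, hK]; push_cast; field_simp
  obtain ⟨v, hv⟩ : ∃ v, T v = v := ⟨_, hT.fixedPoint_isFixedPt⟩
  refine ⟨fun x => exp (K * |x|) * v x, by have := v.continuous; fun_prop, fun s => ?_⟩
  have h1 : v s = exp (-(K * |s|)) * (γ - s * dilAvg 0 (dilAvg 0 (G v)) s) := by
    conv_lhs => rw [← hv]
    rfl
  show exp (K * |s|) * v s = γ - s * dilAvg 0 (dilAvg 0 (G v)) s
  rw [h1, ← mul_assoc, mul_comm (exp (K * |s|)), hee, one_mul]

/-- Continuity argument: if `φ ≤ 0` up to time `t` improves to `φ t < 0`, then `φ < 0`. -/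
lemma bootstrap_neg {φ : ℝ → ℝ} {a b : ℝ} (hφ : ContinuousOn φ (Set.Icc a b)) (ha : φ a < 0)
    (h : ∀ t ∈ Set.Icc a b, (∀ τ ∈ Set.Icc a t, φ τ ≤ 0) → φ t < 0) :
    ∀ t ∈ Set.Icc a b, φ t < 0 := by
  by_contra! hcon
  obtain ⟨t, ht, hpos⟩ := hcon
  set S : Set ℝ := Set.Icc a b ∩ φ ⁻¹' Set.Ici 0 with hS
  have hcl : IsClosed S := hφ.preimage_isClosed_of_isClosed isClosed_Icc isClosed_Ici
  have hne : S.Nonempty := ⟨t, ht, hpos⟩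
  have hbb : BddBelow S := ⟨a, fun x hx => hx.1.1⟩
  have hmem := hcl.csInf_mem hne hbb
  set t0 := sInf S
  have hlt : ∀ τ ∈ Set.Ico a t0, φ τ < 0 := by
    intro τ hτ
    by_contra! hc
    exact absurd (csInf_le hbb (show τ ∈ S from ⟨⟨hτ.1, hτ.2.le.trans hmem.1.2⟩, hc⟩))
      (not_le.2 hτ.2)
  have h0 : φ t0 ≤ 0 := by
    by_contra! hc
    obtain ⟨τ, hτ, hτ0⟩ := intermediate_value_Icc hmem.1.1
      (hφ.mono (Set.Icc_subset_Icc_right hmem.1.2)) (show (0:ℝ) ∈ Set.Icc (φ a) (φ t0) from ⟨ha.le, hc.le⟩)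
    rcases eq_or_lt_of_le hτ.2 with h1 | h1
    · rw [h1] at hτ0; linarith
    · linarith [hlt τ ⟨hτ.1, h1⟩]
  have := h t0 hmem.1 (fun τ hτ => (eq_or_lt_of_le hτ.2).elim (fun e => e ▸ h0)
    (fun e => (hlt τ ⟨hτ.1, e⟩).le))
  exact absurd hmem.2 (not_le.2 this)

/-- The (rescaled) nonlinearity `κ x + b x exp (x ^ 2)`. -/
def nonlin (κ b x : ℝ) : ℝ := κ * x + b * x * exp (x ^ 2)

lemma contDiff_nonlin (κ b : ℝ) : ContDiff ℝ (⊤ : ℕ∞) (nonlin κ b) := by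
  unfold nonlin; fun_prop

/-- `w` is the profile, in the variable `s = r ^ 2`, of a radial solution with `w 0 = γ`. -/
structure IsProfile (κ b γ : ℝ) (w : ℝ → ℝ) : Prop where
  smooth : ContDiff ℝ (⊤ : ℕ∞) w
  init : w 0 = γ
  ode : ∀ s, 0 ≤ s → HasDerivAt (fun x => x * deriv w x) (-nonlin κ b (w s)) s
  bound : ∀ s, 0 ≤ s → |w s| ≤ γ

lemma hasDerivAt_energy {κ b : ℝ} {w : ℝ → ℝ} (hw : ContDiff ℝ (⊤ : ℕ∞) w) {s : ℝ}
    (h : HasDerivAt (fun x => x * deriv w x) (-nonlin κ b (w s)) s) :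
    HasDerivAt (fun x => x * deriv w x ^ 2 + κ * w x ^ 2 + b * exp (w x ^ 2))
      (-(deriv w s) ^ 2) s := by
  have h1 : HasDerivAt w (deriv w s) s := (hw.differentiable (by simp)).differentiableAt.hasDerivAt
  have h2 : HasDerivAt (deriv w) (deriv (deriv w) s) s :=
    ((hw.of_le (by norm_cast) : ContDiff ℝ 2 w).differentiable_deriv_two).differentiableAt.hasDerivAt
  have h3 := (h.unique ((hasDerivAt_id s).mul h2))
  simp only [id] at h3
  have h4 := (((hasDerivAt_id s).mul (h2.pow 2)).add ((h1.pow 2).const_mul κ)).add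
    (((h1.pow 2).exp).const_mul b)
  refine h4.congr_deriv ?_
  unfold nonlin at h3
  simp only [id, Pi.pow_apply]
  push_cast
  linear_combination (-2 * deriv w s) * h3

lemma abs_le_of_energy_le {κ b x y : ℝ} (hκ : 0 < κ) (hb : 0 ≤ b) (hy : 0 ≤ y)
    (h : κ * x ^ 2 + b * exp (x ^ 2) ≤ κ * y ^ 2 + b * exp (y ^ 2)) : |x| ≤ y := by
  by_contra! hc
  have h1 : y ^ 2 < x ^ 2 := by rw [← sq_abs x]; gcongr
  have h2 : exp (y ^ 2) ≤ exp (x ^ 2) := exp_le_exp.2 h1.le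
  nlinarith [mul_lt_mul_of_pos_left h1 hκ, mul_le_mul_of_nonneg_left h2 hb]

theorem exists_isProfile {κ b γ : ℝ} (hκ : 0 < κ) (hb : 0 ≤ b) (hγ : 0 < γ) :
    ∃ w, IsProfile κ b γ w := by
  let φ : ContDiffBump (0:ℝ) := ⟨γ + 1, γ + 2, by positivity, by linarith⟩
  let g : ℝ → ℝ := fun x => φ x * nonlin κ b x
  have hg : ContDiff ℝ (⊤ : ℕ∞) g := φ.contDiff.mul (contDiff_nonlin κ b)
  have hcs : HasCompactSupport g := φ.hasCompactSupport.mul_right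
  obtain ⟨C, hC⟩ := (hg.of_le (by exact_mod_cast le_top) : ContDiff ℝ 1 g).lipschitzWith_of_hasCompactSupport hcs one_ne_zero
  obtain ⟨B, hB⟩ := hcs.exists_bound_of_continuous hg.continuous
  obtain ⟨w, hwc, hw⟩ := exists_eq_dilAvg (C := C + 1) (B := B) hg.continuous (by positivity)
    (fun x y => by
      have := hC.dist_le_mul x y
      rw [Real.dist_eq, Real.dist_eq] at this
      nlinarith [abs_nonneg (x - y)]) (fun x => hB x) γ
  obtain ⟨hws, hwd⟩ := contDiff_of_eq_dilAvg hg hwc hw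
  have hgw : Continuous fun x => g (w x) := hg.continuous.comp hwc
  have hode : ∀ s, HasDerivAt (fun x => x * deriv w x) (-g (w s)) s := by
    intro s
    refine ((hasDerivAt_mul_dilAvg hgw s).neg).congr_of_eventuallyEq (Eventually.of_forall fun x => ?_)
    simp only [Pi.neg_apply]
    rw [(hwd x).deriv]; ring
  have hgeq : ∀ x, |x| ≤ γ + 1 → g x = nonlin κ b x := by
    intro x hx
    have : φ x = 1 := φ.one_of_mem_closedBall (by simpa [φ] using hx)
    simp [g, this]
  have h0 : w 0 = γ := by rw [hw 0]; ring
  have hbd : ∀ s, 0 ≤ s → |w s| < γ + 1 := by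
    intro s hs
    have := bootstrap_neg (φ := fun x => |w x| - (γ + 1)) (a := 0) (b := s)
      (by fun_prop) (by simp [h0, abs_of_pos hγ]) (fun t ht hτ => ?_) s ⟨hs, le_rfl⟩
    · linarith
    · have hanti : AntitoneOn (fun x => x * deriv w x ^ 2 + κ * w x ^ 2 + b * exp (w x ^ 2)) (Set.Icc 0 t) := by
        have hd : ∀ x ∈ Set.Icc 0 t, HasDerivAt
            (fun x => x * deriv w x ^ 2 + κ * w x ^ 2 + b * exp (w x ^ 2)) (-(deriv w x) ^ 2) x := by
          intro x hx
          refine hasDerivAt_energy hws ?_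
          rw [← hgeq _ (by have := hτ x hx; linarith)]
          exact hode x
        refine antitoneOn_of_deriv_nonpos (convex_Icc _ _)
          (fun x hx => (hd x hx).continuousAt.continuousWithinAt)
          (fun x hx => (hd x (interior_subset hx)).differentiableAt.differentiableWithinAt) ?_
        intro x hx
        rw [(hd x (interior_subset hx)).deriv]
        nlinarith [sq_nonneg (deriv w x)]
      have h1 := hanti ⟨le_rfl, ht.1⟩ ⟨ht.1, le_rfl⟩ ht.1
      simp only [h0, zero_mul, zero_add] at h1
      have : |w t| ≤ γ := abs_le_of_energy_le hκ hb hγ.le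
        (by nlinarith [mul_nonneg ht.1 (sq_nonneg (deriv w t))])
      linarith
  have hode' : ∀ s, 0 ≤ s → HasDerivAt (fun x => x * deriv w x) (-nonlin κ b (w s)) s := by
    intro s hs
    rw [← hgeq _ (hbd s hs).le]
    exact hode s
  refine ⟨w, hws, h0, hode', fun s hs => ?_⟩
  have hanti : AntitoneOn (fun x => x * deriv w x ^ 2 + κ * w x ^ 2 + b * exp (w x ^ 2)) (Set.Ici 0) := by
    have hd := fun x (hx : x ∈ Set.Ici (0:ℝ)) => hasDerivAt_energy hws (hode' x hx)
    refine antitoneOn_of_deriv_nonpos (convex_Ici _)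
      (fun x hx => (hd x hx).continuousAt.continuousWithinAt)
      (fun x hx => (hd x (interior_subset hx)).differentiableAt.differentiableWithinAt) ?_
    intro x hx
    rw [(hd x (interior_subset hx)).deriv]
    nlinarith [sq_nonneg (deriv w x)]
  have h1 := hanti (Set.mem_Ici.2 le_rfl) (Set.mem_Ici.2 hs) hs
  simp only [h0, zero_mul, zero_add] at h1
  exact abs_le_of_energy_le hκ hb hγ.le (by nlinarith [mul_nonneg hs (sq_nonneg (deriv w s))])

lemma le_of_hasDerivAt_nonneg {X X' : ℝ → ℝ} {a b : ℝ} (hab : a ≤ b)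
    (hd : ∀ t ∈ Set.Icc a b, HasDerivAt X (X' t) t) (h0 : ∀ t ∈ Set.Icc a b, 0 ≤ X' t) :
    X a ≤ X b := by
  refine (monotoneOn_of_deriv_nonneg (convex_Icc a b)
    (fun x hx => (hd x hx).continuousAt.continuousWithinAt)
    (fun x hx => (hd x (interior_subset hx)).differentiableAt.differentiableWithinAt)
    (fun x hx => ?_)) ⟨le_rfl, hab⟩ ⟨hab, le_rfl⟩ hab
  rw [(hd x (interior_subset hx)).deriv]
  exact h0 x (interior_subset hx)

lemma nonneg_of_hasDerivAt_nonneg_atBot {X X' : ℝ → ℝ} {T : ℝ}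
    (hd : ∀ t ≤ T, HasDerivAt X (X' t) t) (h0 : ∀ t ≤ T, 0 ≤ X' t)
    (hlim : Tendsto X atBot (𝓝 0)) : 0 ≤ X T := by
  refine le_of_tendsto hlim ?_
  filter_upwards [eventually_le_atBot T] with a ha
  exact le_of_hasDerivAt_nonneg ha (fun t ht => hd t ht.2) (fun t ht => h0 t ht.2)

lemma abs_nonlin_le {κ b x y : ℝ} (hκ : 0 ≤ κ) (hb : 0 ≤ b) (h : |x| ≤ y) :
    |nonlin κ b x| ≤ nonlin κ b y := by
  have h1 : x ^ 2 ≤ y ^ 2 := by rw [← sq_abs x]; gcongr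
  have h2 : exp (x ^ 2) ≤ exp (y ^ 2) := exp_le_exp.2 h1
  have hy : 0 ≤ y := (abs_nonneg x).trans h
  unfold nonlin
  refine (abs_add_le _ _).trans ?_
  rw [abs_mul, abs_mul, abs_mul, abs_of_nonneg hκ, abs_of_nonneg hb, abs_of_pos (exp_pos _)]
  gcongr

/-- A profile in the logarithmic variable `t = log s`, with `m = -dz/dt`. -/
structure IsLogProfile (κ b γ : ℝ) (z m : ℝ → ℝ) : Prop where
  hz : ∀ t, HasDerivAt z (-m t) t
  hm : ∀ t, HasDerivAt m (exp t * nonlin κ b (z t)) t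
  bound : ∀ t, |z t| ≤ γ
  m_le : ∀ t, |m t| ≤ exp t * nonlin κ b γ
  z_le : ∀ t, |z t - γ| ≤ exp t * nonlin κ b γ

lemma IsProfile.abs_mul_deriv_le {κ b γ : ℝ} {w : ℝ → ℝ} (hκ : 0 ≤ κ) (hb : 0 ≤ b)
    (h : IsProfile κ b γ w) {s : ℝ} (hs : 0 ≤ s) : |s * deriv w s| ≤ s * nonlin κ b γ := by
  have := Convex.norm_image_sub_le_of_norm_hasDerivWithin_le (f := fun x => x * deriv w x)
    (f' := fun x => -nonlin κ b (w x)) (s := Set.Icc 0 s) (C := nonlin κ b γ) (x := 0) (y := s)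
    (fun x hx => (h.ode x hx.1).hasDerivWithinAt)
    (fun x hx => by
      rw [norm_neg]; exact abs_nonlin_le hκ hb (h.bound x hx.1))
    (convex_Icc _ _) ⟨le_rfl, hs⟩ ⟨hs, le_rfl⟩
  simpa [abs_of_nonneg hs, mul_comm] using this

lemma IsProfile.abs_deriv_le {κ b γ : ℝ} {w : ℝ → ℝ} (hκ : 0 ≤ κ) (hb : 0 ≤ b)
    (h : IsProfile κ b γ w) {s : ℝ} (hs : 0 ≤ s) : |deriv w s| ≤ nonlin κ b γ := by
  have hγ : 0 ≤ γ := (abs_nonneg _).trans (h.bound 0 le_rfl)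
  rcases eq_or_lt_of_le hs with rfl | hs
  · have h2 : HasDerivAt (deriv w) (deriv (deriv w) 0) 0 :=
      ((h.smooth.of_le (by norm_cast) : ContDiff ℝ 2 w).differentiable_deriv_two).differentiableAt.hasDerivAt
    have h3 := (h.ode 0 le_rfl).unique ((hasDerivAt_id 0).mul h2)
    simp only [one_mul, zero_mul, add_zero] at h3
    rw [← h3, abs_neg]
    exact abs_nonlin_le hκ hb (h.bound 0 le_rfl)
  · have := h.abs_mul_deriv_le hκ hb hs.le
    rw [abs_mul, abs_of_pos hs] at this
    exact le_of_mul_le_mul_left this hs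

lemma IsProfile.abs_sub_le {κ b γ : ℝ} {w : ℝ → ℝ} (hκ : 0 ≤ κ) (hb : 0 ≤ b)
    (h : IsProfile κ b γ w) {s : ℝ} (hs : 0 ≤ s) : |w s - γ| ≤ s * nonlin κ b γ := by
  have := Convex.norm_image_sub_le_of_norm_deriv_le (f := w)
    (s := Set.Icc 0 s) (C := nonlin κ b γ) (x := 0) (y := s)
    (fun x hx => (h.smooth.differentiable (by simp)).differentiableAt)
    (fun x hx => h.abs_deriv_le hκ hb hx.1)
    (convex_Icc _ _) ⟨le_rfl, hs⟩ ⟨hs, le_rfl⟩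
  simpa [abs_of_nonneg hs, mul_comm, h.init] using this

lemma IsProfile.toLog {κ b γ : ℝ} {w : ℝ → ℝ} (hκ : 0 ≤ κ) (hb : 0 ≤ b) (h : IsProfile κ b γ w) :
    IsLogProfile κ b γ (fun t => w (exp t)) (fun t => -(exp t * deriv w (exp t))) where
  hz t := by
    have h1 : HasDerivAt w (deriv w (exp t)) (exp t) :=
      (h.smooth.differentiable (by simp)).differentiableAt.hasDerivAt
    refine (h1.comp t (Real.hasDerivAt_exp t)).congr_deriv (by ring)
  hm t := by
    have h1 := ((h.ode (exp t) (exp_pos t).le).comp t (Real.hasDerivAt_exp t)).neg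
    exact h1.congr_deriv (by ring)
  bound t := h.bound _ (exp_pos t).le
  m_le t := by rw [abs_neg]; exact h.abs_mul_deriv_le hκ hb (exp_pos t).le
  z_le t := h.abs_sub_le hκ hb (exp_pos t).le

lemma tendsto_zero_of_abs_le_exp {X : ℝ → ℝ} {C : ℝ} (h : ∀ t, |X t| ≤ exp t * C) :
    Tendsto X atBot (𝓝 0) := by
  rw [tendsto_zero_iff_abs_tendsto_zero]
  refine squeeze_zero (fun _ => abs_nonneg _) h ?_
  simpa using Real.tendsto_exp_atBot.mul_const C

namespace IsLogProfile
variable {κ b γ : ℝ} {z m : ℝ → ℝ}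

lemma tendsto_m (h : IsLogProfile κ b γ z m) : Tendsto m atBot (𝓝 0) :=
  tendsto_zero_of_abs_le_exp h.m_le

lemma tendsto_z (h : IsLogProfile κ b γ z m) : Tendsto z atBot (𝓝 γ) := by
  simpa using (tendsto_zero_of_abs_le_exp h.z_le).add_const γ

lemma hasDerivAt_nonlin (h : IsLogProfile κ b γ z m) (t : ℝ) :
    HasDerivAt (fun t => nonlin κ b (z t))
      (-(m t * (κ + b * exp (z t ^ 2) * (1 + 2 * z t ^ 2)))) t := by
  have h1 := h.hz t
  have h2 := (h1.const_mul κ).add ((h1.const_mul b).mul (h1.pow 2).exp)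
  refine h2.congr_deriv ?_
  simp only [Pi.pow_apply]
  push_cast; ring

/-- The approximate first integral of the bubble. -/
def bubbleDefect (κ b : ℝ) (z m : ℝ → ℝ) (t : ℝ) : ℝ :=
  m t - exp t * nonlin κ b (z t) - z t * m t ^ 2

lemma hasDerivAt_bubbleDefect (h : IsLogProfile κ b γ z m) (t : ℝ) :
    HasDerivAt (bubbleDefect κ b z m)
      (m t * (exp t * (κ + b * exp (z t ^ 2)) - 2 * κ * z t ^ 2 * exp t + m t ^ 2)) t := by
  have h1 := ((h.hm t).sub ((Real.hasDerivAt_exp t).mul (h.hasDerivAt_nonlin t))).sub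
    ((h.hz t).mul ((h.hm t).pow 2))
  refine h1.congr_deriv ?_
  simp only [Pi.pow_apply, nonlin]
  push_cast; ring

lemma tendsto_nonlin (h : IsLogProfile κ b γ z m) :
    Tendsto (fun t => exp t * nonlin κ b (z t)) atBot (𝓝 0) := by
  have : Continuous (nonlin κ b) := (contDiff_nonlin κ b).continuous
  simpa using Real.tendsto_exp_atBot.mul ((this.tendsto γ).comp h.tendsto_z)

lemma tendsto_bubbleDefect (h : IsLogProfile κ b γ z m) :
    Tendsto (bubbleDefect κ b z m) atBot (𝓝 0) := by
  unfold bubbleDefect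
  simpa using (h.tendsto_m.sub h.tendsto_nonlin).sub (h.tendsto_z.mul (h.tendsto_m.pow 2))

/-- While `z ≥ γ / 2` the flux is positive. -/
lemma exp_le_m (h : IsLogProfile κ b γ z m) {c T : ℝ}
    (hz : ∀ t ≤ T, c ≤ nonlin κ b (z t)) : c * exp T ≤ m T := by
  have := nonneg_of_hasDerivAt_nonneg_atBot (X := fun t => m t - c * exp t) (T := T)
    (fun t _ => (h.hm t).sub ((Real.hasDerivAt_exp t).const_mul c))
    (fun t ht => by have := mul_le_mul_of_nonneg_left (hz t ht) (exp_pos t).le; linarith)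
    (by simpa using h.tendsto_m.sub (Real.tendsto_exp_atBot.const_mul c))
  linarith

lemma nonlin_ge (hκ : 0 < κ) (hb : 0 < b) {x c : ℝ} (hc : 0 ≤ c) (hx : c ≤ x) :
    κ * c + b * c * exp (c ^ 2) ≤ nonlin κ b x := by
  have : 0 ≤ x := hc.trans hx
  unfold nonlin; gcongr

lemma m_pos (h : IsLogProfile κ b γ z m) (hκ : 0 < κ) (hb : 0 < b) (hγ : 0 < γ) {T : ℝ}
    (hz : ∀ t ≤ T, γ / 2 ≤ z t) : 0 < m T := by
  refine lt_of_lt_of_le ?_ (h.exp_le_m (fun t ht => nonlin_ge hκ hb (by positivity) (hz t ht)))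
  positivity

lemma bubbleDefect_nonneg (h : IsLogProfile κ b γ z m) (hκ : 0 < κ) (hb : 0 < b) (hγ : 0 < γ)
    (hN : 2 * κ * γ ^ 2 ≤ b * exp (γ ^ 2 / 4)) {T : ℝ} (hz : ∀ t ≤ T, γ / 2 ≤ z t) :
    0 ≤ bubbleDefect κ b z m T := by
  refine nonneg_of_hasDerivAt_nonneg_atBot (fun t _ => h.hasDerivAt_bubbleDefect t) (fun t ht => ?_)
    h.tendsto_bubbleDefect
  have hm := h.m_pos hκ hb hγ (fun τ hτ => hz τ (hτ.trans ht))
  have h1 : exp (γ ^ 2 / 4) ≤ exp (z t ^ 2) := exp_le_exp.2 (by nlinarith [hz t ht])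
  have h2 : z t ≤ γ := (le_abs_self _).trans (h.bound t)
  have h3 : z t ^ 2 ≤ γ ^ 2 := pow_le_pow_left₀ (by linarith [hz t ht]) h2 2
  have h4 : 2 * κ * z t ^ 2 ≤ b * exp (z t ^ 2) := by
    calc 2 * κ * z t ^ 2 ≤ 2 * κ * γ ^ 2 := by gcongr
      _ ≤ _ := hN
      _ ≤ _ := by gcongr
  refine mul_nonneg hm.le ?_
  have : exp t * (2 * κ * z t ^ 2) ≤ exp t * (b * exp (z t ^ 2)) := by gcongr
  nlinarith [exp_pos t, sq_nonneg (m t), mul_pos (exp_pos t) hκ]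

lemma z_mul_m_le (h : IsLogProfile κ b γ z m) (hκ : 0 < κ) (hb : 0 < b) (hγ : 0 < γ)
    (hN : 2 * κ * γ ^ 2 ≤ b * exp (γ ^ 2 / 4)) {T : ℝ} (hz : ∀ t ≤ T, γ / 2 ≤ z t) :
    z T * m T ≤ 1 := by
  have h1 := h.bubbleDefect_nonneg hκ hb hγ hN hz
  have hm := h.m_pos hκ hb hγ hz
  have h2 := nonlin_ge hκ hb (by positivity) (hz T le_rfl)
  have h3 : 0 ≤ exp T * nonlin κ b (z T) := mul_nonneg (exp_pos _).le (le_trans (by positivity) h2)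
  unfold bubbleDefect at h1
  nlinarith

end IsLogProfile

namespace IsLogProfile
variable {κ b γ : ℝ} {z m : ℝ → ℝ}

lemma sq_ge_of_bubble (h : IsLogProfile κ b γ z m) (hκ : 0 < κ) (hb : 0 < b) (hγ : 4 ≤ γ)
    (hN : 2 * κ * γ ^ 2 ≤ b * exp (γ ^ 2 / 4)) {tb T : ℝ} (hT : 0 ≤ T)
    (htb : b * γ ^ 2 * exp (γ ^ 2 + tb) = 1) (hTγ : 4 * (4 + 2 * T) ≤ γ ^ 2) :
    (∀ t ≤ tb + T, γ / 2 ≤ z t) ∧ (∀ t ≤ tb + T, γ ^ 2 - 4 - 2 * T ≤ z t ^ 2) ∧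
      ∀ t ≤ tb, γ ^ 2 - 4 ≤ z t ^ 2 := by
  have hγ0 : 0 < γ := by linarith
  have hκb : κ ≤ b * exp (γ ^ 2) := by
    have : exp (γ ^ 2 / 4) ≤ exp (γ ^ 2) := exp_le_exp.2 (by nlinarith)
    have : b * exp (γ ^ 2 / 4) ≤ b * exp (γ ^ 2) := by gcongr
    nlinarith [mul_pos hκ hγ0]
  have hf : exp tb * nonlin κ b γ ≤ 2 / γ := by
    rw [exp_add] at htb
    have : exp tb * nonlin κ b γ ≤ exp tb * (2 * (b * exp (γ ^ 2) * γ)) := by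
      unfold nonlin
      gcongr
      nlinarith
    rw [le_div_iff₀ hγ0]
    calc _ ≤ exp tb * (2 * (b * exp (γ ^ 2) * γ)) * γ := by gcongr
      _ = 2 * (b * γ ^ 2 * (exp (γ ^ 2) * exp tb)) := by ring
      _ = 2 := by rw [htb]; ring
      _ ≤ 2 := le_rfl
  have hfpos : 0 ≤ nonlin κ b γ := by unfold nonlin; positivity
  have hzb : ∀ t ≤ tb, γ - 2 / γ ≤ z t := by
    intro t ht
    have h1 := h.z_le t
    have h2 : exp t * nonlin κ b γ ≤ exp tb * nonlin κ b γ := by gcongr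
    have := neg_abs_le (z t - γ)
    linarith
  have h2γ : 2 / γ ≤ γ / 2 := by
    rw [div_le_div_iff₀ hγ0 two_pos]; nlinarith
  have hsq : (γ - 2 / γ) ^ 2 ≥ γ ^ 2 - 4 := by
    have : (γ - 2 / γ) ^ 2 = γ ^ 2 - 4 + (2 / γ) ^ 2 := by field_simp; ring
    nlinarith [sq_nonneg (2 / γ)]
  have hzbsq : ∀ t ≤ tb, γ ^ 2 - 4 ≤ z t ^ 2 := by
    intro t ht
    have := pow_le_pow_left₀ (by linarith) (hzb t ht) 2
    linarith
  have key : ∀ t ∈ Set.Icc tb (tb + T), (∀ τ ≤ t, γ / 2 ≤ z τ) → γ ^ 2 - 4 - 2 * T ≤ z t ^ 2 := by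
    intro t ht hz
    have := le_of_hasDerivAt_nonneg (X := fun t => z t ^ 2 + 2 * t) ht.1
      (fun τ _ => ((h.hz τ).pow 2).add ((hasDerivAt_id τ).const_mul 2)) (fun τ hτ => by
        have := h.z_mul_m_le hκ hb hγ0 hN (T := τ) (fun σ hσ => hz σ (hσ.trans hτ.2))
        simp
        nlinarith)
    have h3 := hzbsq tb le_rfl
    linarith [ht.2]
  have hzc : Continuous z := continuous_iff_continuousAt.2 fun t => (h.hz t).continuousAt
  have hboot := bootstrap_neg (φ := fun t => γ / 2 - z t) (a := tb) (b := tb + T)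
    (by fun_prop)
    (by
      have := hzb tb le_rfl
      have : 2 / γ < γ / 2 := by rw [div_lt_div_iff₀ hγ0 two_pos]; nlinarith
      linarith)
    (fun t ht hτ => by
      have hz' : ∀ τ ≤ t, γ / 2 ≤ z τ := by
        intro τ hτt
        rcases le_total τ tb with h1 | h1
        · linarith [hzb τ h1]
        · linarith [hτ τ ⟨h1, hτt⟩]
      have h1 := key t ht hz'
      have h2 := hz' t le_rfl
      nlinarith)
  have hz' : ∀ t ≤ tb + T, γ / 2 ≤ z t := by
    intro τ hτt
    rcases le_total τ tb with h1 | h1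
    · linarith [hzb τ h1]
    · linarith [hboot τ ⟨h1, hτt⟩]
  refine ⟨hz', fun t ht => ?_, hzbsq⟩
  rcases le_total t tb with h1 | h1
  · linarith [hzbsq t h1]
  · exact key t ⟨h1, ht⟩ fun τ hτ => hz' τ (hτ.trans ht)

lemma bubbleDefect_le (h : IsLogProfile κ b γ z m) (hκ : 0 < κ) (hb : 0 < b) (hγ : 0 < γ)
    (hN : 2 * κ * γ ^ 2 ≤ b * exp (γ ^ 2 / 4)) {T : ℝ} (hz : ∀ t ≤ T, γ / 2 ≤ z t) :
    bubbleDefect κ b z m T ≤ 4 / γ ^ 2 * (m T + (γ - z T)) := by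
  have := nonneg_of_hasDerivAt_nonneg_atBot
    (X := fun t => 4 / γ ^ 2 * (m t + (γ - z t)) - bubbleDefect κ b z m t) (T := T)
    (fun t _ => (((h.hm t).add ((h.hz t).const_sub γ)).const_mul (4 / γ ^ 2)).sub
      (h.hasDerivAt_bubbleDefect t)) (fun t ht => ?_) ?_
  · linarith
  · have hz' : ∀ τ ≤ t, γ / 2 ≤ z τ := fun τ hτ => hz τ (hτ.trans ht)
    have hm := h.m_pos hκ hb hγ hz'
    have hzm := h.z_mul_m_le hκ hb hγ hN hz'
    have hzt := hz' t le_rfl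
    have hz0 : 0 < z t := by linarith
    have hq : 1 / z t ≤ 2 / γ := by rw [div_le_div_iff₀ hz0 hγ]; linarith
    have hmz : m t ≤ 2 / γ := by
      refine le_trans ?_ hq
      rw [le_div_iff₀ hz0]; linarith
    have h4 : 4 / γ ^ 2 = (2 / γ) ^ 2 := by ring
    have h1 : m t ^ 2 ≤ 4 / γ ^ 2 := by rw [h4]; exact pow_le_pow_left₀ hm.le hmz 2
    have h2 : m t ≤ 4 / γ ^ 2 * z t := by
      rw [div_mul_eq_mul_div, le_div_iff₀ (by positivity)]
      have : γ ^ 2 ≤ 4 * z t ^ 2 := by nlinarith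
      nlinarith
    have hE : 0 < κ + b * exp (z t ^ 2) := by positivity
    have h3 : m t * (exp t * (κ + b * exp (z t ^ 2))) ≤
        4 / γ ^ 2 * z t * (exp t * (κ + b * exp (z t ^ 2))) := by gcongr
    have h5 : m t * m t ^ 2 ≤ m t * (4 / γ ^ 2) := mul_le_mul_of_nonneg_left h1 hm.le
    have h6 : 0 ≤ m t * (2 * κ * z t ^ 2 * exp t) := by positivity
    unfold nonlin
    nlinarith
  · simpa using ((h.tendsto_m.add (h.tendsto_z.const_sub γ)).const_mul (4 / γ ^ 2)).sub
      h.tendsto_bubbleDefect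

lemma antitoneOn_ratio_aux {f E z m Q κ x : ℝ} (hz : 0 < z) (hm : 0 < m) (hκ : 0 < κ)
    (hE : 7 * κ ≤ E) (hf : f = z * (κ + E)) (hx : x = m - z * m ^ 2 - Q) (hQ : Q ≤ m / 8)
    (hzm : z * m ≤ 1) :
    3 / 2 * f * m - (κ + E * (1 + 2 * z ^ 2)) * m ^ 2 - 2 * f * x ≤ 0 := by
  have hE0 : 0 < κ + E := by linarith
  have hf0 : 0 < f := by rw [hf]; positivity
  have h1 : 2 * f * Q ≤ f * m / 4 := by nlinarith
  have h2 : 2 * z ^ 2 * κ * m ^ 2 ≤ f * m / 4 := by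
    have : z ^ 2 * m ^ 2 ≤ z * m := by nlinarith [mul_pos hz hm]
    have : f * m ≥ 8 * κ * (z * m) := by rw [hf]; nlinarith [mul_pos hz hm]
    nlinarith
  have h3 : 3 / 2 * f * m - (κ + E * (1 + 2 * z ^ 2)) * m ^ 2 - 2 * f * x =
      -(1 / 2) * f * m + 2 * f * Q + 2 * z ^ 2 * κ * m ^ 2 - (κ + E) * m ^ 2 := by
    rw [hx, hf]; ring
  have : 0 ≤ (κ + E) * m ^ 2 := by positivity
  rw [h3]; linarith

/-- State at the end of the bubble: the profile leaves the bubble with slope close to `1 / z`. -/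
lemma bubble_exit (h : IsLogProfile κ b γ z m) (hκ : 0 < κ) (hb : 0 < b) (hγ : 4 ≤ γ)
    (hN : 2 * κ * γ ^ 2 ≤ b * exp (γ ^ 2 / 4)) {tb T : ℝ} (hT : 0 ≤ T)
    (htb : b * γ ^ 2 * exp (γ ^ 2 + tb) = 1) (hTγ : 64 * exp 4 * (6 + 2 * T) ≤ γ ^ 2) :
    exp (tb + T) * nonlin κ b (z (tb + T)) ≤ 8 * exp 4 / γ * exp (-(T / 2)) ∧
    1 - z (tb + T) * m (tb + T) ≤ 2 * γ * exp 4 *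
      (8 * exp 4 / γ * exp (-(T / 2)) + 4 / γ ^ 3 * (6 + 2 * T)) := by
  have hγ0 : 0 < γ := by linarith
  have he4 : 1 ≤ exp 4 := one_le_exp (by norm_num)
  obtain ⟨hz, hsq, hsqb⟩ := h.sq_ge_of_bubble hκ hb hγ hN hT htb (by nlinarith)
  have hz0 : ∀ t ≤ tb + T, 0 < z t := fun t ht => by linarith [hz t ht]
  have hzt : ∀ t ≤ tb + T, ∀ τ ≤ t, γ / 2 ≤ z τ := fun t ht τ hτ => hz τ (hτ.trans ht)
  have hm : ∀ t ≤ tb + T, 0 < m t := fun t ht => h.m_pos hκ hb hγ0 (hzt t ht)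
  have hzm : ∀ t ≤ tb + T, z t * m t ≤ 1 := fun t ht => h.z_mul_m_le hκ hb hγ0 hN (hzt t ht)
  have hQ0 : ∀ t ≤ tb + T, 0 ≤ bubbleDefect κ b z m t :=
    fun t ht => h.bubbleDefect_nonneg hκ hb hγ0 hN (hzt t ht)
  have hf0 : ∀ t ≤ tb + T, 0 < nonlin κ b (z t) := fun t ht => by
    have := hz0 t ht
    unfold nonlin; positivity
  have hm2 : ∀ t ≤ tb + T, m t ≤ 2 / γ := fun t ht => by
    rw [le_div_iff₀ hγ0]; nlinarith [hz t ht, hzm t ht, hm t ht]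
  have hQ : ∀ t ≤ tb + T, bubbleDefect κ b z m t ≤ 4 / γ ^ 3 * (6 + 2 * T) := fun t ht => by
    refine (h.bubbleDefect_le hκ hb hγ0 hN (hzt t ht)).trans ?_
    have h1 : γ - z t ≤ (4 + 2 * T) / γ := by
      rw [le_div_iff₀ hγ0]
      have := hsq t ht
      have := (le_abs_self _).trans (h.bound t)
      nlinarith [hz0 t ht]
    calc _ ≤ 4 / γ ^ 2 * (2 / γ + (4 + 2 * T) / γ) := by gcongr; exact hm2 t ht
      _ = _ := by field_simp; ring
  -- lower bound of the flux
  have hmb : exp (-4) / (2 * γ) ≤ m tb := by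
    have h1 : ∀ t ≤ tb, b * (γ / 2) * exp (γ ^ 2 - 4) ≤ nonlin κ b (z t) := by
      intro t ht
      have ht' : t ≤ tb + T := by linarith
      have h2 := hz t ht'
      have h3 : exp (γ ^ 2 - 4) ≤ exp (z t ^ 2) := exp_le_exp.2 (hsqb t ht)
      have h4 : 0 ≤ κ * z t := by have := hz0 t ht'; positivity
      have h6 := (hz0 t ht').le
      have h5 : b * (γ / 2) * exp (γ ^ 2 - 4) ≤ b * z t * exp (z t ^ 2) := by gcongr
      unfold nonlin; linarith
    refine le_trans (le_of_eq ?_) (h.exp_le_m h1)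
    have h2 : exp (γ ^ 2 - 4) = exp (γ ^ 2) * exp (-4) := by rw [← exp_add]; ring_nf
    rw [exp_add] at htb
    rw [h2, div_eq_iff (by positivity)]
    linear_combination (-exp (-4)) * htb
  have hmlow : ∀ t ∈ Set.Icc tb (tb + T), exp (-4) / (2 * γ) ≤ m t := fun t ht => by
    refine hmb.trans (le_of_hasDerivAt_nonneg ht.1 (fun τ _ => h.hm τ) fun τ hτ => ?_)
    exact mul_nonneg (exp_pos _).le (hf0 τ (hτ.2.trans ht.2)).le
  have hee : exp (-4) * exp 4 = 1 := by rw [← exp_add]; simp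
  have hQ8 : ∀ t ∈ Set.Icc tb (tb + T), bubbleDefect κ b z m t ≤ m t / 8 := fun t ht => by
    refine (hQ t ht.2).trans (le_trans ?_ (div_le_div_of_nonneg_right (hmlow t ht) (by norm_num)))
    rw [div_mul_eq_mul_div, div_div, div_le_div_iff₀ (by positivity) (by positivity)]
    calc 4 * (6 + 2 * T) * (2 * γ * 8) = exp (-4) * exp 4 * (4 * (6 + 2 * T) * (2 * γ * 8)) := by
          rw [hee]; ring
      _ = exp (-4) * γ * (64 * exp 4 * (6 + 2 * T)) := by ring
      _ ≤ exp (-4) * γ * γ ^ 2 := by gcongr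
      _ = _ := by ring
  -- decay of the ratio
  have hratio : exp ((tb + T) * (3 / 2)) * nonlin κ b (z (tb + T)) / m (tb + T) ^ 2 ≤
      exp (tb * (3 / 2)) * nonlin κ b (z tb) / m tb ^ 2 := by
    have := le_of_hasDerivAt_nonneg
      (X := fun t => -(exp (t * (3 / 2)) * nonlin κ b (z t) / m t ^ 2)) (a := tb) (b := tb + T)
      (by linarith)
      (fun t ht => ((((hasDerivAt_mul_const (3 / 2 : ℝ)).exp.mul (h.hasDerivAt_nonlin t)).div
        ((h.hm t).pow 2) (by have := hm t ht.2; simp; positivity)).neg)) (fun t ht => ?_)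
    · linarith
    · have hmt := hm t ht.2
      have h1 := antitoneOn_ratio_aux (f := nonlin κ b (z t)) (E := b * exp (z t ^ 2))
        (z := z t) (m := m t) (Q := bubbleDefect κ b z m t) (κ := κ)
        (x := exp t * nonlin κ b (z t)) (hz0 t ht.2) hmt hκ (by
          have : exp (γ ^ 2 / 4) ≤ exp (z t ^ 2) := exp_le_exp.2 (by nlinarith [hz t ht.2])
          have : b * exp (γ ^ 2 / 4) ≤ b * exp (z t ^ 2) := by gcongr
          have : κ * 16 ≤ κ * γ ^ 2 := mul_le_mul_of_nonneg_left (by nlinarith) hκ.le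
          nlinarith) (by unfold nonlin; ring) (by unfold bubbleDefect; ring) (hQ8 t ht) (hzm t ht.2)
      rw [← neg_div]
      refine div_nonneg ?_ (by positivity)
      have h2 : 0 < exp (t * (3 / 2)) * m t := by positivity
      have h3 := mul_nonneg h2.le (neg_nonneg.2 h1)
      simp only [Pi.pow_apply, Pi.mul_apply]
      push_cast
      refine h3.trans (le_of_eq ?_)
      ring
  have hT1 : tb + T ≤ tb + T := le_rfl
  have hT0 : tb ≤ tb + T := by linarith
  have hhm : ∀ t ≤ tb + T, exp t * nonlin κ b (z t) ≤ m t := fun t ht => by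
    have := hQ0 t ht
    unfold bubbleDefect at this
    nlinarith [mul_nonneg (hz0 t ht).le (sq_nonneg (m t))]
  have hA : exp (tb + T) * nonlin κ b (z (tb + T)) ≤ 8 * exp 4 / γ * exp (-(T / 2)) := by
    set x1 := exp (tb + T) * nonlin κ b (z (tb + T)) with hx1
    have e1 : exp ((tb + T) * (3 / 2)) * nonlin κ b (z (tb + T)) =
        x1 * (exp (tb / 2) * exp (T / 2)) := by
      rw [hx1, ← exp_add (tb / 2), mul_right_comm, ← exp_add]; ring_nf
    have e2 : exp (tb * (3 / 2)) * nonlin κ b (z tb) = exp tb * nonlin κ b (z tb) * exp (tb / 2) := by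
      rw [mul_right_comm, ← exp_add]; ring_nf
    rw [e1, e2, div_le_div_iff₀ (pow_pos (hm _ hT1) 2) (pow_pos (hm _ hT0) 2)] at hratio
    have h1 : x1 * exp (T / 2) * m tb ^ 2 ≤ exp tb * nonlin κ b (z tb) * m (tb + T) ^ 2 := by
      refine le_of_mul_le_mul_right ?_ (exp_pos (tb / 2))
      linarith
    have h2 : x1 * exp (T / 2) * m tb ^ 2 ≤ m tb * (2 / γ) ^ 2 := by
      refine h1.trans ?_
      have := (hf0 tb hT0).le
      have := (hm _ hT1).le
      have := (hm _ hT0).le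
      gcongr
      · exact hhm tb hT0
      · exact hm2 _ hT1
    have h3 : x1 * exp (T / 2) * m tb ≤ (2 / γ) ^ 2 := by
      refine le_of_mul_le_mul_left ?_ (hm _ hT0)
      linarith
    have hx0 : 0 < x1 := mul_pos (exp_pos _) (hf0 _ hT1)
    have h4 : x1 * exp (T / 2) * (exp (-4) / (2 * γ)) ≤ (2 / γ) ^ 2 := by
      refine le_trans ?_ h3
      gcongr
    have h5 : x1 * exp (T / 2) ≤ 8 * exp 4 / γ := by
      rw [le_div_iff₀ hγ0]
      have h6 : x1 * exp (T / 2) * (exp (-4) / (2 * γ)) * (2 * γ ^ 2 * exp 4) ≤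
          (2 / γ) ^ 2 * (2 * γ ^ 2 * exp 4) := by gcongr
      have e3 : x1 * exp (T / 2) * (exp (-4) / (2 * γ)) * (2 * γ ^ 2 * exp 4) =
          x1 * exp (T / 2) * γ * (exp (-4) * exp 4) := by field_simp
      have e4 : (2 / γ) ^ 2 * (2 * γ ^ 2 * exp 4) = 8 * exp 4 := by field_simp; ring
      rw [e3, e4, hee] at h6
      linarith
    calc x1 = x1 * exp (T / 2) * exp (-(T / 2)) := by
          rw [mul_assoc, ← exp_add]; simp
      _ ≤ _ := by gcongr
  refine ⟨hA, ?_⟩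
  have hm1 := hmlow (tb + T) ⟨hT0, le_rfl⟩
  have h1 : m (tb + T) * (1 - z (tb + T) * m (tb + T)) ≤
      8 * exp 4 / γ * exp (-(T / 2)) + 4 / γ ^ 3 * (6 + 2 * T) := by
    have h2 := hQ (tb + T) le_rfl
    have h3 : m (tb + T) * (1 - z (tb + T) * m (tb + T)) =
      exp (tb + T) * nonlin κ b (z (tb + T)) + bubbleDefect κ b z m (tb + T) := by
      unfold bubbleDefect; ring
    rw [h3]; linarith
  have h2 : exp (-4) / (2 * γ) * (1 - z (tb + T) * m (tb + T)) ≤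
      8 * exp 4 / γ * exp (-(T / 2)) + 4 / γ ^ 3 * (6 + 2 * T) := by
    refine le_trans ?_ h1
    have := hzm _ hT1
    gcongr
  calc 1 - z (tb + T) * m (tb + T) = 2 * γ * exp 4 * (exp (-4) / (2 * γ) * (1 - z (tb + T) * m (tb + T))) := by
        have : 2 * γ * exp 4 * (exp (-4) / (2 * γ) * (1 - z (tb + T) * m (tb + T))) =
          exp (-4) * exp 4 * (1 - z (tb + T) * m (tb + T)) := by field_simp
        rw [this, hee, one_mul]
    _ ≤ _ := by gcongr

end IsLogProfile

namespace IsLogProfile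
variable {κ b γ : ℝ} {z m : ℝ → ℝ}

/-- Between the bubble and the bulk, the profile stays close to its tangent line and the
exponential term is negligible. -/
lemma neck (h : IsLogProfile κ b γ z m) (hκ : 0 < κ) (hb : 0 < b) (hγ : 0 < γ)
    {t₁ t₃ η L₀ : ℝ} (ht : t₁ ≤ t₃) (ht₃ : t₃ ≤ 0) (ht₁ : t₁ < 0) (hκt : κ * exp t₃ ≤ 1 / 4)
    (hL : L₀ = z t₁ + m t₁ * t₁) (hL0 : 0 ≤ L₀) (hm₁ : 0 < m t₁) (hz₁ : 0 < z t₁)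
    (hη₁ : b * γ * exp (z t₁ ^ 2 + t₁) ≤ η) (hη₂ : b * γ * exp (L₀ ^ 2) ≤ η)
    (hpos : m t₁ / 2 + η * t₁ ^ 2 / 2 < 3 / 4 * L₀) :
    ∀ t ∈ Icc t₁ t₃, 0 < z t ∧ z t ≤ L₀ - m t₁ * t ∧ 0 < m t ∧
      m t ≤ m t₁ + (L₀ - m t₁ * t + m t₁) / 4 + η * (t - t₁) ∧
      |exp t * (b * z t * exp (z t ^ 2))| ≤ η := by
  have hη : 0 ≤ η := le_trans (by positivity) hη₂
  have hLpos : ∀ t ∈ Icc t₁ t₃, 0 ≤ L₀ - m t₁ * t := fun t ht => by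
    nlinarith [ht.2]
  have hκt' : ∀ t ∈ Icc t₁ t₃, κ * exp t ≤ 1 / 4 := fun t ht =>
    le_trans (by gcongr; exact ht.2) hκt
  have hmain : ∀ t ∈ Icc t₁ t₃, (∀ τ ∈ Icc t₁ t, 0 ≤ z τ) →
      m t₁ ≤ m t ∧ z t ≤ L₀ - m t₁ * t ∧ exp t * (b * z t * exp (z t ^ 2)) ≤ η := by
    intro t ht hz
    have hmono : ∀ τ ∈ Icc t₁ t, m t₁ ≤ m τ := fun τ hτ =>
      le_of_hasDerivAt_nonneg hτ.1 (fun σ _ => h.hm σ) fun σ hσ => by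
        have := hz σ ⟨hσ.1, hσ.2.trans hτ.2⟩
        unfold nonlin; positivity
    have hzL : z t ≤ L₀ - m t₁ * t := by
      have := le_of_hasDerivAt_nonneg (X := fun t => L₀ - m t₁ * t - z t) ht.1
        (fun τ _ => (((hasDerivAt_id τ).const_mul (m t₁)).const_sub L₀).sub (h.hz τ))
        fun τ hτ => by have := hmono τ hτ; simp; linarith
      simp only [hL] at this
      rw [hL]; linarith
    refine ⟨hmono t ⟨ht.1, le_rfl⟩, hzL, ?_⟩
    have hz0 := hz t ⟨ht.1, le_rfl⟩
    have hzγ := (le_abs_self _).trans (h.bound t)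
    have h1 : exp t * (b * z t * exp (z t ^ 2)) ≤ b * γ * exp ((L₀ - m t₁ * t) ^ 2 + t) := by
      rw [exp_add]
      calc _ = b * z t * (exp (z t ^ 2) * exp t) := by ring
        _ ≤ _ := by gcongr
    refine h1.trans ?_
    have h2 : (L₀ - m t₁ * t) ^ 2 + t ≤ max (z t₁ ^ 2 + t₁) (L₀ ^ 2) := by
      obtain ⟨θ, hθ⟩ : ∃ θ, t = θ * t₁ := ⟨t / t₁, (div_mul_cancel₀ t ht₁.ne).symm⟩
      have hθ0 : 0 ≤ θ := by
        by_contra! hc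
        nlinarith [ht.1, ht.2]
      have hθ1 : θ ≤ 1 := by
        by_contra! hc
        nlinarith [ht.1, ht.2]
      have hz1 : z t₁ = L₀ - m t₁ * t₁ := by linarith
      have h3 : (L₀ - m t₁ * t) ^ 2 + t ≤ θ * (z t₁ ^ 2 + t₁) + (1 - θ) * L₀ ^ 2 := by
        rw [hθ, hz1]
        nlinarith [mul_nonneg (mul_nonneg hθ0 (sub_nonneg.2 hθ1)) (sq_nonneg (m t₁ * t₁))]
      have h4 := mul_le_mul_of_nonneg_left (le_max_left (z t₁ ^ 2 + t₁) (L₀ ^ 2)) hθ0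
      have h5 := mul_le_mul_of_nonneg_left (le_max_right (z t₁ ^ 2 + t₁) (L₀ ^ 2))
        (sub_nonneg.2 hθ1)
      linarith
    rcases max_choice (z t₁ ^ 2 + t₁) (L₀ ^ 2) with h3 | h3 <;> rw [h3] at h2
    · exact le_trans (by gcongr) hη₁
    · exact le_trans (by gcongr) hη₂
  have hflux : ∀ t ∈ Icc t₁ t₃, (∀ τ ∈ Icc t₁ t, 0 ≤ z τ) →
      m t ≤ m t₁ + κ * exp t * (L₀ - m t₁ * t + m t₁) + η * (t - t₁) := by
    intro t ht hz
    have h1 := le_of_hasDerivAt_nonneg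
      (X := fun t => κ * (exp t * (L₀ - m t₁ * t + m t₁)) + η * t - m t) ht.1
      (fun τ _ => ((((Real.hasDerivAt_exp τ).mul ((((hasDerivAt_id τ).const_mul
        (m t₁)).const_sub L₀).add_const (m t₁))).const_mul κ).add
        ((hasDerivAt_id τ).const_mul η)).sub (h.hm τ)) fun τ hτ => by
          obtain ⟨-, h2, h3⟩ := hmain τ ⟨hτ.1, hτ.2.trans ht.2⟩
            fun σ hσ => hz σ ⟨hσ.1, hσ.2.trans hτ.2⟩
          have h4 : κ * exp τ * z τ ≤ κ * exp τ * (L₀ - m t₁ * τ) := by gcongr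
          simp only [nonlin, id]
          linarith
    have h2 : 0 ≤ κ * (exp t₁ * (L₀ - m t₁ * t₁ + m t₁)) := by
      have := hLpos t₁ ⟨le_rfl, ‹_›⟩
      positivity
    linarith
  have hboot := bootstrap_neg (φ := fun t => - z t) (a := t₁) (b := t₃)
    (fun t _ => (h.hz t).neg.continuousAt.continuousWithinAt) (by linarith) fun t ht hτ => by
      have hz : ∀ τ ∈ Icc t₁ t, 0 ≤ z τ := fun τ hh => by linarith [hτ τ hh]
      have h1 := le_of_hasDerivAt_nonneg
        (X := fun t => z t + m t₁ * t + κ * (exp t * (L₀ - m t₁ * t + 2 * m t₁)) +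
          η * (t - t₁) ^ 2 / 2) ht.1
        (fun τ _ => (((h.hz τ).add ((hasDerivAt_id τ).const_mul (m t₁))).add
          (((Real.hasDerivAt_exp τ).mul ((((hasDerivAt_id τ).const_mul
          (m t₁)).const_sub L₀).add_const (2 * m t₁))).const_mul κ)).add
          (((((hasDerivAt_id τ).sub_const t₁).pow 2).const_mul η).div_const 2)) fun τ hτ => by
            have h2 := hflux τ ⟨hτ.1, hτ.2.trans ht.2⟩
              fun σ hσ => hz σ ⟨hσ.1, hσ.2.trans hτ.2⟩
            simp only [id]
            norm_num
            linarith
      have h2 : 0 ≤ κ * (exp t₁ * (L₀ - m t₁ * t₁ + 2 * m t₁)) := by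
        have := hLpos t₁ ⟨le_rfl, ‹_›⟩
        positivity
      have h3 : κ * exp t * (L₀ - m t₁ * t + 2 * m t₁) ≤ 1 / 4 * (L₀ - m t₁ * t + 2 * m t₁) := by
        have := hLpos t ht
        have := hκt' t ht
        gcongr
      have h4 : η * (t - t₁) ^ 2 / 2 ≤ η * t₁ ^ 2 / 2 := by
        have : (t - t₁) ^ 2 ≤ t₁ ^ 2 := by nlinarith [ht.1, ht.2]
        gcongr
      have h5 : L₀ ≤ L₀ - m t₁ * t := by nlinarith [ht.2]
      norm_num at h1
      linarith
  intro t ht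
  have hz : ∀ τ ∈ Icc t₁ t, 0 ≤ z τ := fun τ hτ => by
    linarith [hboot τ ⟨hτ.1, hτ.2.trans ht.2⟩]
  obtain ⟨h1, h2, h3⟩ := hmain t ht hz
  have h4 := hflux t ht hz
  have hzt : 0 < z t := by linarith [hboot t ht]
  refine ⟨hzt, h2, by linarith, ?_, ?_⟩
  · have : κ * exp t * (L₀ - m t₁ * t + m t₁) ≤ 1 / 4 * (L₀ - m t₁ * t + m t₁) := by
      have := hLpos t ht
      have := hκt' t ht
      gcongr
    linarith
  · rwa [abs_of_nonneg (by positivity)]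

end IsLogProfile

/-- Gronwall estimate for the perturbed linear equation in logarithmic time. The quantity
`d - t q` is the value at time zero of the tangent to `d` at time `t`. -/
lemma gronwall_tangent {κ η t₁ t₄ : ℝ} {d q h : ℝ → ℝ} (hκ : 0 ≤ κ) (ht₁ : t₁ ≤ 0)
    (ht₄ : t₄ ≤ 1) (hη0 : 0 ≤ η) (hη1 : η ≤ 1) (hη : η * (-t₁) ≤ 1)
    (hd : ∀ t, HasDerivAt d (q t) t) (hq : ∀ t, HasDerivAt q (-(κ * exp t * d t + h t)) t)
    (hh : ∀ t ∈ Icc t₁ t₄, |h t| ≤ η) :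
    ∀ t ∈ Icc t₁ t₄, (d t - t * q t) ^ 2 + q t ^ 2 ≤ exp (4 * κ * exp 1 + 2) *
      ((d t₁ - t₁ * q t₁) ^ 2 + q t₁ ^ 2 + η * (2 - t₁ - t₁ ^ 3)) := by
  intro t ht
  have hK : ∀ t, HasDerivAt (fun t => exp t * (t ^ 2 - 2 * t + 3)) (exp t * (1 + t ^ 2)) t :=
    fun t => ((Real.hasDerivAt_exp t).mul (((hasDerivAt_pow 2 t).sub
      ((hasDerivAt_id t).const_mul 2)).add_const 3)).congr_deriv (by simp; ring)
  set K : ℝ → ℝ := fun t => 2 * κ * (exp t * (t ^ 2 - 2 * t + 3)) + η * t with hKdef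
  have hK' : ∀ t, HasDerivAt K (2 * κ * (exp t * (1 + t ^ 2)) + η) t := fun t =>
    (((hK t).const_mul (2 * κ)).add ((hasDerivAt_id t).const_mul η)).congr_deriv (by simp)
  have hKlow : ∀ τ ∈ Icc t₁ t₄, -1 ≤ K τ := fun τ hτ => by
    have h1 : 0 ≤ τ ^ 2 - 2 * τ + 3 := by nlinarith [sq_nonneg (τ - 1)]
    have h2 : 0 ≤ 2 * κ * (exp τ * (τ ^ 2 - 2 * τ + 3)) := by positivity
    have h3 : η * t₁ ≤ η * τ := mul_le_mul_of_nonneg_left hτ.1 hη0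
    simp only [hKdef]; linarith
  have hKup : K t ≤ 4 * κ * exp 1 + 1 := by
    have h1 := le_of_hasDerivAt_nonneg (ht.2.trans ht₄) (fun τ _ => hK τ)
      (fun τ _ => by positivity)
    have h2 := mul_le_mul_of_nonneg_left h1 (by positivity : 0 ≤ 2 * κ)
    have h3 : η * t ≤ 1 := by nlinarith [ht.2]
    simp only [hKdef]; nlinarith
  have hY := le_of_hasDerivAt_nonneg
    (X := fun t => exp 1 * η * (t + t ^ 3 / 3) - exp (-K t) * ((d t - t * q t) ^ 2 + q t ^ 2)) ht.1
    (fun τ _ => ((((hasDerivAt_id τ).add ((hasDerivAt_pow 3 τ).div_const 3)).const_mul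
      (exp 1 * η))).sub ((hK' τ).neg.exp.mul ((((hd τ).sub ((hasDerivAt_id τ).mul (hq τ))).pow
      2).add ((hq τ).pow 2)))) fun τ hτ => by
        have hh' := hh τ ⟨hτ.1, hτ.2.trans ht.2⟩
        have hE : exp (-K τ) ≤ exp 1 :=
          exp_le_exp.2 (by linarith [hKlow τ ⟨hτ.1, hτ.2.trans ht.2⟩])
        simp only [Pi.sub_apply, Pi.mul_apply, Pi.neg_apply, id]
        set P := d τ - τ * q τ with hP
        have hdP : d τ = P + τ * q τ := by rw [hP]; ring
        set Y := P ^ 2 + q τ ^ 2 with hY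
        have h1 : (τ * P - q τ) * (P + τ * q τ) ≤ (1 + τ ^ 2) * Y := by
          have e1 : (τ * P - q τ) ^ 2 ≤ (1 + τ ^ 2) * Y := by
            nlinarith [sq_nonneg (P + τ * q τ)]
          have e2 : (P + τ * q τ) ^ 2 ≤ (1 + τ ^ 2) * Y := by
            nlinarith [sq_nonneg (τ * P - q τ)]
          nlinarith [sq_nonneg (τ * P - q τ - (P + τ * q τ))]
        have h2 : 2 * ((τ * P - q τ) * h τ) ≤ η * (Y + (1 + τ ^ 2)) := by
          have e0 : (τ * P - q τ) * h τ ≤ |τ * P - q τ| * η :=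
            (le_abs_self _).trans (by rw [abs_mul]; gcongr)
          have e1 : |τ * P - q τ| ^ 2 ≤ (1 + τ ^ 2) * Y := by
            rw [sq_abs]; nlinarith [sq_nonneg (P + τ * q τ)]
          have hY0 : 0 ≤ Y := by positivity
          have e2 : 2 * |τ * P - q τ| ≤ Y + (1 + τ ^ 2) := by
            nlinarith [sq_nonneg (Y - (1 + τ ^ 2)), abs_nonneg (τ * P - q τ), sq_nonneg τ]
          nlinarith
        have h3 : 2 * κ * exp τ * ((τ * P - q τ) * (P + τ * q τ)) ≤
            2 * κ * exp τ * ((1 + τ ^ 2) * Y) := by gcongr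
        have h4 : exp (-K τ) * (η * (1 + τ ^ 2)) ≤ exp 1 * (η * (1 + τ ^ 2)) := by gcongr
        have h5 := mul_le_mul_of_nonneg_left (add_le_add h3 h2) (exp_pos (-K τ)).le
        rw [hdP]
        norm_num
        nlinarith
  set Y := (d t - t * q t) ^ 2 + q t ^ 2 with hYdef
  set Y₁ := (d t₁ - t₁ * q t₁) ^ 2 + q t₁ ^ 2 with hY₁def
  have hE1 : exp (-K t₁) ≤ exp 1 := exp_le_exp.2 (by linarith [hKlow t₁ ⟨le_rfl, ht.1.trans ht.2⟩])
  have h1 : exp (-K t₁) * Y₁ ≤ exp 1 * Y₁ := by gcongr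
  have h2 : t + t ^ 3 / 3 ≤ 2 := by
    have : t ≤ 1 := ht.2.trans ht₄
    nlinarith [sq_nonneg t, sq_nonneg (t + 1 / 2)]
  have h3 : -(t₁ + t₁ ^ 3 / 3) ≤ -t₁ - t₁ ^ 3 := by
    nlinarith [mul_nonneg (neg_nonneg.2 ht₁) (sq_nonneg t₁)]
  have h4 : exp 1 * η * (t + t ^ 3 / 3 - (t₁ + t₁ ^ 3 / 3)) ≤ exp 1 * η * (2 - t₁ - t₁ ^ 3) := by
    apply mul_le_mul_of_nonneg_left _ (by positivity)
    linarith
  have h5 : exp (-K t) * Y ≤ exp 1 * (Y₁ + η * (2 - t₁ - t₁ ^ 3)) := by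
    linarith
  have h6 : 0 ≤ exp 1 * (Y₁ + η * (2 - t₁ - t₁ ^ 3)) := le_trans (by positivity) h5
  calc Y = exp (K t) * (exp (-K t) * Y) := by rw [← mul_assoc, ← exp_add]; simp
    _ ≤ exp (K t) * (exp 1 * (Y₁ + η * (2 - t₁ - t₁ ^ 3))) := by gcongr
    _ ≤ exp (4 * κ * exp 1 + 1) * (exp 1 * (Y₁ + η * (2 - t₁ - t₁ ^ 3))) := by gcongr
    _ = _ := by rw [← mul_assoc, ← exp_add]; ring_nf

/-- Logarithmic time at which the profile leaves the bubble. -/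
def exitTime (A γ : ℝ) : ℝ := A * γ - γ ^ 2 + 18 * log γ

lemma eventually_exitTime_mem (A : ℝ) :
    ∀ᶠ γ in atTop, exitTime A γ ∈ Icc (-γ ^ 2 - |A| * γ) (-(γ ^ 2 / 2)) := by
  filter_upwards [eventually_ge_atTop 1, eventually_ge_atTop (2 * (|A| + 18))] with γ h1 h2
  have h3 := log_nonneg h1
  have h4 := log_le_self (by linarith : 0 ≤ γ)
  have h5 := le_abs_self A
  have h6 := neg_abs_le A
  unfold exitTime
  constructor <;> nlinarith

lemma tendsto_log_div_atTop (a c : ℝ) :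
    Tendsto (fun γ : ℝ => (a + c * log γ) / γ) atTop (𝓝 0) := by
  have h1 : Tendsto (fun γ : ℝ => log γ / γ) atTop (𝓝 0) :=
    Real.isLittleO_log_id_atTop.tendsto_div_nhds_zero
  have h2 : Tendsto (fun γ : ℝ => a / γ) atTop (𝓝 0) := tendsto_const_nhds.div_atTop tendsto_id
  have := h2.add (h1.const_mul c)
  simp only [mul_zero, add_zero] at this
  refine this.congr fun γ => by ring

lemma tendsto_pow_mul_exp_neg_mul (n : ℕ) {a : ℝ} (ha : 0 < a) :
    Tendsto (fun γ : ℝ => γ ^ n * exp (-(a * γ))) atTop (𝓝 0) := by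
  simpa using tendsto_rpow_mul_exp_neg_mul_atTop_nhds_zero n a ha

lemma tendsto_pow_mul_exp_exitTime (A : ℝ) (n : ℕ) :
    Tendsto (fun γ : ℝ => γ ^ n * exp (exitTime A γ)) atTop (𝓝 0) := by
  refine squeeze_zero' ?_ ?_ (tendsto_pow_mul_exp_neg_mul n one_pos)
  · filter_upwards [eventually_ge_atTop 0] with γ h using by positivity
  · filter_upwards [eventually_ge_atTop 2, eventually_exitTime_mem A] with γ h h1
    have : exitTime A γ ≤ -(1 * γ) := h1.2.trans (by nlinarith)
    gcongr

lemma exp_neg_log (γ : ℝ) (hγ : 0 < γ) : exp (-(20 * log γ / 2)) = (γ ^ 10)⁻¹ := by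
  rw [show 20 * log γ / 2 = (10 : ℕ) * log γ by push_cast; ring, exp_neg, ← log_pow,
    exp_log (by positivity)]

/-- The state of a profile at the exit of the bubble. -/
lemma eventually_exit {κ A : ℝ} (hκ : 0 < κ) (hA : 0 < A) {z m : ℝ → ℝ → ℝ}
    (h : ∀ γ, 0 < γ → IsLogProfile κ (exp (-(A * γ))) γ (z γ) (m γ)) :
    ∀ᶠ γ in atTop,
      (∀ t ≤ exitTime A γ, γ / 2 ≤ z γ t ∧ 0 < m γ t ∧ z γ t * m γ t ≤ 1) ∧
      γ ^ 2 - 4 - 40 * log γ ≤ z γ (exitTime A γ) ^ 2 ∧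
      exp (exitTime A γ) * nonlin κ (exp (-(A * γ))) (z γ (exitTime A γ)) ≤
        8 * exp 4 / γ * (γ ^ 10)⁻¹ ∧
      1 - z γ (exitTime A γ) * m γ (exitTime A γ) ≤
        (16 * exp 4 * exp 4 + 8 * exp 4 * (6 + 40 * log γ)) / γ ^ 2 := by
  have hpow : ∀ᶠ γ : ℝ in atTop, 2 * κ * (γ ^ 2 * exp (-(1 * γ))) ≤ 1 := by
    have := (tendsto_pow_mul_exp_neg_mul 2 one_pos).const_mul (2 * κ)
    rw [mul_zero] at this
    exact this.eventually_le_const one_pos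
  filter_upwards [eventually_ge_atTop 4, eventually_ge_atTop (4 * (A + 1)),
    eventually_ge_atTop (64 * exp 4 * 46), hpow] with γ h4 hγA hγe hp
  have hγ : 0 < γ := by linarith
  have hN : 2 * κ * γ ^ 2 ≤ exp (-(A * γ)) * exp (γ ^ 2 / 4) := by
    have h1 : exp γ ≤ exp (-(A * γ)) * exp (γ ^ 2 / 4) := by
      rw [← exp_add]; exact exp_le_exp.2 (by nlinarith)
    refine le_trans ?_ h1
    rw [one_mul, ← mul_assoc, exp_neg, mul_inv_le_iff₀ (exp_pos _), one_mul] at hp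
    exact hp
  have hlog0 : 0 ≤ log γ := log_nonneg (by linarith)
  have hlog := log_le_self hγ.le
  have he4 : 1 ≤ exp 4 := one_le_exp (by norm_num)
  have hTγ : 64 * exp 4 * (6 + 2 * (20 * log γ)) ≤ γ ^ 2 := by
    calc 64 * exp 4 * (6 + 2 * (20 * log γ)) ≤ 64 * exp 4 * (46 * γ) := by gcongr; linarith
      _ = 64 * exp 4 * 46 * γ := by ring
      _ ≤ γ * γ := by gcongr
      _ = _ := by ring
  have htb : exp (-(A * γ)) * γ ^ 2 * exp (γ ^ 2 + (A * γ - γ ^ 2 - 2 * log γ)) = 1 := by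
    have : γ ^ 2 = exp (2 * log γ) := by
      rw [show 2 * log γ = (2 : ℕ) * log γ by norm_num, ← log_pow, exp_log (by positivity)]
    rw [show γ ^ 2 + (A * γ - γ ^ 2 - 2 * log γ) = A * γ - 2 * log γ by ring, this, ← exp_add,
      ← exp_add]
    ring_nf
    exact exp_zero
  have hT : 0 ≤ 20 * log γ := by positivity
  have hexit : A * γ - γ ^ 2 - 2 * log γ + 20 * log γ = exitTime A γ := by unfold exitTime; ring
  obtain ⟨h1, h2, -⟩ := (h γ hγ).sq_ge_of_bubble hκ (exp_pos _) h4 hN hT htb (by nlinarith)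
  obtain ⟨h5, h6⟩ := (h γ hγ).bubble_exit hκ (exp_pos _) h4 hN hT htb hTγ
  rw [hexit] at h1 h2 h5 h6
  rw [exp_neg_log γ hγ] at h5 h6
  refine ⟨fun t ht => ?_, ?_, h5, h6.trans ?_⟩
  · have hz : ∀ τ ≤ t, γ / 2 ≤ z γ τ := fun τ hτ => h1 τ (hτ.trans ht)
    exact ⟨h1 t ht, (h γ hγ).m_pos hκ (exp_pos _) hγ hz, (h γ hγ).z_mul_m_le hκ (exp_pos _) hγ hN hz⟩
  · linarith [h2 (exitTime A γ) le_rfl]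
  · have e1 : 2 * γ * exp 4 * (8 * exp 4 / γ * (γ ^ 10)⁻¹ + 4 / γ ^ 3 * (6 + 2 * (20 * log γ))) =
        16 * exp 4 * exp 4 * (γ ^ 10)⁻¹ + 8 * exp 4 * (6 + 40 * log γ) / γ ^ 2 := by
      field_simp; ring
    have e2 : (γ ^ 10)⁻¹ ≤ (γ ^ 2)⁻¹ := by
      have : γ ^ 2 ≤ γ ^ 10 := pow_le_pow_right₀ (by linarith) (by norm_num)
      gcongr
    rw [e1, add_div, div_eq_mul_inv (16 * exp 4 * exp 4)]
    gcongr

/-- Limits at the exit of the bubble. -/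
lemma tendsto_exit {κ A : ℝ} (hκ : 0 < κ) (hA : 0 < A) {z m : ℝ → ℝ → ℝ}
    (h : ∀ γ, 0 < γ → IsLogProfile κ (exp (-(A * γ))) γ (z γ) (m γ)) :
    Tendsto (fun γ => γ - z γ (exitTime A γ)) atTop (𝓝 0) ∧
    Tendsto (fun γ => z γ (exitTime A γ) * m γ (exitTime A γ)) atTop (𝓝 1) ∧
    Tendsto (fun γ => γ * m γ (exitTime A γ)) atTop (𝓝 1) ∧
    Tendsto (fun γ => m γ (exitTime A γ)) atTop (𝓝 0) ∧
    Tendsto (fun γ => z γ (exitTime A γ) + m γ (exitTime A γ) * exitTime A γ) atTop (𝓝 A) := by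
  have hev := eventually_exit hκ hA h
  have hgap : ∀ᶠ γ in atTop, γ - z γ (exitTime A γ) ≤ (4 + 40 * log γ) / γ := by
    filter_upwards [hev, eventually_gt_atTop 0] with γ ⟨h1, h2, _⟩ hγ
    rw [le_div_iff₀ hγ]
    have h3 := (h1 _ le_rfl).1
    have h4 := (le_abs_self _).trans ((h γ hγ).bound (exitTime A γ))
    nlinarith
  have hgap0 : ∀ᶠ γ in atTop, 0 ≤ γ - z γ (exitTime A γ) := by
    filter_upwards [eventually_gt_atTop 0] with γ hγ
    linarith [(le_abs_self _).trans ((h γ hγ).bound (exitTime A γ))]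
  have hδ0 : ∀ᶠ γ in atTop, 0 ≤ 1 - z γ (exitTime A γ) * m γ (exitTime A γ) := by
    filter_upwards [hev] with γ ⟨h1, _⟩
    linarith [(h1 _ le_rfl).2.2]
  set D : ℝ → ℝ := fun γ => 16 * exp 4 * exp 4 + 8 * exp 4 * 6 + 8 * exp 4 * 40 * log γ with hD
  have hδ : ∀ᶠ γ in atTop, 1 - z γ (exitTime A γ) * m γ (exitTime A γ) ≤ D γ / γ ^ 2 := by
    filter_upwards [hev] with γ ⟨_, _, _, h4⟩
    refine h4.trans (le_of_eq ?_)
    simp only [hD]; ring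
  have hD0 : ∀ᶠ γ in atTop, 0 ≤ D γ := by
    filter_upwards [eventually_ge_atTop 1] with γ hγ
    have := log_nonneg hγ
    positivity
  have l1 : Tendsto (fun γ => γ - z γ (exitTime A γ)) atTop (𝓝 0) :=
    squeeze_zero' hgap0 hgap (tendsto_log_div_atTop 4 40)
  have l2 : Tendsto (fun γ => 1 - z γ (exitTime A γ) * m γ (exitTime A γ)) atTop (𝓝 0) := by
    refine squeeze_zero' hδ0 ?_ (tendsto_log_div_atTop
      (16 * exp 4 * exp 4 + 8 * exp 4 * 6) (8 * exp 4 * 40))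
    filter_upwards [hδ, hD0, eventually_ge_atTop 1] with γ h1 h2 h3
    refine h1.trans ?_
    have : γ ≤ γ ^ 2 := by nlinarith
    gcongr
  have l3 : Tendsto (fun γ => z γ (exitTime A γ) * m γ (exitTime A γ)) atTop (𝓝 1) := by
    simpa using (tendsto_const_nhds (x := (1:ℝ))).sub l2
  have l4 : Tendsto (fun γ => m γ (exitTime A γ)) atTop (𝓝 0) := by
    refine squeeze_zero' (g := fun γ : ℝ => 2 / γ) ?_ ?_
      (tendsto_const_nhds.div_atTop tendsto_id)
    · filter_upwards [hev] with γ ⟨h1, _⟩ using (h1 _ le_rfl).2.1.le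
    · filter_upwards [hev, eventually_gt_atTop 0] with γ ⟨h1, _⟩ hγ
      obtain ⟨h2, h3, h4⟩ := h1 _ le_rfl
      rw [le_div_iff₀ hγ]; nlinarith
  refine ⟨l1, l3, ?_, l4, ?_⟩
  · have := l3.add (l1.mul l4)
    simp only [mul_zero, add_zero] at this
    exact this.congr fun γ => by ring
  · rw [← tendsto_sub_nhds_zero_iff]
    refine squeeze_zero_norm' (a := fun γ : ℝ => (2 * (4 + 4 * A + 2 * (1 + A) *
      (16 * exp 4 * exp 4 + 8 * exp 4 * 6)) + (2 * (58 + 40 * A + 2 * (1 + A) *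
        (8 * exp 4 * 40))) * log γ) / γ) ?_ (tendsto_log_div_atTop _ _)
    filter_upwards [hev, hgap, hgap0, hδ, hδ0, hD0, eventually_ge_atTop 1,
      eventually_exitTime_mem A] with γ ⟨h1, h2, _⟩ g1 g0 d1 d0 hD0 hγ ht
    rw [abs_of_pos hA] at ht
    have hlog := log_nonneg hγ
    have hz := (h1 _ le_rfl).1
    set z₁ := z γ (exitTime A γ) with hz₁
    set m₁ := m γ (exitTime A γ) with hm₁
    set t₁ := exitTime A γ with ht₁
    have e1 : z₁ * (z₁ + m₁ * t₁ - A) =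
        (z₁ ^ 2 - γ ^ 2) + 18 * log γ + A * (γ - z₁) - (1 - z₁ * m₁) * t₁ := by
      simp only [ht₁, exitTime]; ring
    have hg : γ - z₁ ≤ 4 + 40 * log γ := g1.trans (div_le_self (by positivity) hγ)
    have hδt : |(1 - z₁ * m₁) * t₁| ≤ D γ * (2 * (1 + A)) / 2 := by
      have ht2 : |t₁| ≤ γ ^ 2 * (1 + A) := by
        rw [abs_le]
        constructor
        · nlinarith [ht.1]
        · nlinarith [ht.2, mul_nonneg hA.le (sq_nonneg γ)]
      rw [abs_mul, abs_of_nonneg d0]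
      calc _ ≤ D γ / γ ^ 2 * (γ ^ 2 * (1 + A)) := by gcongr
        _ = _ := by field_simp
    have hz0 : 0 < z₁ := by linarith
    have hzγ : z₁ ≤ γ := by linarith
    have e2 : |z₁ * (z₁ + m₁ * t₁ - A)| ≤ 4 + 4 * A + (58 + 40 * A) * log γ + (1 + A) * D γ := by
      rw [e1, abs_le]
      obtain ⟨b1, b2⟩ := abs_le.1 hδt
      have : A * (γ - z₁) ≤ A * (4 + 40 * log γ) := by gcongr
      have : 0 ≤ A * (γ - z₁) := by positivity
      have : z₁ ^ 2 ≤ γ ^ 2 := by gcongr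
      have : 0 ≤ A * log γ := by positivity
      constructor <;> nlinarith
    rw [abs_mul, abs_of_pos hz0] at e2
    rw [Real.norm_eq_abs, le_div_iff₀ (by linarith)]
    have e3 : |z₁ + m₁ * t₁ - A| * γ ≤ 2 * (z₁ * |z₁ + m₁ * t₁ - A|) := by
      nlinarith [abs_nonneg (z₁ + m₁ * t₁ - A)]
    have e4 : 0 ≤ (1 + A) * D γ := by positivity
    simp only [hD] at e2 e4
    nlinarith

lemma IsLogProfile.energy_le {κ b γ : ℝ} {z m : ℝ → ℝ} (h : IsLogProfile κ b γ z m) {t₃ t : ℝ}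
    (ht : t₃ ≤ t) :
    m t ^ 2 * exp (-t) + κ * z t ^ 2 + b * exp (z t ^ 2) ≤
      m t₃ ^ 2 * exp (-t₃) + κ * z t₃ ^ 2 + b * exp (z t₃ ^ 2) := by
  have := le_of_hasDerivAt_nonneg
    (X := fun t => -(m t ^ 2 * exp (-t) + κ * z t ^ 2 + b * exp (z t ^ 2))) ht
    (fun τ _ => ((((h.hm τ).pow 2).mul (hasDerivAt_neg τ).exp).add
      (((h.hz τ).pow 2).const_mul κ)).add ((((h.hz τ).pow 2).exp).const_mul b) |>.neg)
    fun τ _ => by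
      have h1 : exp τ * exp (-τ) = 1 := by rw [← exp_add]; simp
      have h2 : 0 ≤ m τ ^ 2 * exp (-τ) := by positivity
      simp only [Pi.pow_apply, nonlin]
      norm_num
      linear_combination h2 + 2 * m τ * (κ * z τ + b * z τ * exp (z τ ^ 2)) * h1
  linarith

set_option maxHeartbeats 800000 in
/-- The exponential nonlinearity is negligible after the bubble, and the profile remains positive
up to a time independent of the parameter. -/
lemma eventually_source {κ A : ℝ} (hκ : 0 < κ) (hA : 0 < A) {z m : ℝ → ℝ → ℝ}
    (h : ∀ γ, 0 < γ → IsLogProfile κ (exp (-(A * γ))) γ (z γ) (m γ)) :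
    ∃ t₃ ≤ 0, ∀ᶠ γ in atTop, (∀ t ≤ t₃, 0 < z γ t) ∧
      ∀ t ∈ Icc (exitTime A γ) 1,
        |exp t * (exp (-(A * γ)) * z γ t * exp (z γ t ^ 2))| ≤ (γ ^ 8)⁻¹ := by
  set t₃ := min 0 (-log (4 * κ)) with ht₃
  have ht₃0 : t₃ ≤ 0 := min_le_left _ _
  have hκt : κ * exp t₃ ≤ 1 / 4 := by
    have : exp t₃ ≤ exp (-log (4 * κ)) := exp_le_exp.2 (min_le_right _ _)
    rw [exp_neg, exp_log (by positivity)] at this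
    calc κ * exp t₃ ≤ κ * (4 * κ)⁻¹ := by gcongr
      _ = 1 / 4 := by field_simp
  refine ⟨t₃, ht₃0, ?_⟩
  obtain ⟨-, -, -, l4, l5⟩ := tendsto_exit hκ hA h
  have hmt : Tendsto (fun γ => m γ (exitTime A γ) * t₃) atTop (𝓝 0) := by
    simpa using l4.mul_const t₃
  have hpow : Tendsto (fun γ : ℝ => (γ ^ 4)⁻¹) atTop (𝓝 0) :=
    (tendsto_pow_atTop (by norm_num)).inv_tendsto_atTop
  set C := (A + 1) ^ 2 * exp (-t₃) + κ * (A + 1) ^ 2 + exp ((A + 1) ^ 2) with hC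
  have hC0 : 0 < C := by positivity
  have e1 : ∀ᶠ γ : ℝ in atTop, exp ((A + 1) ^ 2) * (γ ^ 9 * exp (-(A * γ))) ≤ 1 := by
    have := (tendsto_pow_mul_exp_neg_mul 9 hA).const_mul (exp ((A + 1) ^ 2))
    rw [mul_zero] at this
    exact this.eventually_le_const one_pos
  have e2 : ∀ᶠ γ : ℝ in atTop,
      exp 1 * (1 + C / κ) * exp (C / κ) * (γ ^ 8 * exp (-(A * γ))) ≤ 1 := by
    have := (tendsto_pow_mul_exp_neg_mul 8 hA).const_mul (exp 1 * (1 + C / κ) * exp (C / κ))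
    rw [mul_zero] at this
    exact this.eventually_le_const one_pos
  filter_upwards [eventually_exit hκ hA h, l5.eventually_lt_const (lt_add_of_pos_right A
    (by norm_num : (0:ℝ) < 1 / 4)), l5.eventually_const_lt (show A * (3 / 4) < A by linarith),
    hmt.eventually_const_lt (show -(1 / 4 : ℝ) < 0 by norm_num),
    l4.eventually_lt_const (show 0 < min (1 / 4) (A / 4) by positivity),
    hpow.eventually_lt_const (show 0 < min (1 / 4) (A / 8) by positivity),
    eventually_ge_atTop 4, eventually_ge_atTop (16 * exp 4), eventually_ge_atTop (|A|),
    eventually_ge_atTop (2 * (-t₃ + 1)), eventually_exitTime_mem A, e1, e2]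
    with γ hexit L1 L2 M1 M2 H1 h4 h16 hAγ hγt₃ hmem E1 E2
  have hγ : 0 < γ := by linarith
  have hprof := h γ hγ
  obtain ⟨x1, -, x3, -⟩ := hexit
  obtain ⟨hz₁, hm₁, hzm⟩ := x1 _ le_rfl
  set t₁ := exitTime A γ with ht₁
  set b := exp (-(A * γ)) with hb
  have hb0 : 0 < b := exp_pos _
  set η := (γ ^ 8)⁻¹ with hη
  have hη0 : 0 < η := by positivity
  have M2a := M2.trans_le (min_le_left _ _)
  have M2b := M2.trans_le (min_le_right _ _)
  have H1a := H1.trans_le (min_le_left _ _)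
  have H1b := H1.trans_le (min_le_right _ _)
  have hγsq : 4 * γ ≤ γ ^ 2 := by rw [sq]; gcongr
  have ht₁0 : t₁ < 0 := by linarith [hmem.2]
  have ht₁sq : -t₁ ≤ 2 * γ ^ 2 := by
    have : |A| * γ ≤ γ * γ := by gcongr
    linarith [hmem.1]
  have ht13 : t₁ ≤ t₃ := by linarith [hmem.2]
  have hηγ : η * γ ^ 4 = (γ ^ 4)⁻¹ := by rw [hη]; field_simp
  have hηt : η * t₁ ^ 2 ≤ 4 * (γ ^ 4)⁻¹ := by
    have : t₁ ^ 2 ≤ (2 * γ ^ 2) ^ 2 := by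
      rw [← neg_sq]; exact pow_le_pow_left₀ (by linarith) ht₁sq 2
    calc η * t₁ ^ 2 ≤ η * (2 * γ ^ 2) ^ 2 := by gcongr
      _ = 4 * (η * γ ^ 4) := by ring
      _ = _ := by rw [hηγ]
  have hηt' : η * (-t₁) ≤ 2 * (γ ^ 4)⁻¹ := by
    have : -t₁ ≤ 2 * γ ^ 4 := by
      have : γ ^ 2 ≤ γ ^ 4 := pow_le_pow_right₀ (by linarith) (by norm_num)
      linarith
    calc η * (-t₁) ≤ η * (2 * γ ^ 4) := by gcongr
      _ = _ := by rw [← hηγ]; ring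
  have hη₁ : b * γ * exp (z γ t₁ ^ 2 + t₁) ≤ η := by
    have e3 : exp t₁ * (b * z γ t₁ * exp (z γ t₁ ^ 2)) ≤ 8 * exp 4 / γ * (γ ^ 10)⁻¹ := by
      refine le_trans ?_ x3
      unfold nonlin
      have : 0 ≤ κ * z γ t₁ := by have : 0 < z γ t₁ := by linarith
                                  positivity
      gcongr
      linarith
    calc b * γ * exp (z γ t₁ ^ 2 + t₁) ≤ b * (2 * z γ t₁) * exp (z γ t₁ ^ 2 + t₁) := by
          gcongr; linarith
      _ = 2 * (exp t₁ * (b * z γ t₁ * exp (z γ t₁ ^ 2))) := by rw [exp_add]; ring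
      _ ≤ 2 * (8 * exp 4 / γ * (γ ^ 10)⁻¹) := by gcongr
      _ = 16 * exp 4 * (γ ^ 11)⁻¹ := by field_simp; ring
      _ ≤ γ * (γ ^ 11)⁻¹ := by gcongr
      _ = (γ ^ 10)⁻¹ := by field_simp
      _ ≤ η := by
        have : γ ^ 8 ≤ γ ^ 10 := pow_le_pow_right₀ (by linarith) (by norm_num)
        rw [hη]; gcongr
  set L₀ := z γ t₁ + m γ t₁ * t₁ with hL₀
  have hL₀0 : 0 ≤ L₀ := by linarith
  have hη₂ : b * γ * exp (L₀ ^ 2) ≤ η := by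
    rw [hη, ← one_div, le_div_iff₀ (by positivity)]
    refine le_trans ?_ E1
    calc b * γ * exp (L₀ ^ 2) * γ ^ 8 = exp (L₀ ^ 2) * (γ ^ 9 * b) := by ring
      _ ≤ _ := by gcongr; linarith
  have hneck := hprof.neck hκ hb0 hγ ht13 ht₃0 ht₁0 hκt hL₀ hL₀0 hm₁ (by linarith) hη₁ hη₂
    (by linarith)
  refine ⟨fun t ht => ?_, fun t ht => ?_⟩
  · rcases le_total t t₁ with h1 | h1
    · linarith [(x1 t h1).1]
    · exact (hneck t ⟨h1, ht⟩).1
  · rcases le_total t t₃ with h1 | h1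
    · exact (hneck t ⟨ht.1, h1⟩).2.2.2.2
    · obtain ⟨n1, n2, n3, n4, -⟩ := hneck t₃ ⟨ht13, le_rfl⟩
      have n5 : z γ t₃ ≤ A + 1 := by linarith
      have n6 : m γ t₃ ≤ A + 1 := by nlinarith
      have n7 : b ≤ 1 := exp_le_one_iff.2 (by nlinarith)
      have n8 : m γ t₃ ^ 2 * exp (-t₃) + κ * z γ t₃ ^ 2 + b * exp (z γ t₃ ^ 2) ≤ C := by
        calc _ ≤ (A + 1) ^ 2 * exp (-t₃) + κ * (A + 1) ^ 2 + 1 * exp ((A + 1) ^ 2) := by gcongr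
          _ = C := by rw [hC]; ring
      have n9 := (hprof.energy_le h1).trans n8
      have n10 : z γ t ^ 2 ≤ C / κ := by
        rw [le_div_iff₀ hκ]
        have : 0 ≤ m γ t ^ 2 * exp (-t) := by positivity
        have : 0 ≤ b * exp (z γ t ^ 2) := by positivity
        linarith
      have n11 : |z γ t| ≤ 1 + C / κ := by
        rw [← sq_abs] at n10
        nlinarith [sq_nonneg (|z γ t| - 1)]
      rw [abs_mul, abs_mul, abs_mul, abs_of_pos hb0, abs_of_pos (exp_pos _),
        abs_of_pos (exp_pos _), hη, ← one_div, le_div_iff₀ (by positivity)]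
      refine le_trans ?_ E2
      calc exp t * (b * |z γ t| * exp (z γ t ^ 2)) * γ ^ 8
          ≤ exp 1 * (b * (1 + C / κ) * exp (C / κ)) * γ ^ 8 := by gcongr; exact ht.2
        _ = _ := by ring

section

lemma abs_sub_le_of_hasDerivAt {X X' : ℝ → ℝ} {a t C : ℝ} (hat : a ≤ t)
    (hd : ∀ τ ∈ Icc a t, HasDerivAt X (X' τ) τ) (hC : ∀ τ ∈ Icc a t, |X' τ| ≤ C) :
    |X t - X a| ≤ C * (t - a) := by
  have := Convex.norm_image_sub_le_of_norm_hasDerivWithin_le (f := X) (f' := X') (s := Icc a t)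
    (fun x hx => (hd x hx).hasDerivWithinAt) hC (convex_Icc a t) ⟨le_rfl, hat⟩ ⟨hat, le_rfl⟩
  rwa [Real.norm_eq_abs, Real.norm_eq_abs, abs_of_nonneg (sub_nonneg.2 hat)] at this

lemma tendsto_exitTime (A : ℝ) : Tendsto (exitTime A) atTop atBot := by
  refine tendsto_atBot_mono' _ ?_ tendsto_neg_atTop_atBot
  filter_upwards [eventually_exitTime_mem A, eventually_ge_atTop 2] with γ h1 h2
  exact h1.2.trans (by nlinarith)

lemma tendsto_pow_mul_exitTime (A : ℝ) (n : ℕ) :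
    Tendsto (fun γ => (exitTime A γ) ^ n * exp (exitTime A γ)) atTop (𝓝 0) := by
  have h := (tendsto_pow_mul_exp_neg_atTop_nhds_zero n).comp
    (tendsto_neg_atBot_atTop.comp (tendsto_exitTime A))
  have := h.const_mul ((-1) ^ n)
  rw [mul_zero] at this
  refine this.congr fun γ => ?_
  simp only [Function.comp, neg_neg]
  rw [← mul_assoc, ← mul_pow]; simp

lemma eventually_abs_exitTime_le (A : ℝ) : ∀ᶠ γ in atTop, -(exitTime A γ) ≤ 2 * γ ^ 2 := by
  filter_upwards [eventually_exitTime_mem A, eventually_ge_atTop (|A|), eventually_ge_atTop 0]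
    with γ h1 h2 h3
  nlinarith [h1.1]

variable {κ A : ℝ} {z m : ℝ → ℝ → ℝ} {j p : ℝ → ℝ}

lemma tendsto_comp_exitTime (hj : IsLogProfile κ 0 1 j p) :
    Tendsto (fun γ => j (exitTime A γ)) atTop (𝓝 1) ∧
    Tendsto (fun γ => p (exitTime A γ)) atTop (𝓝 0) ∧
    Tendsto (fun γ => exitTime A γ * p (exitTime A γ)) atTop (𝓝 0) := by
  refine ⟨hj.tendsto_z.comp (tendsto_exitTime A), hj.tendsto_m.comp (tendsto_exitTime A), ?_⟩
  refine squeeze_zero_norm' (a := fun γ => |exitTime A γ ^ 1 * exp (exitTime A γ)| * nonlin κ 0 1)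
    (Eventually.of_forall fun γ => ?_) ?_
  · have := hj.m_le (exitTime A γ)
    rw [Real.norm_eq_abs, abs_mul, abs_mul, abs_of_pos (exp_pos _), pow_one, mul_assoc]
    gcongr
  · simpa using ((tendsto_pow_mul_exitTime A 1).abs).mul_const (nonlin κ 0 1)

/-- After the bubble, the profile and its flux are close to those of the linear profile. -/
lemma eventually_tangent (hκ : 0 < κ) (hA : 0 < A)
    (h : ∀ γ, 0 < γ → IsLogProfile κ (exp (-(A * γ))) γ (z γ) (m γ))
    (hj : IsLogProfile κ 0 1 j p) {ε : ℝ} (hε : 0 < ε) :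
    ∀ᶠ γ in atTop, ∀ t ∈ Icc (exitTime A γ) 1,
      |z γ t - A * j t + t * (m γ t - A * p t)| ≤ ε ∧ |m γ t - A * p t| ≤ ε := by
  obtain ⟨t₃, -, hs⟩ := eventually_source hκ hA h
  obtain ⟨-, -, -, l4, l5⟩ := tendsto_exit hκ hA h
  obtain ⟨j1, j2, j3⟩ := tendsto_comp_exitTime (A := A) hj
  have hP : Tendsto (fun γ => z γ (exitTime A γ) - A * j (exitTime A γ) +
      exitTime A γ * (m γ (exitTime A γ) - A * p (exitTime A γ))) atTop (𝓝 0) := by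
    have := (l5.sub (j1.const_mul A)).sub (j3.const_mul A)
    simp only [mul_one, sub_self, mul_zero] at this
    exact this.congr fun γ => by ring
  have hq : Tendsto (fun γ => m γ (exitTime A γ) - A * p (exitTime A γ)) atTop (𝓝 0) := by
    simpa using l4.sub (j2.const_mul A)
  have hpow : Tendsto (fun γ : ℝ => 12 * (γ ^ 2)⁻¹) atTop (𝓝 0) := by
    simpa using ((tendsto_pow_atTop (α := ℝ) (n := 2) (by norm_num)).inv_tendsto_atTop).const_mul 12
  have hlim := (((hP.pow 2).add (hq.pow 2)).add hpow).const_mul (exp (4 * κ * exp 1 + 2))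
  norm_num at hlim
  filter_upwards [hs, hlim.eventually_le_const (show 0 < ε ^ 2 by positivity),
    eventually_ge_atTop 2, eventually_abs_exitTime_le A, eventually_exitTime_mem A]
    with γ ⟨_, s2⟩ h1 h2 h3 h4 t ht
  have hγ : 0 < γ := by linarith
  have ht0 : exitTime A γ ≤ 0 := h4.2.trans (by simp; positivity)
  have hη1 : (γ ^ 8)⁻¹ ≤ 1 := inv_le_one_of_one_le₀ (one_le_pow₀ (by linarith))
  have hγ8 : γ ^ 8 = γ ^ 2 * γ ^ 6 := by ring
  have hγ1 : 1 ≤ γ ^ 2 := one_le_pow₀ (by linarith)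
  have hg := gronwall_tangent (d := fun t => z γ t - A * j t) (q := fun t => -(m γ t - A * p t))
    (η := (γ ^ 8)⁻¹) hκ.le ht0 le_rfl (by positivity) hη1
    (by
      rw [inv_mul_le_iff₀ (by positivity)]
      have : γ ^ 2 ≤ γ ^ 6 := pow_le_pow_right₀ (by linarith) (by norm_num)
      have : 2 ≤ γ ^ 6 := by nlinarith
      have : γ ^ 2 * 2 ≤ γ ^ 2 * γ ^ 6 := by gcongr
      linarith)
    (fun t => (((h γ hγ).hz t).sub ((hj.hz t).const_mul A)).congr_deriv (by ring))
    (fun t => (((h γ hγ).hm t).sub ((hj.hm t).const_mul A)).neg.congr_deriv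
      (show _ = -(κ * exp t * (z γ t - A * j t) +
        exp t * (exp (-(A * γ)) * z γ t * exp (z γ t ^ 2))) by unfold nonlin; ring)) s2 t ht
  have hcub : (γ ^ 8)⁻¹ * (2 - exitTime A γ - exitTime A γ ^ 3) ≤ 12 * (γ ^ 2)⁻¹ := by
    have e1 : -(exitTime A γ ^ 3) ≤ (2 * γ ^ 2) ^ 3 := by
      have : (-exitTime A γ) ^ 3 ≤ (2 * γ ^ 2) ^ 3 := pow_le_pow_left₀ (by linarith) h3 3
      calc _ = (-exitTime A γ) ^ 3 := by ring
        _ ≤ _ := this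
    have e2 : γ ^ 2 ≤ γ ^ 6 := pow_le_pow_right₀ (by linarith) (by norm_num)
    have e3 : 2 - exitTime A γ - exitTime A γ ^ 3 ≤ 12 * γ ^ 6 := by nlinarith
    calc _ ≤ (γ ^ 8)⁻¹ * (12 * γ ^ 6) := by gcongr
      _ = _ := by rw [hγ8]; field_simp
  have hfin : (z γ t - A * j t + t * (m γ t - A * p t)) ^ 2 + (m γ t - A * p t) ^ 2 ≤ ε ^ 2 := by
    refine le_trans (le_trans (le_of_eq (by ring)) hg) (le_trans ?_ h1)
    apply mul_le_mul_of_nonneg_left _ (exp_pos _).le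
    refine add_le_add (le_of_eq (by ring)) hcub
  constructor <;> refine abs_le_of_sq_le_sq ?_ hε.le
  · linarith [sq_nonneg (m γ t - A * p t)]
  · linarith [sq_nonneg (z γ t - A * j t + t * (m γ t - A * p t))]

/-- The Wronskian of the profile with the linear profile. -/
lemma eventually_wronskian (hκ : 0 < κ) (hA : 0 < A)
    (h : ∀ γ, 0 < γ → IsLogProfile κ (exp (-(A * γ))) γ (z γ) (m γ))
    (hj : IsLogProfile κ 0 1 j p) {ε : ℝ} (hε : 0 < ε) :
    ∀ᶠ γ in atTop, ∀ t ∈ Icc (exitTime A γ) 1, |γ * (m γ t * j t - z γ t * p t) - 1| ≤ ε := by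
  obtain ⟨t₃, -, hs⟩ := eventually_source hκ hA h
  obtain ⟨-, -, l3, -, -⟩ := tendsto_exit hκ hA h
  obtain ⟨j1, j2, j3⟩ := tendsto_comp_exitTime (A := A) hj
  have hzp : Tendsto (fun γ => γ * (z γ (exitTime A γ) * p (exitTime A γ))) atTop (𝓝 0) := by
    refine squeeze_zero_norm' (a := fun γ => γ ^ 2 * exp (exitTime A γ) * nonlin κ 0 1) ?_
      (by simpa using (tendsto_pow_mul_exp_exitTime A 2).mul_const (nonlin κ 0 1))
    filter_upwards [eventually_gt_atTop 0] with γ hγ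
    have e1 := hj.m_le (exitTime A γ)
    have e2 := (h γ hγ).bound (exitTime A γ)
    rw [Real.norm_eq_abs, abs_mul, abs_mul, abs_of_pos hγ]
    calc _ ≤ γ * (γ * (exp (exitTime A γ) * nonlin κ 0 1)) := by gcongr
      _ = _ := by ring
  have hW : Tendsto (fun γ => γ * (m γ (exitTime A γ) * j (exitTime A γ) -
      z γ (exitTime A γ) * p (exitTime A γ))) atTop (𝓝 1) := by
    have := (l3.mul j1).sub hzp
    simp only [mul_one, sub_zero] at this
    exact this.congr fun γ => by ring
  have hpow : Tendsto (fun γ : ℝ => 3 * (γ ^ 5)⁻¹) atTop (𝓝 0) := by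
    simpa using ((tendsto_pow_atTop (α := ℝ) (n := 5) (by norm_num)).inv_tendsto_atTop).const_mul 3
  have hlim := ((hW.sub_const 1).abs).add hpow
  norm_num at hlim
  filter_upwards [hs, hlim.eventually_le_const hε,
    eventually_ge_atTop 2, eventually_abs_exitTime_le A]
    with γ ⟨_, s2⟩ h1 h2 h3 t ht
  have hγ : 0 < γ := by linarith
  have hd := abs_sub_le_of_hasDerivAt (X := fun t => m γ t * j t - z γ t * p t)
    (C := (γ ^ 8)⁻¹) ht.1
    (fun τ _ => ((((h γ hγ).hm τ).mul (hj.hz τ)).sub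
      (((h γ hγ).hz τ).mul (hj.hm τ))).congr_deriv (show _ =
        exp τ * (exp (-(A * γ)) * z γ τ * exp (z γ τ ^ 2)) * j τ by
          unfold nonlin; ring)) fun τ hτ => by
        rw [abs_mul]
        have e1 := s2 τ ⟨hτ.1, hτ.2.trans ht.2⟩
        have e2 := hj.bound τ
        calc _ ≤ (γ ^ 8)⁻¹ * 1 := by gcongr
          _ = _ := mul_one _
  have e3 : (γ ^ 8)⁻¹ * (t - exitTime A γ) ≤ (γ ^ 8)⁻¹ * (3 * γ ^ 2) := by
    gcongr
    nlinarith [ht.2]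
  have e4 : γ * ((γ ^ 8)⁻¹ * (3 * γ ^ 2)) = 3 * (γ ^ 5)⁻¹ := by field_simp
  have e5 := mul_le_mul_of_nonneg_left (hd.trans e3) hγ.le
  rw [e4, ← abs_of_pos hγ, ← abs_mul, abs_of_pos hγ] at e5
  calc _ = |(γ * (m γ (exitTime A γ) * j (exitTime A γ) -
      z γ (exitTime A γ) * p (exitTime A γ)) - 1) +
        γ * (m γ t * j t - z γ t * p t - (m γ (exitTime A γ) * j (exitTime A γ) -
      z γ (exitTime A γ) * p (exitTime A γ)))| := by ring_nf
    _ ≤ _ := (abs_add_le _ _).trans (add_le_add le_rfl e5)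
    _ ≤ ε := h1

/-- Pohozaev-type identity for the Dirichlet energy of the profile. -/
lemma eventually_dirichlet (hκ : 0 < κ) (hA : 0 < A)
    (h : ∀ γ, 0 < γ → IsLogProfile κ (exp (-(A * γ))) γ (z γ) (m γ))
    (hj : IsLogProfile κ 0 1 j p) {g : ℝ → ℝ → ℝ}
    (hg : ∀ γ, 0 < γ → ∀ t, HasDerivAt (g γ) (m γ t ^ 2) t)
    (hg0 : ∀ γ, 0 < γ → Tendsto (g γ) atBot (𝓝 0)) {ε : ℝ} (hε : 0 < ε) :
    ∀ᶠ γ in atTop, ∀ t ∈ Icc (exitTime A γ) 1,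
      |g γ t + z γ t * m γ t - m γ t ^ 2 - κ * exp t * z γ t ^ 2 - 1| ≤ ε := by
  obtain ⟨t₃, -, hs⟩ := eventually_source hκ hA h
  obtain ⟨l1, l2, l3, l4, -⟩ := tendsto_exit hκ hA h
  have hgl : Tendsto (fun γ => g γ (exitTime A γ)) atTop (𝓝 0) := by
    refine squeeze_zero' (g := fun γ => 2 / γ * (γ - z γ (exitTime A γ))) ?_ ?_ ?_
    · filter_upwards [eventually_gt_atTop 0] with γ hγ
      exact nonneg_of_hasDerivAt_nonneg_atBot (fun t _ => hg γ hγ t) (fun t _ => sq_nonneg _)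
        (hg0 γ hγ)
    · filter_upwards [eventually_exit hκ hA h, eventually_gt_atTop 0] with γ ⟨x1, _⟩ hγ
      have := nonneg_of_hasDerivAt_nonneg_atBot
        (X := fun t => 2 / γ * (γ - z γ t) - g γ t) (T := exitTime A γ)
        (fun t _ => ((((h γ hγ).hz t).const_sub γ).const_mul (2 / γ)).sub (hg γ hγ t))
        (fun t ht => by
          obtain ⟨y1, y2, y3⟩ := x1 t ht
          have : m γ t ≤ 2 / γ := by rw [le_div_iff₀ hγ]; nlinarith
          nlinarith)
        (by simpa using (((h γ hγ).tendsto_z.const_sub γ).const_mul (2 / γ)).sub (hg0 γ hγ))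
      linarith
    · have : Tendsto (fun γ : ℝ => 2 / γ) atTop (𝓝 0) := tendsto_const_nhds.div_atTop tendsto_id
      simpa using this.mul l1
  have hz2 : Tendsto (fun γ => κ * exp (exitTime A γ) * z γ (exitTime A γ) ^ 2) atTop (𝓝 0) := by
    refine squeeze_zero' (g := fun γ => κ * (γ ^ 2 * exp (exitTime A γ)))
      (Eventually.of_forall fun γ => by positivity) ?_
      (by simpa using (tendsto_pow_mul_exp_exitTime A 2).const_mul κ)
    filter_upwards [eventually_gt_atTop 0] with γ hγ
    have e2 := (h γ hγ).bound (exitTime A γ)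
    have : z γ (exitTime A γ) ^ 2 ≤ γ ^ 2 := by rw [← sq_abs]; gcongr
    calc _ ≤ κ * exp (exitTime A γ) * γ ^ 2 := by gcongr
      _ = _ := by ring
  have hN := ((hgl.add l2).sub (l4.pow 2)).sub hz2
  have hpow : Tendsto (fun γ : ℝ => 6 * (γ ^ 5)⁻¹) atTop (𝓝 0) := by
    simpa using ((tendsto_pow_atTop (α := ℝ) (n := 5) (by norm_num)).inv_tendsto_atTop).const_mul 6
  have hlim := ((hN.sub_const 1).abs).add hpow
  norm_num at hlim
  filter_upwards [hs, hlim.eventually_le_const hε, eventually_tangent hκ hA h hj one_pos,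
    eventually_ge_atTop 2, eventually_ge_atTop (2 * (1 + A * (exp 1 * nonlin κ 0 1))),
    eventually_abs_exitTime_le A]
    with γ ⟨_, s2⟩ h1 h5 h2 h6 h3 t ht
  have hγ : 0 < γ := by linarith
  have hn0 : 0 ≤ nonlin κ 0 1 := by unfold nonlin; positivity
  have hd := abs_sub_le_of_hasDerivAt
    (X := fun t => g γ t + z γ t * m γ t - m γ t ^ 2 - κ * exp t * z γ t ^ 2)
    (C := (γ ^ 8)⁻¹ * (2 * γ)) ht.1
    (fun τ _ => ((((hg γ hγ τ).add (((h γ hγ).hz τ).mul ((h γ hγ).hm τ))).sub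
      (((h γ hγ).hm τ).pow 2)).sub (((Real.hasDerivAt_exp τ).const_mul κ).mul
        (((h γ hγ).hz τ).pow 2))).congr_deriv (show _ =
        exp τ * (exp (-(A * γ)) * z γ τ * exp (z γ τ ^ 2)) * (z γ τ - 2 * m γ τ) by
          simp only [nonlin, Pi.pow_apply]; push_cast; ring)) fun τ hτ => by
        rw [abs_mul]
        have e1 := s2 τ ⟨hτ.1, hτ.2.trans ht.2⟩
        have e2 := (h γ hγ).bound τ
        have e3 := (h5 τ ⟨hτ.1, hτ.2.trans ht.2⟩).2
        have e4 : |p τ| ≤ exp 1 * nonlin κ 0 1 := (hj.m_le τ).trans (by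
          gcongr; exact hτ.2.trans ht.2)
        have e5 : |m γ τ| ≤ 1 + A * (exp 1 * nonlin κ 0 1) := by
          calc |m γ τ| = |(m γ τ - A * p τ) + A * p τ| := by ring_nf
            _ ≤ |m γ τ - A * p τ| + |A * p τ| := abs_add_le _ _
            _ ≤ _ := by rw [abs_mul, abs_of_pos hA]; gcongr
        have e6 : |z γ τ - 2 * m γ τ| ≤ 2 * γ := by
          refine (abs_sub _ _).trans ?_
          rw [abs_mul, abs_two]; linarith
        gcongr
  have e3 : (γ ^ 8)⁻¹ * (2 * γ) * (t - exitTime A γ) ≤ (γ ^ 8)⁻¹ * (2 * γ) * (3 * γ ^ 2) := by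
    gcongr
    nlinarith [ht.2]
  have e4 : (γ ^ 8)⁻¹ * (2 * γ) * (3 * γ ^ 2) = 6 * (γ ^ 5)⁻¹ := by field_simp; ring
  have e5 := hd.trans (e3.trans_eq e4)
  set X := fun t => g γ t + z γ t * m γ t - m γ t ^ 2 - κ * exp t * z γ t ^ 2 with hX
  calc _ = |(X (exitTime A γ) - 1) + (X t - X (exitTime A γ))| := by simp only [hX]; ring_nf
    _ ≤ _ := (abs_add_le _ _).trans (add_le_add le_rfl e5)
    _ ≤ ε := h1

end

namespace IsProfile
variable {κ b γ : ℝ} {w : ℝ → ℝ}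

lemma hasDerivAt (h : IsProfile κ b γ w) (s : ℝ) : HasDerivAt w (deriv w s) s :=
  (h.smooth.differentiable (by simp)).differentiableAt.hasDerivAt

lemma continuous_deriv (h : IsProfile κ b γ w) : Continuous (deriv w) :=
  h.smooth.continuous_deriv (by simp)

lemma hasDerivAt_deriv (h : IsProfile κ b γ w) (s : ℝ) :
    HasDerivAt (deriv w) (deriv (deriv w) s) s :=
  ((h.smooth.of_le (by norm_cast) :
    ContDiff ℝ 2 w).differentiable_deriv_two).differentiableAt.hasDerivAt

lemma deriv_add_mul_deriv_deriv (h : IsProfile κ b γ w) {s : ℝ} (hs : 0 ≤ s) :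
    deriv w s + s * deriv (deriv w) s = -nonlin κ b (w s) := by
  have := (h.ode s hs).unique ((hasDerivAt_id s).mul (h.hasDerivAt_deriv s))
  simp only [id, one_mul] at this
  exact this.symm

/-- The Dirichlet energy of the profile on `[0, s]`. -/
lemma hasDerivAt_dirichlet (h : IsProfile κ b γ w) (t : ℝ) :
    HasDerivAt (fun t => ∫ σ in (0:ℝ)..exp t, σ * deriv w σ ^ 2)
      ((-(exp t * deriv w (exp t))) ^ 2) t := by
  have hc : Continuous fun σ => σ * deriv w σ ^ 2 := continuous_id.mul (h.continuous_deriv.pow 2)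
  have h1 := (hc.integral_hasStrictDerivAt 0 (exp t)).hasDerivAt
  exact (h1.comp t (Real.hasDerivAt_exp t)).congr_deriv (by ring)

lemma tendsto_dirichlet (h : IsProfile κ b γ w) :
    Tendsto (fun t => ∫ σ in (0:ℝ)..exp t, σ * deriv w σ ^ 2) atBot (𝓝 0) := by
  have hc : Continuous fun σ => σ * deriv w σ ^ 2 := continuous_id.mul (h.continuous_deriv.pow 2)
  have h1 := (hc.integral_hasStrictDerivAt 0 0).hasDerivAt.continuousAt.tendsto
  simp only [intervalIntegral.integral_same] at h1
  exact h1.comp Real.tendsto_exp_atBot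

/-- Pohozaev identity for the linear profile. -/
lemma pohozaev (h : IsProfile κ 0 γ w) {s : ℝ} (hs : 0 ≤ s) :
    (s * deriv w s) ^ 2 + κ * s * w s ^ 2 = κ * ∫ σ in (0:ℝ)..s, w σ ^ 2 := by
  have hd : ∀ x ∈ uIcc 0 s, HasDerivAt (fun x => (x * deriv w x) ^ 2 + κ * x * w x ^ 2)
      (κ * w x ^ 2) x := fun x hx => by
    rw [uIcc_of_le hs] at hx
    refine (((h.ode x hx.1).pow 2).add (((hasDerivAt_id x).const_mul κ).mul
      ((h.hasDerivAt x).pow 2))).congr_deriv ?_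
    simp only [nonlin, Pi.pow_apply, id]
    push_cast
    ring
  have hc : Continuous fun x => κ * w x ^ 2 :=
    continuous_const.mul (h.smooth.continuous.pow 2)
  have := intervalIntegral.integral_eq_sub_of_hasDerivAt hd (hc.intervalIntegrable _ _)
  rw [intervalIntegral.integral_const_mul] at this
  rw [this]; ring

lemma deriv_ne_zero (h : IsProfile κ 0 γ w) (hκ : 0 < κ) (hγ : 0 < γ) {s : ℝ} (hs : 0 < s)
    (h0 : w s = 0) : deriv w s ≠ 0 := by
  intro hd
  have h1 := h.pohozaev hs.le
  have h2 : 0 < ∫ σ in (0:ℝ)..s, w σ ^ 2 :=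
    intervalIntegral.integral_pos hs (h.smooth.continuous.pow 2).continuousOn
      (fun x _ => sq_nonneg _) ⟨0, ⟨le_rfl, hs.le⟩, by rw [h.init]; positivity⟩
  rw [h0, hd] at h1
  nlinarith [mul_pos hκ h2]

end IsProfile

section limits
variable {κ A : ℝ} {w : ℝ → ℝ → ℝ} {J : ℝ → ℝ}

lemma eventually_log_mem (A : ℝ) {s₀ : ℝ} (hs₀ : 0 < s₀) :
    ∀ᶠ γ in atTop, ∀ s ∈ Icc s₀ 2, log s ∈ Icc (exitTime A γ) 1 := by
  filter_upwards [(tendsto_exitTime A).eventually_le_atBot (log s₀)] with γ h s hs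
  refine ⟨h.trans (log_le_log hs₀ hs.1), ?_⟩
  have := log_le_log (hs₀.trans_le hs.1) hs.2
  linarith [log_two_lt_d9]

lemma eventually_pos (hκ : 0 < κ) (hA : 0 < A)
    (hw : ∀ γ, 0 < γ → IsProfile κ (exp (-(A * γ))) γ (w γ)) :
    ∃ s₃ > 0, ∀ᶠ γ in atTop, ∀ s ∈ Icc 0 s₃, 0 < w γ s := by
  obtain ⟨t₃, -, h⟩ := eventually_source hκ hA (fun γ hγ => (hw γ hγ).toLog hκ.le (exp_pos _).le)
  refine ⟨exp t₃, exp_pos _, ?_⟩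
  filter_upwards [h, eventually_gt_atTop 0] with γ ⟨h1, _⟩ hγ s hs
  rcases eq_or_lt_of_le hs.1 with rfl | h0
  · rw [(hw γ hγ).init]; exact hγ
  · have := h1 (log s) ((log_le_iff_le_exp h0).2 hs.2)
    rwa [exp_log h0] at this

lemma eventually_close (hκ : 0 < κ) (hA : 0 < A)
    (hw : ∀ γ, 0 < γ → IsProfile κ (exp (-(A * γ))) γ (w γ)) (hJ : IsProfile κ 0 1 J)
    {s₀ ε : ℝ} (hs₀ : 0 < s₀) (hε : 0 < ε) :
    ∀ᶠ γ in atTop, ∀ s ∈ Icc s₀ 2,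
      |w γ s - A * J s| ≤ ε ∧ |deriv (w γ) s - A * deriv J s| ≤ ε := by
  set M := |log s₀| + 1 with hM
  have hM0 : 0 < M := by positivity
  filter_upwards [eventually_log_mem A hs₀, eventually_tangent hκ hA
    (fun γ hγ => (hw γ hγ).toLog hκ.le (exp_pos _).le) (hJ.toLog hκ.le le_rfl)
    (show 0 < min (ε / (1 + M)) (ε * s₀) by positivity)] with γ h1 h2 s hs
  have hs0 : 0 < s := hs₀.trans_le hs.1
  obtain ⟨h3, h4⟩ := h2 _ (h1 s hs)
  rw [exp_log hs0] at h3 h4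
  have hlog : |log s| ≤ M := by
    rw [abs_le]
    have e1 := log_le_log hs₀ hs.1
    have e2 := log_le_log hs0 hs.2
    have e3 := neg_abs_le (log s₀)
    have e4 := abs_nonneg (log s₀)
    constructor <;> linarith [log_two_lt_d9]
  constructor
  · calc |w γ s - A * J s| = |(w γ s - A * J s + log s * (-(s * deriv (w γ) s) -
          A * -(s * deriv J s))) - log s * (-(s * deriv (w γ) s) - A * -(s * deriv J s))| := by
          ring_nf
      _ ≤ _ := abs_sub _ _
      _ ≤ ε / (1 + M) + M * (ε / (1 + M)) := by
        rw [abs_mul]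
        have := h3.trans (min_le_left _ _)
        have := h4.trans (min_le_left _ _)
        gcongr
      _ = ε := by field_simp
  · have h5 := h4.trans (min_le_right _ _)
    have e : -(s * deriv (w γ) s) - A * -(s * deriv J s) =
      -(s * (deriv (w γ) s - A * deriv J s)) := by ring
    rw [e, abs_neg, abs_mul, abs_of_pos hs0] at h5
    have h6 : s₀ * |deriv (w γ) s - A * deriv J s| ≤ s * |deriv (w γ) s - A * deriv J s| := by
      gcongr; exact hs.1
    exact le_of_mul_le_mul_left (by linarith) hs₀

lemma eventually_wronskian_profile (hκ : 0 < κ) (hA : 0 < A)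
    (hw : ∀ γ, 0 < γ → IsProfile κ (exp (-(A * γ))) γ (w γ)) (hJ : IsProfile κ 0 1 J)
    {s₀ ε : ℝ} (hs₀ : 0 < s₀) (hε : 0 < ε) :
    ∀ᶠ γ in atTop, ∀ s ∈ Icc s₀ 2,
      |γ * (s * (w γ s * deriv J s - deriv (w γ) s * J s)) - 1| ≤ ε := by
  filter_upwards [eventually_log_mem A hs₀, eventually_wronskian hκ hA
    (fun γ hγ => (hw γ hγ).toLog hκ.le (exp_pos _).le) (hJ.toLog hκ.le le_rfl) hε] with γ h1 h2 s hs
  have h3 := h2 _ (h1 s hs)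
  rw [exp_log (hs₀.trans_le hs.1)] at h3
  refine le_trans (le_of_eq ?_) h3
  ring_nf

lemma eventually_dirichlet_profile (hκ : 0 < κ) (hA : 0 < A)
    (hw : ∀ γ, 0 < γ → IsProfile κ (exp (-(A * γ))) γ (w γ)) (hJ : IsProfile κ 0 1 J)
    {s₀ ε : ℝ} (hs₀ : 0 < s₀) (hε : 0 < ε) :
    ∀ᶠ γ in atTop, ∀ s ∈ Icc s₀ 2,
      |(∫ σ in (0:ℝ)..s, σ * deriv (w γ) σ ^ 2) - s * w γ s * deriv (w γ) s -
        (s * deriv (w γ) s) ^ 2 - κ * s * w γ s ^ 2 - 1| ≤ ε := by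
  filter_upwards [eventually_log_mem A hs₀, eventually_dirichlet hκ hA
    (fun γ hγ => (hw γ hγ).toLog hκ.le (exp_pos _).le) (hJ.toLog hκ.le le_rfl)
    (fun γ hγ => (hw γ hγ).hasDerivAt_dirichlet) (fun γ hγ => (hw γ hγ).tendsto_dirichlet) hε]
    with γ h1 h2 s hs
  have h3 := h2 _ (h1 s hs)
  rw [exp_log (hs₀.trans_le hs.1)] at h3
  refine le_trans (le_of_eq ?_) h3
  ring_nf

end limits

section zeros

lemma exists_unique_zero {f f' : ℝ → ℝ} {a b c : ℝ} (hab : a < b)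
    (hd : ∀ x ∈ Icc a b, HasDerivAt f (f' x) x) (hpos : ∀ x ∈ Icc a b, 0 < c * f' x)
    (ha : c * f a < 0) (hb : 0 < c * f b) :
    ∃ z ∈ Ioo a b, f z = 0 ∧ ∀ x ∈ Icc a b, f x = 0 → x = z := by
  have hc : ContinuousOn (fun x => c * f x) (Icc a b) :=
    fun x hx => ((hd x hx).const_mul c).continuousAt.continuousWithinAt
  have hmono : StrictMonoOn (fun x => c * f x) (Icc a b) := by
    refine strictMonoOn_of_deriv_pos (convex_Icc a b) hc fun x hx => ?_
    rw [interior_Icc] at hx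
    rw [((hd x (Ioo_subset_Icc_self hx)).const_mul c).deriv]
    exact hpos x (Ioo_subset_Icc_self hx)
  have hc0 : c ≠ 0 := by rintro rfl; simp at ha
  obtain ⟨z, hz, h0⟩ := intermediate_value_Ioo hab.le hc ⟨ha, hb⟩
  have h0' : c * f z = 0 := h0
  refine ⟨z, hz, by simpa [hc0] using h0', fun x hx hfx => ?_⟩
  exact hmono.injOn hx (Ioo_subset_Icc_self hz) (by simp only [h0', hfx, mul_zero])

lemma eventually_pos_of_uniform {F : ℝ → ℝ → ℝ} {G : ℝ → ℝ} {K : Set ℝ} (hK : IsCompact K)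
    (hG : ContinuousOn G K) (hpos : ∀ x ∈ K, 0 < G x)
    (hc : ∀ ε > 0, ∀ᶠ γ in atTop, ∀ x ∈ K, |F γ x - G x| ≤ ε) :
    ∀ᶠ γ in atTop, ∀ x ∈ K, 0 < F γ x := by
  rcases K.eq_empty_or_nonempty with rfl | hne
  · simp
  obtain ⟨x₀, hx₀, hmin⟩ := hK.exists_isMinOn hne hG
  filter_upwards [hc (G x₀ / 2) (half_pos (hpos x₀ hx₀))] with γ h x hx
  have h1 : G x₀ ≤ G x := hmin hx
  have h2 := (abs_le.1 (h x hx)).1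
  linarith [hpos x₀ hx₀]

lemma strictMonoOn_const_mul {J : ℝ → ℝ} {c a b : ℝ} (hd : Differentiable ℝ J)
    (h : ∀ x ∈ Icc a b, 0 < c * deriv J x) : StrictMonoOn (fun x => c * J x) (Icc a b) := by
  refine strictMonoOn_of_deriv_pos (convex_Icc a b) (hd.continuous.const_mul c).continuousOn
    fun x hx => ?_
  rw [interior_Icc] at hx
  rw [((hd x).hasDerivAt.const_mul c).deriv]
  exact h x (Ioo_subset_Icc_self hx)

/-- A zero of `f` preceded in `(0, S)` by exactly `n` zeros and by a negative value. -/
structure IsNodalZero (f : ℝ → ℝ) (n : ℕ) (S : ℝ) : Prop where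
  pos : 0 < S
  zero : f S = 0
  ncard : {s : ℝ | s ∈ Ioo 0 S ∧ f s = 0}.ncard = n
  neg : ∃ s ∈ Ioo 0 S, f s < 0

lemma IsNodalZero.unique {f : ℝ → ℝ} {n : ℕ} (hn : n ≠ 0) {S T : ℝ} (hS : IsNodalZero f n S)
    (hT : IsNodalZero f n T) : S = T := by
  have key : ∀ {S T : ℝ}, IsNodalZero f n S → IsNodalZero f n T → ¬ S < T := by
    intro S T hS hT hlt
    have hfin : {s : ℝ | s ∈ Ioo 0 T ∧ f s = 0}.Finite :=
      finite_of_ncard_ne_zero (by rw [hT.ncard]; exact hn)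
    have := ncard_lt_ncard (s := {s : ℝ | s ∈ Ioo 0 S ∧ f s = 0})
      (t := {s : ℝ | s ∈ Ioo 0 T ∧ f s = 0}) ⟨fun s hs => ⟨⟨hs.1.1, hs.1.2.trans hlt⟩, hs.2⟩,
        fun h => lt_irrefl S (h (show S ∈ _ from ⟨⟨hS.pos, hlt⟩, hS.zero⟩)).1.2⟩ hfin
    rw [hS.ncard, hT.ncard] at this
    exact lt_irrefl _ this
  exact le_antisymm (not_lt.1 (key hT hS)) (not_lt.1 (key hS hT))

variable {A : ℝ} {w : ℝ → ℝ → ℝ} {J : ℝ → ℝ}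

lemma eventually_isNodalZero (hA : 0 < A) (hJd : Differentiable ℝ J) (hJc : Continuous (deriv J))
    (hJ0 : 0 < J 0) (hwd : ∀ γ > 0, Differentiable ℝ (w γ))
    (hpos : ∃ s₃ > 0, ∀ᶠ γ in atTop, ∀ s ∈ Icc 0 s₃, 0 < w γ s)
    (hclose : ∀ s₀ > 0, ∀ ε > 0, ∀ᶠ γ in atTop, ∀ s ∈ Icc s₀ 2,
      |w γ s - A * J s| ≤ ε ∧ |deriv (w γ) s - A * deriv J s| ≤ ε)
    (hfin : {s : ℝ | s ∈ Ioo 0 1 ∧ J s = 0}.Finite)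
    (hne : {s : ℝ | s ∈ Ioo 0 1 ∧ J s = 0}.Nonempty) (hJ1 : J 1 = 0)
    (hsimple : ∀ s, 0 < s → J s = 0 → deriv J s ≠ 0) :
    ∀ᶠ δ in 𝓝[>] (0:ℝ), ∀ᶠ γ in atTop, ∃ S ∈ Ioo (1 - δ) (1 + δ),
      IsNodalZero (w γ) {s : ℝ | s ∈ Ioo 0 1 ∧ J s = 0}.ncard S := by
  set Z := {s : ℝ | s ∈ Ioo 0 1 ∧ J s = 0} with hZ
  obtain ⟨s₃, hs₃, hw₃⟩ := hpos
  obtain ⟨r, hr, hJr⟩ := Metric.eventually_nhds_iff.1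
    (hJd.continuous.continuousAt.eventually (lt_mem_nhds hJ0))
  set s₀ := min (min s₃ (r / 2)) 1 with hs₀
  have hs₀0 : 0 < s₀ := by positivity
  have hJs₀ : ∀ s ∈ Icc 0 s₀, 0 < J s := fun s hs => hJr (by
    rw [Real.dist_eq, sub_zero, abs_of_nonneg hs.1]
    have := hs.2.trans ((min_le_left _ _).trans (min_le_right _ _))
    linarith)
  set Z' := insert 1 Z with hZ'
  have hfin' : Z'.Finite := hfin.insert 1
  have hZ'0 : ∀ a ∈ Z', J a = 0 := by
    rintro a (rfl | ha); exacts [hJ1, ha.2]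
  have hZ'1 : ∀ a ∈ Z', a ≤ 1 := by
    rintro a (rfl | ha); exacts [le_rfl, ha.1.2.le]
  have hZ's : ∀ a ∈ Z', s₀ < a := fun a ha => by
    by_contra! hle
    have h0 : 0 ≤ a := by
      rcases ha with rfl | ha; exacts [zero_le_one, ha.1.1.le]
    exact (hJs₀ a ⟨h0, hle⟩).ne' (hZ'0 a ha)
  have hlt : ∀ c : ℝ, 0 < c → ∀ᶠ δ in 𝓝[>] (0:ℝ), δ < c := fun c hc =>
    mem_nhdsWithin_of_mem_nhds (gt_mem_nhds hc)
  have hδ1 : ∀ᶠ δ in 𝓝[>] (0:ℝ), ∀ a ∈ Z', ∀ x ∈ Icc (a - δ) (a + δ),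
      0 < deriv J a * deriv J x := by
    refine (eventually_all_finite hfin').2 fun a ha => ?_
    have h1 : 0 < deriv J a * deriv J a :=
      mul_self_pos.2 (hsimple a (hs₀0.trans (hZ's a ha)) (hZ'0 a ha))
    obtain ⟨ρ, hρ, h2⟩ := Metric.eventually_nhds_iff.1
      ((hJc.const_mul (deriv J a)).continuousAt.eventually (lt_mem_nhds h1))
    filter_upwards [hlt ρ hρ] with δ hδ x hx
    refine h2 ?_
    rw [Real.dist_eq]
    exact (abs_le.2 ⟨by linarith [hx.1], by linarith [hx.2]⟩).trans_lt hδ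
  have hδ2 : ∀ᶠ δ in 𝓝[>] (0:ℝ), ∀ a ∈ Z', δ < a - s₀ :=
    (eventually_all_finite hfin').2 fun a ha => hlt _ (by linarith [hZ's a ha])
  have hδ3 : ∀ᶠ δ in 𝓝[>] (0:ℝ), ∀ a ∈ Z', ∀ b ∈ Z', a < b → δ < (b - a) / 2 :=
    (eventually_all_finite hfin').2 fun a ha => (eventually_all_finite hfin').2 fun b hb => by
      by_cases hab : a < b
      · filter_upwards [hlt ((b - a) / 2) (by linarith)] with δ h _ using h
      · exact Eventually.of_forall fun δ h => absurd h hab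
  filter_upwards [hδ1, hδ2, hδ3, hlt 1 one_pos, self_mem_nhdsWithin] with δ h1 h2 h3 h4 h5
  have hδ : 0 < δ := h5
  have hsub : ∀ a ∈ Z', Icc (a - δ) (a + δ) ⊆ Icc s₀ 2 := fun a ha x hx =>
    ⟨by linarith [hx.1, h2 a ha], by linarith [hx.2, hZ'1 a ha]⟩
  have hmono : ∀ a ∈ Z', StrictMonoOn (fun x => deriv J a * J x) (Icc (a - δ) (a + δ)) :=
    fun a ha => strictMonoOn_const_mul hJd (h1 a ha)
  have hcl : ∀ ε > 0, ∀ᶠ γ in atTop, ∀ s ∈ Icc s₀ 2,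
      |w γ s - A * J s| ≤ ε ∧ |deriv (w γ) s - A * deriv J s| ≤ ε := hclose s₀ hs₀0
  have hmul : ∀ c : ℝ, ∀ ε > 0, ∀ x y : ℝ, |x - y| ≤ ε / (|c| + 1) → |c * x - c * y| ≤ ε := by
    intro c ε hε x y h
    rw [← mul_sub, abs_mul]
    calc |c| * |x - y| ≤ (|c| + 1) * (ε / (|c| + 1)) := by gcongr; linarith
      _ = ε := by field_simp
  have ev1 : ∀ᶠ γ in atTop, ∀ a ∈ Z', ∀ x ∈ Icc (a - δ) (a + δ),
      0 < deriv J a * deriv (w γ) x := by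
    refine (eventually_all_finite hfin').2 fun a ha => ?_
    refine eventually_pos_of_uniform (G := fun x => deriv J a * (A * deriv J x)) isCompact_Icc
      ((hJc.const_mul _).const_mul _).continuousOn
      (fun x hx => by have := mul_pos hA (h1 a ha x hx); linarith) fun ε hε => ?_
    filter_upwards [hcl (ε / (|deriv J a| + 1)) (by positivity)] with γ h x hx
    exact hmul _ ε hε _ _ (h x (hsub a ha hx)).2
  have ev2 : ∀ᶠ γ in atTop, ∀ a ∈ Z', deriv J a * w γ (a - δ) < 0 ∧
      0 < deriv J a * w γ (a + δ) := by
    refine (eventually_all_finite hfin').2 fun a ha => ?_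
    have hma : a - δ ∈ Icc (a - δ) (a + δ) := ⟨le_rfl, by linarith⟩
    have hpa : a + δ ∈ Icc (a - δ) (a + δ) := ⟨by linarith, le_rfl⟩
    have ha' : a ∈ Icc (a - δ) (a + δ) := ⟨by linarith, by linarith⟩
    have e1 := hmono a ha hma ha' (by linarith)
    have e2 := hmono a ha ha' hpa (by linarith)
    simp only [hZ'0 a ha, mul_zero] at e1 e2
    have e3 := eventually_pos_of_uniform (F := fun γ x => deriv J a * w γ x)
      (G := fun x => deriv J a * (A * J x)) (K := {a + δ}) isCompact_singleton
      (continuousOn_singleton _ _) (by rintro _ rfl; have := mul_pos hA e2; linarith)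
      (fun ε hε => by
        filter_upwards [hcl (ε / (|deriv J a| + 1)) (by positivity)] with γ h x hx
        obtain rfl : x = a + δ := hx
        exact hmul _ ε hε _ _ (h _ (hsub a ha hpa)).1)
    have e4 := eventually_pos_of_uniform (F := fun γ x => -deriv J a * w γ x)
      (G := fun x => -deriv J a * (A * J x)) (K := {a - δ}) isCompact_singleton
      (continuousOn_singleton _ _) (by rintro _ rfl; have := mul_neg_of_pos_of_neg hA e1; linarith)
      (fun ε hε => by
        filter_upwards [hcl (ε / (|-deriv J a| + 1)) (by positivity)] with γ h x hx
        obtain rfl : x = a - δ := hx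
        exact hmul _ ε hε _ _ (h _ (hsub a ha hma)).1)
    filter_upwards [e3, e4] with γ e3 e4
    exact ⟨by have := e4 _ rfl; linarith, e3 _ rfl⟩
  have ev3 : ∀ᶠ γ in atTop, ∀ x ∈ Icc s₀ 1 \ ⋃ a ∈ Z', Ioo (a - δ) (a + δ), 0 < |w γ x| := by
    have hKc : IsCompact (Icc s₀ 1 \ ⋃ a ∈ Z', Ioo (a - δ) (a + δ)) :=
      isCompact_Icc.diff (isOpen_biUnion fun a _ => isOpen_Ioo)
    refine eventually_pos_of_uniform (G := fun x => |A * J x|) hKc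
      (hJd.continuous.const_mul A).abs.continuousOn (fun x hx => ?_) fun ε hε => ?_
    · refine abs_pos.2 (mul_ne_zero hA.ne' fun h0 => hx.2 ?_)
      have hxZ : x ∈ Z' := by
        rcases eq_or_lt_of_le hx.1.2 with rfl | h
        · exact mem_insert _ _
        · exact mem_insert_of_mem _ ⟨⟨hs₀0.trans_le hx.1.1, h⟩, h0⟩
      exact mem_biUnion hxZ ⟨by linarith, by linarith⟩
    · filter_upwards [hcl ε hε] with γ h x hx
      exact (abs_abs_sub_abs_le _ _).trans (h x ⟨hx.1.1, by linarith [hx.1.2]⟩).1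
  filter_upwards [ev1, ev2, ev3, hw₃, eventually_gt_atTop 0] with γ e1 e2 e3 e4 hγ
  have hz : ∀ a ∈ Z', ∃ z ∈ Ioo (a - δ) (a + δ), w γ z = 0 ∧
      ∀ x ∈ Icc (a - δ) (a + δ), w γ x = 0 → x = z := fun a ha =>
    exists_unique_zero (by linarith) (fun x _ => (hwd γ hγ x).hasDerivAt) (e1 a ha) (e2 a ha).1
      (e2 a ha).2
  choose! z hzm hz0 hzu using hz
  have h1Z : (1:ℝ) ∈ Z' := mem_insert _ _
  have hsep : ∀ a ∈ Z, a + δ < 1 - δ := fun a ha => by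
    linarith [h3 a (mem_insert_of_mem _ ha) 1 h1Z ha.1.2]
  have hset : {s : ℝ | s ∈ Ioo 0 (z 1) ∧ w γ s = 0} = z '' Z := by
    ext s
    constructor
    · rintro ⟨hs, hs0⟩
      have hss : s₀ < s := by
        by_contra! hle
        exact (e4 s ⟨hs.1.le, hle.trans ((min_le_left _ _).trans (min_le_left _ _))⟩).ne' hs0
      obtain ⟨a, ha, hsa⟩ : ∃ a ∈ Z', s ∈ Icc (a - δ) (a + δ) := by
        by_cases hs1 : s ≤ 1
        · by_contra! hcon
          refine (e3 s ⟨⟨hss.le, hs1⟩, fun hm => ?_⟩).ne' (by rw [hs0, abs_zero])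
          obtain ⟨a, ha, hsa⟩ := mem_iUnion₂.1 hm
          exact hcon a ha (Ioo_subset_Icc_self hsa)
        · exact ⟨1, h1Z, by linarith, by linarith [hs.2, (hzm 1 h1Z).2]⟩
      have hsz := hzu a ha s hsa hs0
      rcases ha with rfl | ha
      · exact absurd hsz hs.2.ne
      · exact ⟨a, ha, hsz.symm⟩
    · rintro ⟨a, ha, rfl⟩
      have ha' := mem_insert_of_mem 1 ha
      exact ⟨⟨by linarith [(hzm a ha').1, h2 a ha'],
        by linarith [(hzm a ha').2, hsep a ha, (hzm 1 h1Z).1]⟩, hz0 a ha'⟩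
  have hinj : InjOn z Z := by
    have key : ∀ a ∈ Z, ∀ b ∈ Z, a < b → z a < z b := fun a ha b hb hab => by
      have ha' := mem_insert_of_mem 1 ha
      have hb' := mem_insert_of_mem 1 hb
      linarith [h3 a ha' b hb' hab, (hzm a ha').2, (hzm b hb').1]
    intro a ha b hb hab
    rcases lt_trichotomy a b with h | h | h
    · exact absurd hab (key a ha b hb h).ne
    · exact h
    · exact absurd hab (key b hb a ha h).ne'
  refine ⟨z 1, hzm 1 h1Z, by linarith [(hzm 1 h1Z).1], hz0 1 h1Z, by rw [hset, hinj.ncard_image], ?_⟩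
  obtain ⟨a, ha⟩ := hne
  have ha' := mem_insert_of_mem 1 ha
  have hS := (hzm 1 h1Z).1
  have ha1 := hsep a ha
  have ha2 := h2 a ha'
  rcases lt_or_ge (deriv J a) 0 with hc | hc
  · exact ⟨a + δ, ⟨by linarith, by linarith⟩, by nlinarith [(e2 a ha').2]⟩
  · exact ⟨a - δ, ⟨by linarith, by linarith⟩, by nlinarith [(e2 a ha').1]⟩

lemma exists_nodalZero (hA : 0 < A) (hJd : Differentiable ℝ J) (hJc : Continuous (deriv J))
    (hJ0 : 0 < J 0) (hwd : ∀ γ > 0, Differentiable ℝ (w γ))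
    (hpos : ∃ s₃ > 0, ∀ᶠ γ in atTop, ∀ s ∈ Icc 0 s₃, 0 < w γ s)
    (hclose : ∀ s₀ > 0, ∀ ε > 0, ∀ᶠ γ in atTop, ∀ s ∈ Icc s₀ 2,
      |w γ s - A * J s| ≤ ε ∧ |deriv (w γ) s - A * deriv J s| ≤ ε)
    (hn : {s : ℝ | s ∈ Ioo 0 1 ∧ J s = 0}.ncard ≠ 0) (hJ1 : J 1 = 0)
    (hsimple : ∀ s, 0 < s → J s = 0 → deriv J s ≠ 0) :
    ∃ S : ℝ → ℝ, Tendsto S atTop (𝓝 1) ∧ ∀ᶠ γ in atTop,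
      IsNodalZero (w γ) {s : ℝ | s ∈ Ioo 0 1 ∧ J s = 0}.ncard (S γ) := by
  set n := {s : ℝ | s ∈ Ioo 0 1 ∧ J s = 0}.ncard with hn'
  have ev := eventually_isNodalZero hA hJd hJc hJ0 hwd hpos hclose
    (finite_of_ncard_ne_zero hn) (nonempty_of_ncard_ne_zero hn) hJ1 hsimple
  rw [← hn'] at ev
  have hex : ∃ S : ℝ → ℝ, ∀ γ, (∃ T, IsNodalZero (w γ) n T) → IsNodalZero (w γ) n (S γ) :=
    ⟨fun γ => Classical.epsilon fun T => IsNodalZero (w γ) n T,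
      fun γ h => Classical.epsilon_spec h⟩
  obtain ⟨S, hS⟩ := hex
  refine ⟨S, Metric.tendsto_nhds.2 fun ε hε => ?_, ?_⟩
  · have hε' : ∀ᶠ δ in 𝓝[>] (0:ℝ), δ < ε := mem_nhdsWithin_of_mem_nhds (gt_mem_nhds hε)
    obtain ⟨δ, hδ, hδε⟩ := (ev.and hε').exists
    filter_upwards [hδ] with γ ⟨T, hT, hNT⟩
    rw [(hS γ ⟨T, hNT⟩).unique hn hNT, Real.dist_eq, abs_lt]
    exact ⟨by linarith [hT.1], by linarith [hT.2]⟩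
  · obtain ⟨δ, hδ⟩ := ev.exists
    filter_upwards [hδ] with γ ⟨T, _, hT⟩ using hS γ ⟨T, hT⟩

end zeros

lemma integral_comp_mul_sq {g : ℝ → ℝ} (hg : Continuous g) (S : ℝ) :
    ∫ r in Ioo (0:ℝ) 1, g (S * r ^ 2) * (2 * S * r) = ∫ σ in (0:ℝ)..S, g σ := by
  have := intervalIntegral.integral_comp_mul_deriv (a := 0) (b := 1) (f := fun r => S * r ^ 2)
    (f' := fun r => 2 * S * r) (g := g)
    (fun x _ => (((hasDerivAt_id x).pow 2).const_mul S).congr_deriv (by simp; ring))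
    (by fun_prop) hg
  simp only [Function.comp_def] at this
  rw [← integral_Ioc_eq_integral_Ioo, ← intervalIntegral.integral_of_le zero_le_one, this]
  simp

lemma ncard_zeros_comp_mul_sq (f : ℝ → ℝ) {S : ℝ} (hS : 0 < S) :
    {r : ℝ | r ∈ Ioo (0:ℝ) 1 ∧ f (S * r ^ 2) = 0}.ncard =
      {s : ℝ | s ∈ Ioo 0 S ∧ f s = 0}.ncard := by
  have h : {s : ℝ | s ∈ Ioo 0 S ∧ f s = 0} =
      (fun r => S * r ^ 2) '' {r : ℝ | r ∈ Ioo (0:ℝ) 1 ∧ f (S * r ^ 2) = 0} := by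
    ext s
    constructor
    · rintro ⟨hs, h0⟩
      have h1 : S * √(s / S) ^ 2 = s := by
        rw [sq_sqrt (div_nonneg hs.1.le hS.le)]; field_simp
      refine ⟨√(s / S), ⟨⟨sqrt_pos.2 (div_pos hs.1 hS), ?_⟩, by rw [h1]; exact h0⟩, h1⟩
      rw [sqrt_lt' one_pos, div_lt_iff₀ hS]
      linarith [hs.2]
    · rintro ⟨r, ⟨hr, h0⟩, rfl⟩
      refine ⟨⟨mul_pos hS (pow_pos hr.1 2), ?_⟩, h0⟩
      have : r ^ 2 < 1 := by nlinarith [hr.1, hr.2]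
      simpa using mul_lt_mul_of_pos_left this hS
  rw [h, InjOn.ncard_image]
  intro x hx y hy hxy
  have h1 : x ^ 2 = y ^ 2 := mul_left_cancel₀ hS.ne' hxy
  exact (sq_eq_sq₀ hx.1.1.le hy.1.1.le).1 h1

namespace IsProfile
variable {κ b γ : ℝ} {w : ℝ → ℝ}

lemma hasDerivAt_comp_mul_sq (h : IsProfile κ b γ w) (S r : ℝ) :
    HasDerivAt (fun r => w (S * r ^ 2)) (2 * S * r * deriv w (S * r ^ 2)) r :=
  ((h.hasDerivAt (S * r ^ 2)).comp r (((hasDerivAt_id r).pow 2).const_mul S)).congr_deriv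
    (by simp; ring)

lemma deriv_comp_mul_sq (h : IsProfile κ b γ w) (S : ℝ) :
    deriv (fun r => w (S * r ^ 2)) = fun r => 2 * S * r * deriv w (S * r ^ 2) :=
  funext fun r => (h.hasDerivAt_comp_mul_sq S r).deriv

lemma hasDerivAt_deriv_comp_mul_sq (h : IsProfile κ b γ w) (S r : ℝ) :
    HasDerivAt (fun r => 2 * S * r * deriv w (S * r ^ 2))
      (2 * S * deriv w (S * r ^ 2) + 4 * S * (S * r ^ 2) * deriv (deriv w) (S * r ^ 2)) r := by
  have h0 : HasDerivAt (fun r => S * r ^ 2) (2 * S * r) r :=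
    (((hasDerivAt_id r).pow 2).const_mul S).congr_deriv (by simp; ring)
  have h1 : HasDerivAt (fun r => deriv w (S * r ^ 2))
      (2 * S * r * deriv (deriv w) (S * r ^ 2)) r := by
    have h2 := HasDerivAt.comp r (h.hasDerivAt_deriv (S * r ^ 2)) h0
    exact h2.congr_deriv (by ring)
  exact (((hasDerivAt_id r).const_mul (2 * S)).mul h1).congr_deriv (by simp; ring)

lemma radLap_comp_mul_sq (h : IsProfile κ b γ w) {S r : ℝ} (hS : 0 ≤ S) (hr : r ≠ 0) :
    radLap (fun r => w (S * r ^ 2)) r = 4 * S * nonlin κ b (w (S * r ^ 2)) := by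
  have h1 := h.deriv_add_mul_deriv_deriv (mul_nonneg hS (sq_nonneg r))
  rw [radLap, h.deriv_comp_mul_sq, (h.hasDerivAt_deriv_comp_mul_sq S r).deriv]
  have h2 : 2 * S * r * deriv w (S * r ^ 2) / r = 2 * S * deriv w (S * r ^ 2) := by field_simp
  rw [h2]
  linear_combination (-4 * S) * h1

lemma dirEnergy_comp_mul_sq (h : IsProfile κ b γ w) (S : ℝ) :
    dirEnergy (fun r => w (S * r ^ 2)) = 4 * π * ∫ σ in (0:ℝ)..S, σ * deriv w σ ^ 2 := by
  rw [dirEnergy, h.deriv_comp_mul_sq, ← intervalIntegral.integral_const_mul,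
    ← integral_comp_mul_sq (by have := h.continuous_deriv; fun_prop)]
  congr 1
  ext r
  ring

end IsProfile

/-- The radial Dirichlet eigenfunctions are dilations of the linear profile. -/
lemma RadialEigen.eq_profile {k : ℕ} {lamk : ℝ} {vk J : ℝ → ℝ} (h : RadialEigen k lamk vk)
    (hJ : IsProfile (lamk / 4) 0 1 J) : ∀ r ∈ Icc (0:ℝ) 1, vk r = vk 0 * J (1 * r ^ 2) := by
  obtain ⟨hl, hs, hode, -⟩ := h
  have hu : UniqueDiffOn ℝ (Icc (0:ℝ) 1) := uniqueDiffOn_Icc zero_lt_one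
  set v1 := derivWithin vk (Icc 0 1) with hv1
  set v2 := derivWithin v1 (Icc 0 1) with hv2
  have hs1 : ContDiffOn ℝ (⊤ : ℕ∞) v1 (Icc 0 1) := hs.derivWithin hu (by simp)
  have hs2 : ContDiffOn ℝ (⊤ : ℕ∞) v2 (Icc 0 1) := hs1.derivWithin hu (by simp)
  have hd : ∀ r ∈ Ioo (0:ℝ) 1, HasDerivAt vk (v1 r) r := fun r hr =>
    ((hs.differentiableOn (by simp)) r (Ioo_subset_Icc_self hr)).hasDerivWithinAt.hasDerivAt
      (Icc_mem_nhds hr.1 hr.2)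
  have hd1 : ∀ r ∈ Ioo (0:ℝ) 1, HasDerivAt v1 (v2 r) r := fun r hr =>
    ((hs1.differentiableOn (by simp)) r (Ioo_subset_Icc_self hr)).hasDerivWithinAt.hasDerivAt
      (Icc_mem_nhds hr.1 hr.2)
  have hode' : ∀ r ∈ Ioo (0:ℝ) 1, v1 r + r * v2 r + lamk * r * vk r = 0 := fun r hr => by
    have h1 := hode r hr
    have h2 : deriv vk =ᶠ[𝓝 r] v1 := by
      filter_upwards [Ioo_mem_nhds hr.1 hr.2] with x hx using (hd x hx).deriv
    rw [radLap, h2.deriv_eq, (hd1 r hr).deriv, (hd r hr).deriv] at h1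
    have := hr.1.ne'
    field_simp at h1
    linarith
  have hcl : Icc (0:ℝ) 1 ⊆ closure (Ioo 0 1) := by rw [closure_Ioo zero_ne_one]
  have hv10 : v1 0 = 0 := by
    have hc : ContinuousOn (fun r => v1 r + r * v2 r + lamk * r * vk r) (Icc 0 1) :=
      (hs1.continuousOn.add (continuousOn_id.mul hs2.continuousOn)).add
        ((continuousOn_const.mul continuousOn_id).mul hs.continuousOn)
    have := EqOn.of_subset_closure (f := fun r => v1 r + r * v2 r + lamk * r * vk r)
      (g := fun _ => 0) (fun r hr => hode' r hr) hc continuousOn_const Ioo_subset_Icc_self hcl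
      ⟨le_rfl, zero_le_one⟩
    simpa using this
  set d := fun r => vk r - vk 0 * J (1 * r ^ 2) with hdd
  set d1 := fun r => v1 r - vk 0 * (2 * 1 * r * deriv J (1 * r ^ 2)) with hdd1
  have hJc := hJ.continuous_deriv
  have hJc0 := hJ.smooth.continuous
  have hdc : ContinuousOn d (Icc 0 1) := hs.continuousOn.sub (by fun_prop)
  have hd1c : ContinuousOn d1 (Icc 0 1) := hs1.continuousOn.sub (by fun_prop)
  have hE : AntitoneOn (fun r => d1 r ^ 2 + lamk * d r ^ 2) (Icc 0 1) := by
    refine antitoneOn_of_hasDerivWithinAt_nonpos (convex_Icc 0 1)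
      (f' := fun r => -(2 * d1 r ^ 2 / r))
      ((hd1c.pow 2).add (continuousOn_const.mul (hdc.pow 2))) (fun r hr => ?_) fun r hr => ?_
    · rw [interior_Icc] at hr
      have e1 : HasDerivAt d (d1 r) r :=
        (hd r hr).sub ((hJ.hasDerivAt_comp_mul_sq 1 r).const_mul (vk 0))
      have e2 := (hd1 r hr).sub ((hJ.hasDerivAt_deriv_comp_mul_sq 1 r).const_mul (vk 0))
      have e3 := hJ.deriv_add_mul_deriv_deriv (s := 1 * r ^ 2) (by positivity)
      have e4 := hode' r hr
      refine (((e2.pow 2).add ((e1.pow 2).const_mul lamk)).congr_deriv ?_).hasDerivWithinAt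
      have hr0 := hr.1.ne'
      have e5 : v2 r = -(v1 r) / r - lamk * vk r := by field_simp; linarith
      have e6 : deriv (deriv J) (1 * r ^ 2) =
          (-(lamk / 4 * J (1 * r ^ 2)) - deriv J (1 * r ^ 2)) / r ^ 2 := by
        simp only [nonlin, one_mul] at e3 ⊢
        field_simp
        linarith
      simp only [Pi.sub_apply, hdd, hdd1, e5, e6]
      field_simp
      ring
    · rw [interior_Icc] at hr
      have := hr.1
      have : 0 ≤ 2 * d1 r ^ 2 / r := by positivity
      linarith
  intro r hr
  have h1 := hE ⟨le_rfl, zero_le_one⟩ hr hr.1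
  have hd0 : d 0 = 0 := by simp [hdd, hJ.init]
  have hd10 : d1 0 = 0 := by simp [hdd1, hv10]
  simp only [hd0, hd10] at h1
  have h2 : d r ^ 2 = 0 := by nlinarith [sq_nonneg (d1 r), mul_nonneg hl.le (sq_nonneg (d r))]
  exact sub_eq_zero.1 (pow_eq_zero_iff two_ne_zero |>.1 h2)

lemma RadialEigen.integral_profile {k : ℕ} {lamk : ℝ} {vk J : ℝ → ℝ} (h : RadialEigen k lamk vk)
    (hJ : IsProfile (lamk / 4) 0 1 J) : π * vk 0 ^ 2 * ∫ σ in (0:ℝ)..1, J σ ^ 2 = 1 := by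
  have heq := h.eq_profile hJ
  obtain ⟨-, -, -, -, -, hn, -⟩ := h
  refine Eq.trans ?_ hn
  rw [← integral_comp_mul_sq (g := fun σ => J σ ^ 2) (hJ.smooth.continuous.pow 2),
    ← integral_const_mul]
  refine setIntegral_congr_fun measurableSet_Ioo fun r hr => ?_
  simp only [heq r (Ioo_subset_Icc_self hr)]
  ring

lemma exists_pos_of_continuous {f : ℝ → ℝ} (hf : Continuous f) (h0 : 0 < f 0) :
    ∃ r ∈ Ioo (0:ℝ) 1, 0 < f r := by
  have h1 : ∀ᶠ r in 𝓝[>] (0:ℝ), 0 < f r :=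
    mem_nhdsWithin_of_mem_nhds (hf.continuousAt.eventually (lt_mem_nhds h0))
  obtain ⟨r, hr⟩ := (h1.and (Ioo_mem_nhdsGT one_pos)).exists
  exact ⟨r, hr.2, hr.1⟩

section nodal
variable {κ A : ℝ} {w : ℝ → ℝ → ℝ} {J S : ℝ → ℝ}

lemma tendsto_deriv_comp (hκ : 0 < κ) (hA : 0 < A)
    (hw : ∀ γ, 0 < γ → IsProfile κ (exp (-(A * γ))) γ (w γ)) (hJ : IsProfile κ 0 1 J)
    {σ : ℝ → ℝ} {s : ℝ} (hσ : Tendsto σ atTop (𝓝 s)) (hs : s ∈ Ioo 0 2) :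
    Tendsto (fun γ => deriv (w γ) (σ γ)) atTop (𝓝 (A * deriv J s)) := by
  have h1 : Tendsto (fun γ => deriv (w γ) (σ γ) - A * deriv J (σ γ)) atTop (𝓝 0) := by
    refine Metric.tendsto_nhds.2 fun ε hε => ?_
    filter_upwards [eventually_close hκ hA hw hJ (half_pos hs.1) (half_pos hε),
      hσ.eventually (Icc_mem_nhds (half_lt_self hs.1) hs.2)] with γ h1 h2
    rw [Real.dist_eq, sub_zero]
    linarith [(h1 _ h2).2]
  have h2 := h1.add ((hJ.continuous_deriv.continuousAt.tendsto.comp hσ).const_mul A)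
  simpa using h2

lemma tendsto_mul_one_sub (hκ : 0 < κ) (hA : 0 < A)
    (hw : ∀ γ, 0 < γ → IsProfile κ (exp (-(A * γ))) γ (w γ)) (hJ : IsProfile κ 0 1 J)
    (hJ1 : J 1 = 0) (hS : Tendsto S atTop (𝓝 1)) (hz : ∀ᶠ γ in atTop, w γ (S γ) = 0) :
    Tendsto (fun γ => γ * (1 - S γ)) atTop (𝓝 (1 / (A * deriv J 1 ^ 2))) := by
  have h1 : Tendsto (fun γ => γ * (1 - S γ) * (S γ * deriv (w γ) (S γ) * dslope J 1 (S γ))) atTop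
      (𝓝 1) := by
    refine Metric.tendsto_nhds.2 fun ε hε => ?_
    filter_upwards [eventually_wronskian_profile hκ hA hw hJ one_half_pos (half_pos hε),
      hS.eventually (Icc_mem_nhds one_half_lt_one one_lt_two), hz] with γ h1 h2 h3
    have h4 := h1 _ h2
    have h5 : (S γ - 1) * dslope J 1 (S γ) = J (S γ) := by
      have := sub_smul_dslope J 1 (S γ)
      rwa [hJ1, sub_zero, smul_eq_mul] at this
    rw [h3, ← h5] at h4
    rw [Real.dist_eq]
    calc _ = |γ * (S γ * (0 * deriv J (S γ) - deriv (w γ) (S γ) *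
          ((S γ - 1) * dslope J 1 (S γ)))) - 1| := by ring_nf
      _ < ε := by linarith
  have h2 : Tendsto (fun γ => S γ * deriv (w γ) (S γ) * dslope J 1 (S γ)) atTop
      (𝓝 (A * deriv J 1 ^ 2)) := by
    have e1 := tendsto_deriv_comp hκ hA hw hJ hS ⟨one_pos, one_lt_two⟩
    have e2 : Tendsto (fun γ => dslope J 1 (S γ)) atTop (𝓝 (deriv J 1)) := by
      have := (continuousAt_dslope_same.2 (hJ.hasDerivAt 1).differentiableAt).tendsto.comp hS
      rwa [dslope_same] at this
    convert (hS.mul e1).mul e2 using 2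
    ring
  have h3 := hJ.deriv_ne_zero hκ one_pos one_pos hJ1
  have h4 : A * deriv J 1 ^ 2 ≠ 0 := by positivity
  refine (h1.div h2 h4).congr' ?_
  filter_upwards [h2.eventually_ne h4] with γ h
  exact mul_div_cancel_right₀ _ h

lemma tendsto_dirichlet_nodal (hκ : 0 < κ) (hA : 0 < A)
    (hw : ∀ γ, 0 < γ → IsProfile κ (exp (-(A * γ))) γ (w γ)) (hJ : IsProfile κ 0 1 J)
    (hS : Tendsto S atTop (𝓝 1)) (hz : ∀ᶠ γ in atTop, w γ (S γ) = 0) :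
    Tendsto (fun γ => ∫ σ in (0:ℝ)..S γ, σ * deriv (w γ) σ ^ 2) atTop
      (𝓝 (1 + (A * deriv J 1) ^ 2)) := by
  have h1 : Tendsto (fun γ => (∫ σ in (0:ℝ)..S γ, σ * deriv (w γ) σ ^ 2) -
      (S γ * deriv (w γ) (S γ)) ^ 2) atTop (𝓝 1) := by
    refine Metric.tendsto_nhds.2 fun ε hε => ?_
    filter_upwards [eventually_dirichlet_profile hκ hA hw hJ one_half_pos (half_pos hε),
      hS.eventually (Icc_mem_nhds one_half_lt_one one_lt_two), hz] with γ h1 h2 h3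
    have h4 := h1 _ h2
    rw [h3] at h4
    simp only [mul_zero, zero_mul, sub_zero, zero_pow two_ne_zero] at h4
    rw [Real.dist_eq]
    linarith
  have h2 := h1.add ((hS.mul (tendsto_deriv_comp hκ hA hw hJ hS ⟨one_pos, one_lt_two⟩)).pow 2)
  simpa using h2

/-- Weak convergence of the dilated profiles, tested against functions supported away from the
origin. -/
lemma tendsto_integral_deriv_mul (hκ : 0 < κ) (hA : 0 < A)
    (hw : ∀ γ, 0 < γ → IsProfile κ (exp (-(A * γ))) γ (w γ)) (hJ : IsProfile κ 0 1 J)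
    (hS : Tendsto S atTop (𝓝 1)) {φ : ℝ → ℝ} (hφ : ContDiff ℝ (⊤ : ℕ∞) φ)
    (hsupp : tsupport φ ⊆ Ioo (0:ℝ) 1) :
    Tendsto (fun γ => ∫ r in Ioo (0:ℝ) 1,
      2 * S γ * r * deriv (w γ) (S γ * r ^ 2) * deriv φ r * (2 * π * r)) atTop
      (𝓝 (∫ r in Ioo (0:ℝ) 1, A * (2 * 1 * r * deriv J (1 * r ^ 2)) * deriv φ r * (2 * π * r))) := by
  have hφc : Continuous (deriv φ) := hφ.continuous_deriv (by simp)
  have hcpt : IsCompact (tsupport φ) :=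
    isCompact_Icc.of_isClosed_subset (isClosed_tsupport φ) (hsupp.trans Ioo_subset_Icc_self)
  obtain ⟨a, ha, hφa⟩ : ∃ a > 0, ∀ r, r < a → deriv φ r = 0 := by
    have h0 : ∀ᶠ r in 𝓝 (0:ℝ), r ∉ tsupport φ :=
      (isClosed_tsupport φ).isOpen_compl.mem_nhds fun h => lt_irrefl _ (hsupp h).1
    obtain ⟨a, ha, h⟩ := Metric.eventually_nhds_iff.1 h0
    refine ⟨a, ha, fun r hr => ?_⟩
    by_contra hne
    have hm : r ∈ tsupport φ := support_deriv_subset hne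
    refine h ?_ hm
    rw [Real.dist_eq, sub_zero, abs_of_pos (hsupp hm).1]
    exact hr
  obtain ⟨M, hM⟩ := isCompact_Icc.exists_bound_of_continuousOn (s := Icc (0:ℝ) 2)
    (f := fun s => A * deriv J s) (hJ.continuous_deriv.const_mul A).continuousOn
  obtain ⟨N, hN⟩ := isCompact_Icc.exists_bound_of_continuousOn (s := Icc (0:ℝ) 1) hφc.continuousOn
  have hM0 : 0 ≤ M := (norm_nonneg _).trans (hM 0 ⟨le_rfl, zero_le_two⟩)
  have hN0 : 0 ≤ N := (norm_nonneg _).trans (hN 0 ⟨le_rfl, zero_le_one⟩)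
  refine tendsto_integral_filter_of_dominated_convergence
    (fun _ => 2 * 2 * 1 * (M + 1) * N * (2 * π * 1)) ?_ ?_ (integrable_const _) ?_
  · filter_upwards [eventually_gt_atTop 0] with γ hγ
    have := (hw γ hγ).continuous_deriv
    exact Continuous.aestronglyMeasurable (by fun_prop)
  · filter_upwards [hS.eventually (Icc_mem_nhds one_half_lt_one one_lt_two),
      eventually_close hκ hA hw hJ (half_pos (pow_pos ha 2)) one_pos] with γ h1 h2
    refine (ae_restrict_iff' measurableSet_Ioo).2 (Eventually.of_forall fun r hr => ?_)
    have hr0 := hr.1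
    have hr1 := hr.2.le
    rcases lt_or_ge r a with hra | hra
    · rw [hφa r hra]
      simp only [mul_zero, zero_mul, norm_zero]
      positivity
    · have hS0 : 0 ≤ S γ := by linarith [h1.1]
      have hr2 : a ^ 2 ≤ r ^ 2 := by gcongr
      have hr3 : r ^ 2 ≤ 1 := pow_le_one₀ hr0.le hr1
      have hm : S γ * r ^ 2 ∈ Icc (a ^ 2 / 2) 2 := ⟨by nlinarith [h1.1, pow_pos ha 2], by
        nlinarith [h1.2, sq_nonneg r]⟩
      have e1 := (h2 _ hm).2
      have e2 := hM (S γ * r ^ 2) ⟨by positivity, hm.2⟩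
      have e3 : |deriv (w γ) (S γ * r ^ 2)| ≤ M + 1 := by
        rw [Real.norm_eq_abs] at e2
        linarith [abs_sub_abs_le_abs_sub (deriv (w γ) (S γ * r ^ 2)) (A * deriv J (S γ * r ^ 2))]
      have e4 := hN r ⟨hr0.le, hr1⟩
      rw [Real.norm_eq_abs] at e4 ⊢
      rw [abs_mul, abs_mul, abs_mul, abs_of_nonneg (by positivity : 0 ≤ 2 * S γ * r),
        abs_of_nonneg (by positivity : 0 ≤ 2 * π * r)]
      have := h1.2
      gcongr
  · refine (ae_restrict_iff' measurableSet_Ioo).2 (Eventually.of_forall fun r hr => ?_)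
    have hr0 := hr.1
    have hr1 : r ^ 2 ≤ 1 := pow_le_one₀ hr0.le hr.2.le
    have e1 := tendsto_deriv_comp hκ hA hw hJ (hS.mul_const (r ^ 2))
      (s := 1 * r ^ 2) ⟨by positivity, by linarith⟩
    have e2 := ((((hS.const_mul 2).mul_const r).mul e1).mul_const (deriv φ r)).mul_const (2 * π * r)
    have e3 : A * (2 * 1 * r * deriv J (1 * r ^ 2)) = 2 * 1 * r * (A * deriv J (1 * r ^ 2)) := by
      ring
    rw [e3]
    exact e2

end nodal

lemma RadialEigen.profile_zeros {k : ℕ} {lamk : ℝ} {vk J : ℝ → ℝ} (h : RadialEigen k lamk vk)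
    (hJ : IsProfile (lamk / 4) 0 1 J) :
    J 1 = 0 ∧ {s : ℝ | s ∈ Ioo 0 1 ∧ J s = 0}.ncard = k - 1 := by
  have heq := h.eq_profile hJ
  obtain ⟨-, -, -, h1, h0, -, hn⟩ := h
  refine ⟨?_, ?_⟩
  · have := heq 1 ⟨zero_le_one, le_rfl⟩
    rw [h1] at this
    simpa [h0.ne'] using this.symm
  · rw [← ncard_zeros_comp_mul_sq J one_pos, ← hn]
    congr 1
    ext r
    refine and_congr_right fun hr => ?_
    rw [heq r (Ioo_subset_Icc_self hr), mul_eq_zero]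
    simp [h0.ne']

lemma RadialEigen.sq_deriv_profile {k : ℕ} {lamk : ℝ} {vk J : ℝ → ℝ}
    (h : RadialEigen k lamk vk) (hJ : IsProfile (lamk / 4) 0 1 J) {l : ℝ} (hl : 0 ≤ l) :
    (√(l / lamk) * vk 0 * deriv J 1) ^ 2 = l / (4 * π) := by
  have h1 := hJ.pohozaev zero_le_one
  have h2 := h.integral_profile hJ
  have h3 := h.1
  rw [(h.profile_zeros hJ).1] at h1
  have h4 : deriv J 1 ^ 2 = lamk / 4 * ∫ σ in (0:ℝ)..1, J σ ^ 2 := by linarith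
  rw [mul_pow, mul_pow, sq_sqrt (by positivity), h4]
  have hπ := pi_ne_zero
  field_simp
  linear_combination l * h2

/-- Theorem 2, nodal case. Let l > 0 and k ≥ 2. There exist γ̄ > 0 and,
for each γ > γ̄, reals λ̄_γ, β_γ > 0 and a smooth radial u_γ solving
Δu_γ = λ̄_γ u_γ + β_γ u_γ e^{u_γ²} in Ω, u_γ = 0 on ∂Ω, u_γ(0) = γ, sign-changing with
exactly k nodal regions (k−1 interior zeros), such that
λ_k − λ̄_γ = (1+o(1))(4π v_k(0)/γ)√(λ_k/l), β_γ → 0,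
u_γ ⇀ √(l/λ_k) v_k ≢ 0 weakly in H¹₀(Ω), and ∫_Ω |∇u_γ|² dy = 4π + l + o(1). -/
theorem statement12 (k : ℕ) (hk : 2 ≤ k) (lamk : ℝ) (vk : ℝ → ℝ)
    (hEk : RadialEigen k lamk vk) (l : ℝ) (hl : 0 < l) :
    ∃ γbar : ℝ, 0 < γbar ∧ ∃ lambar β : ℝ → ℝ, ∃ u : ℝ → ℝ → ℝ,
      (∀ γ : ℝ, γbar < γ →
        0 < β γ ∧
        ContDiffOn ℝ (⊤ : ℕ∞) (u γ) (Set.Icc 0 1) ∧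
        (∀ r ∈ Set.Ioo (0:ℝ) 1,
          radLap (u γ) r = lambar γ * u γ r + β γ * u γ r * Real.exp ((u γ r) ^ 2)) ∧
        u γ 1 = 0 ∧ u γ 0 = γ ∧
        (∃ r ∈ Set.Ioo (0:ℝ) 1, u γ r < 0) ∧ (∃ r ∈ Set.Ioo (0:ℝ) 1, 0 < u γ r) ∧
        {r : ℝ | r ∈ Set.Ioo (0:ℝ) 1 ∧ u γ r = 0}.ncard = k - 1) ∧
      Tendsto (fun γ : ℝ => γ * (lamk - lambar γ) / (4 * π * vk 0 * Real.sqrt (lamk / l)))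
        atTop (𝓝 1) ∧
      Tendsto β atTop (𝓝 0) ∧
      (∃ C : ℝ, ∀ᶠ γ in atTop, dirEnergy (u γ) ≤ C) ∧
      (∀ φ : ℝ → ℝ, ContDiff ℝ (⊤ : ℕ∞) φ → tsupport φ ⊆ Set.Ioo (0:ℝ) 1 →
        Tendsto
          (fun γ : ℝ => ∫ r in Set.Ioo (0:ℝ) 1, deriv (u γ) r * deriv φ r * (2 * π * r))
          atTop
          (𝓝 (∫ r in Set.Ioo (0:ℝ) 1,
            deriv (fun t => Real.sqrt (l / lamk) * vk t) r * deriv φ r * (2 * π * r)))) ∧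
      (∃ r ∈ Set.Ioo (0:ℝ) 1, Real.sqrt (l / lamk) * vk r ≠ 0) ∧
      Tendsto (fun γ : ℝ => dirEnergy (u γ)) atTop (𝓝 (4 * π + l)) := by
  have hlam : 0 < lamk := hEk.1
  have hv0 : 0 < vk 0 := hEk.2.2.2.2.1
  have hκ : 0 < lamk / 4 := by positivity
  obtain ⟨J, hJ⟩ := exists_isProfile hκ le_rfl one_pos
  obtain ⟨hJ1, hJn⟩ := hEk.profile_zeros hJ
  have hEq := hEk.eq_profile hJ
  set A := √(l / lamk) * vk 0 with hAdef
  have hA : 0 < A := by positivity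
  have hAJ : (A * deriv J 1) ^ 2 = l / (4 * π) := hEk.sq_deriv_profile hJ hl.le
  have hex : ∀ γ : ℝ, ∃ w, 0 < γ → IsProfile (lamk / 4) (exp (-(A * γ))) γ w := fun γ => by
    by_cases hγ : 0 < γ
    · obtain ⟨w, hw⟩ := exists_isProfile hκ (exp_pos (-(A * γ))).le hγ
      exact ⟨w, fun _ => hw⟩
    · exact ⟨0, fun h => absurd h hγ⟩
  choose w hw using hex
  have hJd : Differentiable ℝ J := fun s => (hJ.hasDerivAt s).differentiableAt
  obtain ⟨S, hS, hSn⟩ := exists_nodalZero hA hJd hJ.continuous_deriv (by rw [hJ.init]; exact one_pos)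
    (fun γ hγ s => ((hw γ hγ).hasDerivAt s).differentiableAt) (eventually_pos hκ hA hw)
    (fun s₀ hs₀ ε hε => eventually_close hκ hA hw hJ hs₀ hε) (by rw [hJn]; omega) hJ1
    (fun s hs h0 => hJ.deriv_ne_zero hκ one_pos hs h0)
  rw [hJn] at hSn
  have hSz : ∀ᶠ γ in atTop, w γ (S γ) = 0 := hSn.mono fun γ h => h.zero
  have hdir : Tendsto (fun γ => dirEnergy (fun r => w γ (S γ * r ^ 2))) atTop
      (𝓝 (4 * π + l)) := by
    have h1 := (tendsto_dirichlet_nodal hκ hA hw hJ hS hSz).const_mul (4 * π)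
    have h2 : 4 * π * (1 + (A * deriv J 1) ^ 2) = 4 * π + l := by
      rw [hAJ]
      field_simp [pi_ne_zero]
    rw [h2] at h1
    refine h1.congr' ?_
    filter_upwards [eventually_gt_atTop 0] with γ hγ
    exact ((hw γ hγ).dirEnergy_comp_mul_sq (S γ)).symm
  obtain ⟨γ₀, hγ₀⟩ := eventually_atTop.1 hSn
  refine ⟨max γ₀ 1, by positivity, fun γ => lamk * S γ, fun γ => 4 * exp (-(A * γ)) * S γ,
    fun γ r => w γ (S γ * r ^ 2), fun γ hγ => ?_, ?_, ?_, ⟨4 * π + l + 1, ?_⟩, fun φ hφ hsupp => ?_,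
    ?_, hdir⟩
  · have hγ0 : 0 < γ := by linarith [le_max_right γ₀ 1]
    have hN := hγ₀ γ ((le_max_left _ _).trans hγ.le)
    have hwγ := hw γ hγ0
    have hSp := hN.pos
    have hsm : ContDiff ℝ (⊤ : ℕ∞) (fun r => w γ (S γ * r ^ 2)) :=
      hwγ.smooth.comp (contDiff_const.mul (contDiff_id.pow 2))
    refine ⟨by positivity, hsm.contDiffOn, fun r hr => ?_, ?_, ?_, ?_, ?_, ?_⟩
    · rw [hwγ.radLap_comp_mul_sq hSp.le hr.1.ne', nonlin]
      ring
    · simpa using hN.zero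
    · simpa using hwγ.init
    · obtain ⟨s, hs, hneg⟩ := hN.neg
      refine ⟨√(s / S γ), ⟨sqrt_pos.2 (div_pos hs.1 hSp), ?_⟩, ?_⟩
      · rw [sqrt_lt' one_pos, div_lt_iff₀ hSp]
        linarith [hs.2]
      · show w γ (S γ * √(s / S γ) ^ 2) < 0
        rwa [sq_sqrt (div_nonneg hs.1.le hSp.le), mul_div_cancel₀ _ hSp.ne']
    · exact exists_pos_of_continuous hsm.continuous (by simpa [hwγ.init] using hγ0)
    · rw [ncard_zeros_comp_mul_sq _ hSp, hN.ncard]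
  · have h1 := (tendsto_mul_one_sub hκ hA hw hJ hJ1 hS hSz).const_mul
      (lamk / (4 * π * vk 0 * √(lamk / l)))
    have h2 : lamk / (4 * π * vk 0 * √(lamk / l)) * (1 / (A * deriv J 1 ^ 2)) = 1 := by
      have hJ1' := hJ.deriv_ne_zero hκ one_pos one_pos hJ1
      have e1 : √(l / lamk) = (√(lamk / l))⁻¹ := by rw [← sqrt_inv, inv_div]
      have e2 : √(lamk / l) ^ 2 = lamk / l := sq_sqrt (by positivity)
      have e3 : 0 < √(lamk / l) := by positivity
      rw [hAdef, e1] at hAJ ⊢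
      set q := √(lamk / l)
      have e4 : lamk = l * q ^ 2 := by rw [e2]; field_simp
      have hπ := pi_pos
      field_simp at hAJ ⊢
      rw [e4]
      linear_combination (-1) * hAJ
    rw [h2] at h1
    refine h1.congr fun γ => ?_
    ring
  · have h1 : Tendsto (fun γ : ℝ => exp (-(A * γ))) atTop (𝓝 0) := by
      simpa using tendsto_pow_mul_exp_neg_mul 0 hA
    simpa using (h1.const_mul 4).mul hS
  · exact (hdir.eventually (gt_mem_nhds (lt_add_one _))).mono fun γ h => h.le
  · have h1 := tendsto_integral_deriv_mul hκ hA hw hJ hS hφ hsupp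
    have h2 : ∫ r in Ioo (0:ℝ) 1, deriv (fun t => √(l / lamk) * vk t) r * deriv φ r * (2 * π * r) =
        ∫ r in Ioo (0:ℝ) 1, A * (2 * 1 * r * deriv J (1 * r ^ 2)) * deriv φ r * (2 * π * r) := by
      refine setIntegral_congr_fun measurableSet_Ioo fun r hr => ?_
      have e1 : (fun t => √(l / lamk) * vk t) =ᶠ[𝓝 r] fun t => A * J (1 * t ^ 2) := by
        filter_upwards [Ioo_mem_nhds hr.1 hr.2] with t ht
        rw [hEq t (Ioo_subset_Icc_self ht), hAdef, mul_assoc]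
      simp only [e1.deriv_eq, ((hJ.hasDerivAt_comp_mul_sq 1 r).const_mul A).deriv]
    rw [h2]
    refine h1.congr' ?_
    filter_upwards [eventually_gt_atTop 0] with γ hγ
    simp only [(hw γ hγ).deriv_comp_mul_sq (S γ)]
  · obtain ⟨r, hr, hpos⟩ := exists_pos_of_continuous (f := fun r => J (1 * r ^ 2))
      (hJ.smooth.continuous.comp (by fun_prop)) (by simp [hJ.init])
    refine ⟨r, hr, ?_⟩
    rw [hEq r (Ioo_subset_Icc_self hr), ← mul_assoc]
    exact (mul_pos hA hpos).ne'

end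
end

section
/- Let μ_γ > 0 be defined by μ_γ² β_γ γ² g(γ) = 4. Then μ_γ → 0 as γ → +∞; equivalently, β_γ γ² g(γ) → +∞. -/
open Real Set Filter MeasureTheory Topology

noncomputable section

/-- `GCtx a c0 g` : a > 0, c₀ > 0, g is continuous and positive on [0,∞), and
g(t) = exp(t² − at) for all t ≥ c₀ (hypotheses (G1)-(G2) of the paper). -/
def GCtx (a c0 : ℝ) (g : ℝ → ℝ) : Prop :=
  0 < a ∧ 0 < c0 ∧ ContinuousOn g (Set.Ici 0) ∧ (∀ t : ℝ, 0 ≤ t → 0 < g t) ∧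
    ∀ t : ℝ, c0 ≤ t → g t = Real.exp (t ^ 2 - a * t)

/-- `IsGSol g beta gam u` : u is a smooth radial function on the closed unit disk,
positive in the open disk, vanishing on the boundary, with central value γ, solving
Δu = β u g(u) in Ω (radially). -/
def IsGSol (g : ℝ → ℝ) (beta gam : ℝ) (u : ℝ → ℝ) : Prop :=
  ContDiffOn ℝ (⊤ : ℕ∞) u (Set.Icc 0 1) ∧
    (∀ r ∈ Set.Ioo (0:ℝ) 1, radLap u r = beta * u r * g (u r)) ∧
    (∀ r ∈ Set.Ico (0:ℝ) 1, 0 < u r) ∧ u 1 = 0 ∧ u 0 = gam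

/-- A radial function on the closed unit disk with `Δf ≤ M` makes `f + M r² / 4` nondecreasing. -/
theorem monotoneOn_of_radLap_le {f : ℝ → ℝ} {M : ℝ}
    (hf : ContDiffOn ℝ (⊤ : ℕ∞) f (Set.Icc 0 1))
    (hM : ∀ r ∈ Set.Ioo (0:ℝ) 1, radLap f r ≤ M) :
    MonotoneOn (fun r => f r + M * r ^ 2 / 4) (Set.Icc 0 1) := by
  have hud : UniqueDiffOn ℝ (Set.Icc (0:ℝ) 1) := uniqueDiffOn_Icc zero_lt_one
  have hnhds : ∀ r ∈ Set.Ioo (0:ℝ) 1, Set.Icc (0:ℝ) 1 ∈ 𝓝 r := fun r hr =>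
    Icc_mem_nhds hr.1 hr.2
  set v := derivWithin f (Set.Icc 0 1) with hv
  have hvc : ContDiffOn ℝ 1 v (Set.Icc 0 1) := hf.derivWithin hud (by norm_cast)
  have hvderiv : ∀ r ∈ Set.Ioo (0:ℝ) 1, v r = deriv f r := fun r hr =>
    derivWithin_of_mem_nhds (hnhds r hr)
  have hfd : ∀ r ∈ Set.Ioo (0:ℝ) 1, HasDerivAt f (v r) r := fun r hr => by
    rw [hvderiv r hr]
    exact ((hf.differentiableOn (by simp)).differentiableAt (hnhds r hr)).hasDerivAt
  have hvd : ∀ r ∈ Set.Ioo (0:ℝ) 1, HasDerivAt v (deriv (deriv f) r) r := fun r hr => by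
    have heq : v =ᶠ[𝓝 r] deriv f := by
      filter_upwards [Ioo_mem_nhds hr.1 hr.2] with s hs using hvderiv s hs
    rw [← heq.deriv_eq]
    exact ((hvc.differentiableOn (by simp)).differentiableAt (hnhds r hr)).hasDerivAt
  have hflux : MonotoneOn (fun r => r * v r + M * r ^ 2 / 2) (Set.Icc 0 1) := by
    refine monotoneOn_of_hasDerivWithinAt_nonneg (convex_Icc 0 1)
      (f' := fun r => 1 * v r + r * deriv (deriv f) r + M * (2 * r) / 2) ?_ ?_ ?_
    · have := hvc.continuousOn
      fun_prop
    · intro r hr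
      rw [interior_Icc] at hr
      have h := ((hasDerivAt_id r).mul (hvd r hr)).add
        (((hasDerivAt_pow 2 r).const_mul M).div_const 2)
      refine HasDerivAt.hasDerivWithinAt ?_
      convert h using 1
      · rfl
      · simp
    · intro r hr
      rw [interior_Icc] at hr
      have hr0 := hr.1
      have h := hM r hr
      rw [radLap, ← hvderiv r hr] at h
      have h' := mul_le_mul_of_nonneg_left h hr0.le
      have : r * (v r / r) = v r := by field_simp
      linarith
  refine monotoneOn_of_hasDerivWithinAt_nonneg (convex_Icc 0 1)
    (f' := fun r => v r + M * (2 * r) / 4) ?_ ?_ ?_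
  · have := hf.continuousOn
    fun_prop
  · intro r hr
    rw [interior_Icc] at hr
    have h := (hfd r hr).add (((hasDerivAt_pow 2 r).const_mul M).div_const 4)
    refine HasDerivAt.hasDerivWithinAt ?_
    convert h using 1
    · rfl
    · simp
  · intro r hr
    rw [interior_Icc] at hr
    have h := hflux (left_mem_Icc.2 zero_le_one) (Ioo_subset_Icc_self hr) hr.1.le
    simp only [zero_mul, ne_eq, OfNat.ofNat_ne_zero, not_false_eq_true, zero_pow, mul_zero,
      zero_div, add_zero] at h
    have : 0 ≤ r * (v r + M * (2 * r) / 4) := by linarith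
    exact nonneg_of_mul_nonneg_right this hr.1

theorem radLap_neg (f : ℝ → ℝ) (r : ℝ) : radLap (fun s => -f s) r = -radLap f r := by
  have h : deriv (fun s => -f s) = fun s => -deriv f s := by
    funext s
    exact deriv.fun_neg
  simp only [radLap, h, deriv.fun_neg]
  ring

/-- For large `γ`, the nonlinearity `g` attains its maximum over `[0, γ]` at `γ`. -/
theorem GCtx.eventually_le {a c0 : ℝ} {g : ℝ → ℝ} (hG : GCtx a c0 g) :
    ∀ᶠ γ in atTop, ∀ t ∈ Set.Icc 0 γ, g t ≤ g γ := by
  obtain ⟨ha, hc0, hgc, -, hexp⟩ := hG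
  obtain ⟨B, hB⟩ := isCompact_Icc.bddAbove_image
    (hgc.mono (Set.Icc_subset_Ici_self : Set.Icc 0 (max c0 a) ⊆ Set.Ici 0))
  filter_upwards [eventually_ge_atTop (max c0 a), eventually_ge_atTop (a + 1),
    eventually_ge_atTop B] with γ h1 h2 h3 t ht
  rw [hexp γ ((le_max_left _ _).trans h1)]
  rcases le_total t (max c0 a) with htc | htc
  · have h4 : g t ≤ B := hB ⟨t, ⟨ht.1, htc⟩, rfl⟩
    have h5 := Real.add_one_le_exp (γ ^ 2 - a * γ)
    nlinarith
  · rw [hexp t ((le_max_left _ _).trans htc)]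
    have h4 : a ≤ t := (le_max_right _ _).trans htc
    refine Real.exp_le_exp.2 ?_
    nlinarith [mul_nonneg (sub_nonneg.2 ht.2) (by linarith : 0 ≤ γ + t - a)]

/-- If `g` attains its maximum over `[0, γ]` at `γ`, then `4 ≤ β g(γ)` for any solution. -/
theorem IsGSol.four_le {g : ℝ → ℝ} {β γ : ℝ} {u : ℝ → ℝ} (hu : IsGSol g β γ u)
    (hβ : 0 < β) (hγ : 0 < γ) (hg : ∀ t, 0 ≤ t → 0 < g t)
    (hmax : ∀ t ∈ Set.Icc 0 γ, g t ≤ g γ) : 4 ≤ β * g γ := by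
  obtain ⟨hsm, heq, hpos, hu1, hu0⟩ := hu
  have hanti := monotoneOn_of_radLap_le (M := 0) hsm.neg fun r hr => by
    have hp := hpos r (Ioo_subset_Ico_self hr)
    have := mul_pos (mul_pos hβ hp) (hg _ hp.le)
    rw [radLap_neg, heq r hr]
    linarith
  have hle : ∀ r ∈ Set.Ioo (0:ℝ) 1, u r ≤ γ := fun r hr => by
    have := hanti (left_mem_Icc.2 zero_le_one) (Ioo_subset_Icc_self hr) hr.1.le
    simp only [hu0] at this
    linarith
  have hmono := monotoneOn_of_radLap_le (M := β * γ * g γ) hsm fun r hr => by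
    have hp := hpos r (Ioo_subset_Ico_self hr)
    have hgr := hg _ hp.le
    rw [heq r hr]
    have h1 := hle r hr
    have h2 := hmax (u r) ⟨hp.le, h1⟩
    gcongr
  have h := hmono (left_mem_Icc.2 zero_le_one) (right_mem_Icc.2 zero_le_one) zero_le_one
  simp only [hu0, hu1] at h
  have : γ * 4 ≤ γ * (β * g γ) := by linarith
  exact le_of_mul_le_mul_left this hγ

/-- With μ_γ > 0 defined by μ_γ² β_γ γ² g(γ) = 4, we have μ_γ → 0 as
γ → +∞; equivalently β_γ γ² g(γ) → +∞. -/
theorem statement14 (a c0 : ℝ) (g : ℝ → ℝ) (hG : GCtx a c0 g)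
    (β : ℝ → ℝ) (u : ℝ → ℝ → ℝ)
    (hsol : ∀ γ : ℝ, 0 < γ → 0 < β γ ∧ IsGSol g (β γ) γ (u γ))
    (μ : ℝ → ℝ)
    (hμ : ∀ γ : ℝ, 0 < γ → 0 < μ γ ∧ (μ γ) ^ 2 * β γ * γ ^ 2 * g γ = 4) :
    Tendsto μ atTop (𝓝 0) ∧
    Tendsto (fun γ : ℝ => β γ * γ ^ 2 * g γ) atTop atTop := by
  have hlow : ∀ᶠ γ : ℝ in atTop, 4 * γ ^ 2 ≤ β γ * γ ^ 2 * g γ := by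
    filter_upwards [hG.eventually_le, eventually_gt_atTop 0] with γ hmax hγ
    have h := (hsol γ hγ).2.four_le (hsol γ hγ).1 hγ hG.2.2.2.1 hmax
    nlinarith [mul_le_mul_of_nonneg_right h (sq_nonneg γ)]
  refine ⟨?_, ?_⟩
  · refine tendsto_of_tendsto_of_tendsto_of_le_of_le' tendsto_const_nhds tendsto_inv_atTop_zero
      ?_ ?_
    · filter_upwards [eventually_gt_atTop 0] with γ hγ using (hμ γ hγ).1.le
    · filter_upwards [hlow, eventually_gt_atTop 0] with γ h hγ
      obtain ⟨hpos, heq⟩ := hμ γ hγ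
      have h1 := mul_le_mul_of_nonneg_left h (sq_nonneg (μ γ))
      have h2 : (μ γ * γ) ^ 2 ≤ 1 := by linarith
      rw [← one_div, le_div_iff₀ hγ]
      exact (sq_le_one_iff₀ (by positivity)).1 h2
  · exact tendsto_atTop_mono' _ hlow
      ((tendsto_pow_atTop two_ne_zero).const_mul_atTop (by norm_num))

end
end
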